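/- Let k: ℝ^{2n+1} → ℝ be bounded, continuous and cylindrically symmetric, k(z,t) = k̃(|z|,t) with k̃ locally Hölder continuous on (0,∞)×ℝ, such that the limit k(∞) = lim_{|(z,t)|→∞} k(z,t) exists in ℝ and k(0,t) = k(∞) for every t ∈ ℝ. Then there exists ε₀ > 0 such that for every ε with |ε| < ε₀ the equation −Δ_{ℍⁿ}u = (1+εk) u^{Q*−1} has a positive cylindrically symmetric finite-energy weak solution. -/

import Mathlib

open MeasureTheory Filter Topology

noncomputable section

/-- Points of the Heisenberg group `ℍⁿ ≅ ℝⁿ × ℝⁿ × ℝ`, written `(x, y, t)`. -/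
abbrev Pt (n : ℕ) : Type := (Fin n → ℝ) × (Fin n → ℝ) × ℝ

namespace Heis

/-- Unit vector in the `x_j` direction. -/
def ex (n : ℕ) (j : Fin n) : Pt n := (Pi.single j 1, 0, 0)

/-- Unit vector in the `y_j` direction. -/
def ey (n : ℕ) (j : Fin n) : Pt n := (0, Pi.single j 1, 0)

/-- Unit vector in the `t` direction. -/
def et (n : ℕ) : Pt n := (0, 0, 1)

/-- The left-invariant vector field `X_j u = ∂u/∂x_j + 2 y_j ∂u/∂t`. -/
def Xd (n : ℕ) (j : Fin n) (u : Pt n → ℝ) (p : Pt n) : ℝ :=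
  fderiv ℝ u p (ex n j) + 2 * p.2.1 j * fderiv ℝ u p (et n)

/-- The left-invariant vector field `Y_j u = ∂u/∂y_j - 2 x_j ∂u/∂t`. -/
def Yd (n : ℕ) (j : Fin n) (u : Pt n → ℝ) (p : Pt n) : ℝ :=
  fderiv ℝ u p (ey n j) - 2 * p.1 j * fderiv ℝ u p (et n)

/-- The Kohn Laplacian `Δ_{ℍⁿ} u = Σ_j (X_j² u + Y_j² u)`. -/
def kohn (n : ℕ) (u : Pt n → ℝ) (p : Pt n) : ℝ :=
  ∑ j, (Xd n j (Xd n j u) p + Yd n j (Yd n j u) p)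

/-- `|z|` for `p = (x, y, t)`, i.e. the Euclidean norm of `(x, y)`. -/
def znorm (n : ℕ) (p : Pt n) : ℝ :=
  Real.sqrt (∑ j, (p.1 j) ^ 2 + ∑ j, (p.2.1 j) ^ 2)

/-- Cylindrical symmetry: `u (z, t)` depends only on `(|z|, t)`. -/
def IsCyl (n : ℕ) (u : Pt n → ℝ) : Prop :=
  ∃ v : ℝ → ℝ → ℝ, ∀ p : Pt n, u p = v (znorm n p) p.2.2

/-- Homogeneous dimension `Q = 2n + 2`. -/
def Qh (n : ℕ) : ℝ := 2 * n + 2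

/-- Critical exponent `Q* = 2Q/(Q-2)`. -/
def Qs (n : ℕ) : ℝ := 2 * Qh n / (Qh n - 2)

/-- Smooth compactly supported test functions. -/
def TestFun (n : ℕ) (φ : Pt n → ℝ) : Prop :=
  ContDiff ℝ (⊤ : ℕ∞) φ ∧ HasCompactSupport φ

/-- Pointwise inner product of horizontal gradients `∇_{ℍⁿ}u · ∇_{ℍⁿ}v`. -/
def hDot (n : ℕ) (u v : Pt n → ℝ) (p : Pt n) : ℝ :=
  ∑ j, (Xd n j u p * Xd n j v p + Yd n j u p * Yd n j v p)

/-- `|∇_{ℍⁿ}u|²`. -/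
def hGradSq (n : ℕ) (u : Pt n → ℝ) (p : Pt n) : ℝ := hDot n u u p

/-- `G = (Gx, Gy)` is the weak horizontal gradient of `u`, and is in `L²`. -/
def HasWeakHGrad (n : ℕ) (u : Pt n → ℝ)
    (G : Pt n → (Fin n → ℝ) × (Fin n → ℝ)) : Prop :=
  (∀ j : Fin n, MemLp (fun p => (G p).1 j) 2 volume ∧
      MemLp (fun p => (G p).2 j) 2 volume) ∧
  ∀ φ : Pt n → ℝ, TestFun n φ → ∀ j : Fin n,
    (∫ p : Pt n, u p * Xd n j φ p = -∫ p : Pt n, (G p).1 j * φ p) ∧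
    (∫ p : Pt n, u p * Yd n j φ p = -∫ p : Pt n, (G p).2 j * φ p)

/-- `G · ∇_{ℍⁿ}φ` pointwise. -/
def gDot (n : ℕ) (G : Pt n → (Fin n → ℝ) × (Fin n → ℝ)) (φ : Pt n → ℝ)
    (p : Pt n) : ℝ :=
  ∑ j, ((G p).1 j * Xd n j φ p + (G p).2 j * Yd n j φ p)

/-- `u` is a positive cylindrically symmetric finite-energy weak solution of
`-Δ_{ℍⁿ} u = K u^{Q*-1}`. -/
def IsWeakSol (n : ℕ) (K u : Pt n → ℝ) : Prop :=
  IsCyl n u ∧ MemLp u (ENNReal.ofReal (Qs n)) volume ∧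
  (∀ᵐ p : Pt n, 0 < u p) ∧
  ∃ G : Pt n → (Fin n → ℝ) × (Fin n → ℝ), HasWeakHGrad n u G ∧
    ∀ φ : Pt n → ℝ, TestFun n φ →
      ∫ p : Pt n, gDot n G φ p = ∫ p : Pt n, K p * u p ^ (Qs n - 1) * φ p

/-- The standard bubble `U_{μ,s}`. -/
def bubble (n : ℕ) (μ s : ℝ) (p : Pt n) : ℝ :=
  μ ^ (-(Qh n - 2) / 2) *
    (((p.2.2 - s) / μ ^ 2) ^ 2 + (1 + (znorm n p) ^ 2 / μ ^ 2) ^ 2)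
      ^ (-(Qh n - 2) / 4)

/-- Local Hölder continuity of an uncurried function of two real variables on a set. -/
def LocHolderOn (f : ℝ → ℝ → ℝ) (s : Set (ℝ × ℝ)) : Prop :=
  ∀ x ∈ s, ∃ t ∈ nhdsWithin x s, ∃ C α : NNReal, 0 < α ∧
    HolderOnWith C α (fun q : ℝ × ℝ => f q.1 q.2) t

/-- `K` is cylindrically symmetric, `K(z,t) = K̃(|z|,t)`, with `K̃` locally Hölder
continuous on `(0,∞) × ℝ`. -/
def CylHolder (n : ℕ) (K : Pt n → ℝ) : Prop :=
  ∃ Kt : ℝ → ℝ → ℝ, (∀ p : Pt n, K p = Kt (znorm n p) p.2.2) ∧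
    LocHolderOn Kt (Set.Ioi 0 ×ˢ Set.univ)

/-- The standard solution `ω(z,t) = (Q-2)^{(Q-2)/2} (t² + (1+|z|²)²)^{-(Q-2)/4}`. -/
def omegaFun (n : ℕ) (p : Pt n) : ℝ :=
  (Qh n - 2) ^ ((Qh n - 2) / 2) *
    (p.2.2 ^ 2 + (1 + (znorm n p) ^ 2) ^ 2) ^ (-(Qh n - 2) / 4)

end Heis
namespace Heis

/-- The Cayley transform `F : S^{2n+1} ∖ {(0,…,0,-1)} → ℍⁿ`. -/
def cayley (n : ℕ) (ζ : Fin (n + 1) → ℂ) : Pt n :=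
  (fun j => (ζ j.castSucc / (1 + ζ (Fin.last n))).re,
   fun j => (ζ j.castSucc / (1 + ζ (Fin.last n))).im,
   (Complex.I * (1 - ζ (Fin.last n)) / (1 + ζ (Fin.last n))).re)

/-- The partial Laplacian `Δ_{x,y} k = Σ_i (∂²k/∂x_i² + ∂²k/∂y_i²)`. -/
def lapXY (n : ℕ) (k : Pt n → ℝ) (p : Pt n) : ℝ :=
  ∑ j, (fderiv ℝ (fun q => fderiv ℝ k q (ex n j)) p (ex n j)
      + fderiv ℝ (fun q => fderiv ℝ k q (ey n j)) p (ey n j))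

/-- The rescaling operator `(𝒰_{μ,s} u)(z,t) = μ^{-(Q-2)/2} u(z/μ, (t-s)/μ²)`. -/
def rescale (n : ℕ) (μ s : ℝ) (u : Pt n → ℝ) (p : Pt n) : ℝ :=
  μ ^ (-(Qh n - 2) / 2) *
    u (fun j => p.1 j / μ, fun j => p.2.1 j / μ, (p.2.2 - s) / μ ^ 2)

/-- The point `(μ z, μ² t + s)`. -/
def scalePt (n : ℕ) (μ s : ℝ) (p : Pt n) : Pt n :=
  (fun j => μ * p.1 j, fun j => μ * p.2.1 j, μ ^ 2 * p.2.2 + s)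

/-- The reduced functional `Γ(μ,s) = (1/Q*) ∫ k(μz, μ²t+s) ω^{Q*}`. -/
def Gam (n : ℕ) (k : Pt n → ℝ) (μ s : ℝ) : ℝ :=
  (1 / Qs n) * ∫ p : Pt n, k (scalePt n μ s p) * omegaFun n p ^ Qs n

/-- The Heisenberg group law
`(x,y,t) ∘ (x',y',t') = (x+x', y+y', t+t'+2x'·y-2x·y')`. -/
def heisMul (n : ℕ) (a b : Pt n) : Pt n :=
  (fun j => a.1 j + b.1 j, fun j => a.2.1 j + b.2.1 j,
   a.2.2 + b.2.2 + 2 * (∑ j, b.1 j * a.2.1 j) - 2 * (∑ j, a.1 j * b.2.1 j))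

end Heis

open Heis

set_option linter.all false
namespace HW
alias aa := mul_le_mul_of_nonneg_left
alias ab := Filter.Eventually.of_forall
alias ac := Real.norm_of_nonneg
alias af := Real.norm_eq_abs
alias ag := mul_le_mul_of_nonneg_right
alias ah := MeasureTheory.integral_const_mul
alias ai := norm_nonneg
alias aj := Complex.norm_real
alias ak := smul_eq_mul
alias al := MeasureTheory.integral_congr_ae
alias am := norm_mul
alias ao := Finset.sum_add_distrib
alias ap := Finset.mul_sum
alias aq := abs_nonneg
alias ar := ENNReal.ofReal_mul
alias au := Complex.normSq_apply
alias av := Complex.normSq_eq_norm_sq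
alias aw := MeasureTheory.Measure.volume_eq_prod
alias ax := mul_le_mul
alias ay := Pi.sub_apply
alias az := div_eq_mul_inv
alias ba := abs_add_le
alias bb := MeasureTheory.Lp.coeFn_sub
alias bc := mul_assoc
alias be := pow_le_pow_left₀
alias bg := ENNReal.ofReal_lt_top
alias bh := abs_mul
alias bi := integral_complex_ofReal
alias bj := MeasureTheory.memLp_two_iff_integrable_sq
alias bk := mul_comm
alias bl := inv_le_one_of_one_le₀
alias bm := abs_of_pos
alias bp := real_inner_self_eq_norm_sq
alias bq := le_mul_of_one_le_right
alias br := continuous_const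
alias bs := le_div_iff₀
alias bt := Submodule.subset_span
alias bu := norm_add_le
alias bw := add_le_add
alias bz := Complex.ext
alias cb := Complex.abs_re_le_norm
alias ce := Real.rpow_add
alias cf := Submodule.smul_mem
alias cg := Function.comp_def
alias ch := ENNReal.toReal_ofReal
alias ci := mul_pow
alias cm := abs_real_inner_le_norm
alias cq := Pi.smul_apply
alias cr := Finset.sum_congr
alias ct := Finset.mem_univ
alias cv := mul_le_of_le_one_right
alias cx := Submodule.span_induction
alias cy := Measurable.aestronglyMeasurable
alias cz := Finset.single_le_sum
alias da := mul_inv_cancel₀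
alias db := MeasureTheory.lintegral_const_mul
alias dd := measurable_const
alias de := ENNReal.ofReal_le_ofReal
alias df := ContinuousLinearMap.comp_apply
alias dn := real_inner_comm
alias dp := norm_sub_le
alias dq := norm_pos_iff
alias dr := inner_sub_left
alias ds := inner_smul_right
alias dx := div_le_iff₀
alias dy := Complex.sq_norm
alias dz := Complex.ofReal_mul
alias ed := sq_nonneg
alias eg := lt_of_le_of_lt
alias eh := abs_le
alias ej := Function.uncurry_def
alias ek := Finsupp.induction_linear
alias el := inner_smul_left
alias em := dist_eq_norm
alias en := Pi.add_apply
alias eo := neg_add'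
alias ep := MeasureTheory.integral_add
alias ew := le_trans
alias fk := measurable_fderiv_apply_const
alias fm := Complex.re_le_norm
alias fz := MeasureTheory.ofReal_integral_eq_lintegral_ofReal
alias ga := Real.rpow_le_rpow_of_nonpos
alias gb := MeasureTheory.lintegral_mono_ae
alias gc := Submodule.add_mem
alias gd := Real.rpow_natCast
alias gg := MeasureTheory.Lp.aestronglyMeasurable
alias gh := Complex.conj_I
alias gi := Complex.add_re
alias gj := sub_eq_zero
alias gk := inner_sub_right
alias gl := abs_of_nonneg
alias gm := Pi.zero_apply
alias gn := Nat.unpair_pair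
alias ia := mul_one
alias ii := inv_pos
alias ir := Complex.abs_im_le_norm
alias it := real_inner_smul_left
alias iu := Complex.measurable_re
alias je := mul_add
alias jw := MeasureTheory.Lp.memLp
alias ka := norm_add_le_of_le
alias kc := MeasureTheory.Measure.prod.instIsAddHaarMeasure
alias kf := min_le_right
alias kg := min_le_left
alias kh := le_of_eq
alias ki := Real.sq_sqrt
alias kj := Real.mul_rpow
alias kl := MeasureTheory.Lp.stronglyMeasurable
alias km := tendsto_one_div_add_atTop_nhds_zero_nat
alias mn := MeasureTheory.lintegral_add_left
alias mo := div_pow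
alias mp := MeasureTheory.Measure.map_apply
alias mq := ENNReal.ofReal_add
alias mr := measurable_snd
alias mt := MeasureTheory.tendsto_integral_filter_of_dominated_convergence
alias mu := div_le_div_iff₀
alias mx := Finset.sum_neg_distrib
alias my := ENNReal.ofReal_ne_top
alias mz := integral_withDensity_eq_integral_toReal_smul
alias na := integrable_rpow_neg_one_add_norm_sq
alias nt := one_mul
alias nw := mul_nonneg
alias px := MeasureTheory.tendsto_integral_of_dominated_convergence
alias py := MeasureTheory.integrable_withDensity_iff_integrable_smul'
alias pz := eq_neg_of_add_eq_zero_left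
alias qb := Set.abs_sub_left_of_mem_uIcc
alias qc := ofReal_norm_eq_enorm
alias qd := norm_ne_zero_iff
alias qe := inner_self_eq_zero
alias qf := continuous_iff_continuousAt
alias qg := Real.enorm_of_nonneg
alias qh := norm_sub_rev
alias qi := mul_self_nonneg
alias qj := mul_eq_zero
alias qk := le_abs_self
alias ql := inner_add_right
alias qm := fderiv_fun_const
alias qn := Real.rpow_mul
alias qo := RCLike.norm_conj
alias qp := MeasureTheory.MemLp.toLp_congr
alias qq := MeasureTheory.Lp.coeFn_add
alias qu := MeasureTheory.integral_map
alias qx := abs_le_of_sq_le_sq'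
alias qy := ENNReal.rpow_ne_top_of_nonneg
alias tk := sub_zero
alias tl := pow_add
alias tm := norm_neg
alias tn := mul_le_of_le_one_left
alias tp := MeasureTheory.enorm_integral_le_lintegral_enorm
alias tq := abs_sub_abs_le_abs_sub
alias tx := tendsto_nhds_unique
alias ty := tendsto_const_nhds
alias tz := InnerProductSpace.span_gramSchmidt_Iio
alias ua := MeasureTheory.lintegral_mul_const
alias ub := inv_mul_cancel₀
alias uc := Submodule.span_mono
alias ud := MeasureTheory.L2.inner_def
alias ue := Complex.ofReal_re
alias uf := Complex.mul_conj
alias ug := Complex.conj_ofReal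
variable {n : ℕ}
def zsq (p : Pt n) : ℝ := ∑ j, (p.1 j) ^ 2 + ∑ j, (p.2.1 j) ^ 2
def tau (p : Pt n) : ℂ := ⟨zsq p, -p.2.2⟩
def zc (p : Pt n) (j : Fin n) : ℂ := ⟨p.1 j, p.2.1 j⟩
def Acl (b : Fin n → ℂ) (c : ℂ) (p : Pt n) : ℂ := tau p + ∑ j, b j * zc p j + c
def AA (p : Pt n) : ℂ := 1 + tau p
def wt (p : Pt n) : ℝ := ‖AA p‖
lemma ez (p : Pt n) : 0 ≤ zsq p := by unfold zsq; positivity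
lemma iw (p : Pt n) : zsq p = ∑ j, ‖zc p j‖ ^ 2 := by
  unfold zsq
  rw [← ao]
  refine cr rfl fun j _ => ?_
  rw [← av, au]; simp [zc]; ring
lemma ml (p : Pt n) : (AA p).re = 1 + zsq p := by simp [AA, tau]
lemma tj (p : Pt n) : (AA p).im = - p.2.2 := by simp [AA, tau]
lemma lc (p : Pt n) : 1 + zsq p ≤ wt p := by
  have := fm (AA p); rwa [ml] at this
lemma bx (p : Pt n) : 1 ≤ wt p := by linarith [lc p, ez p]
lemma ad (p : Pt n) : 0 < wt p := by linarith [bx p]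
lemma nl (p : Pt n) : wt p ^ 2 = (1 + zsq p) ^ 2 + p.2.2 ^ 2 := by
  rw [wt, ← av, au, ml, tj]; ring
lemma kp (p : Pt n) : (1 + p.2.2 ^ 2) ^ (1/2 : ℝ) ≤ wt p := by
  rw [← Real.sqrt_eq_rpow]
  apply Real.sqrt_le_iff.2 ⟨(ad p).le, ?_⟩
  rw [nl]; nlinarith [ez p]
lemma pv (p : Pt n) : AA p ≠ 0 := by
  have := ad p; unfold wt at this; exact dq.1 this
lemma qw (p : Pt n) : ‖tau p‖ ≤ wt p := by
  have h1 : ‖tau p‖ ^ 2 = zsq p ^ 2 + p.2.2 ^ 2 := by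
    rw [← av, au]; simp [tau]; ring
  have := nl p
  nlinarith [ez p, ad p, ai (tau p)]
lemma ko (p : Pt n) (j : Fin n) : ‖zc p j‖ ^ 2 ≤ zsq p := by
  rw [iw]
  exact cz (f := fun j => ‖zc p j‖ ^ 2) (fun i _ => by positivity) (ct j)
lemma rb (p : Pt n) (j : Fin n) : ‖zc p j‖ ≤ wt p ^ (1/2 : ℝ) := by
  rw [← Real.sqrt_eq_rpow]
  apply Real.le_sqrt_of_sq_le
  linarith [ko p j, lc p]
@[fun_prop] lemma cont_zsq : Continuous (zsq (n := n)) := by unfold zsq; fun_prop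
@[fun_prop] lemma ot (j : Fin n) : Continuous (fun p : Pt n => zc p j) := by
  have : (fun p : Pt n => zc p j) = fun p => (p.1 j : ℂ) + (p.2.1 j : ℂ) * Complex.I := by
    ext1 p; apply bz <;> simp [zc]
  rw [this]; fun_prop
@[fun_prop] lemma mc : Continuous (tau (n := n)) := by
  have : (tau (n := n)) = fun p => (zsq p : ℂ) + ((-p.2.2 : ℝ) : ℂ) * Complex.I := by
    ext1 p; apply bz <;> simp [tau]
  rw [this]; fun_prop
@[fun_prop] lemma cont_AA : Continuous (AA (n := n)) := by unfold AA; fun_prop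
@[fun_prop] lemma bo : Continuous (wt (n := n)) := by unfold wt; fun_prop
lemma gp (x : Fin n → ℝ) : ‖x‖ ^ 2 ≤ ∑ j, x j ^ 2 := by
  have h0 : 0 ≤ ∑ j, x j ^ 2 := by positivity
  have : ‖x‖ ≤ Real.sqrt (∑ j, x j ^ 2) := by
    rw [pi_norm_le_iff_of_nonneg (by positivity)]
    intro i
    rw [af]
    apply Real.abs_le_sqrt
    exact cz (f := fun j => x j ^ 2) (fun i _ => by positivity) (ct i)
  calc ‖x‖ ^ 2 ≤ (Real.sqrt (∑ j, x j ^ 2)) ^ 2 := by gcongr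
    _ = _ := ki h0
lemma fh {s : ℝ} (hs : (n : ℝ) + 1 < s) :
    Integrable (fun p : Pt n => wt p ^ (-s)) := by
  set d := (s - n - 1) / 3 with hd
  have hd0 : 0 < d := by rw [hd]; linarith
  have e : s = (n / 2 + d) + ((n/2 + d) + (1 + d)) := by rw [hd]; ring
  have i1 : Integrable (fun x : Fin n → ℝ => ((1 : ℝ) + ‖x‖ ^ 2) ^ (-(2 * (n/2 + d)) / 2)) :=
    na (by simp; linarith)
  have i3 : Integrable (fun x : ℝ => ((1 : ℝ) + ‖x‖ ^ 2) ^ (-(1 + d) / 2)) :=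
    na (by simp; linarith)
  have i := i1.mul_prod (i1.mul_prod i3)
  refine Integrable.mono' i ?_ ?_
  · refine Continuous.aestronglyMeasurable ?_
    exact bo.rpow_const fun p => Or.inl (ad p).ne'
  · refine ab fun p => ?_
    have hw := ad p
    rw [ac (by positivity), e, neg_add (n / 2 + d), neg_add (n / 2 + d) (1 + d), ce hw (-(n / 2 + d)), ce hw (-(n / 2 + d)) (-(1 + d))]
    have hz := lc p
    have hx : 1 + ‖p.1‖ ^ 2 ≤ wt p := by
      have := gp p.1
      have h2 : 0 ≤ ∑ j, p.2.1 j ^ 2 := by positivity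
      unfold zsq at hz; linarith
    have hy : 1 + ‖p.2.1‖ ^ 2 ≤ wt p := by
      have := gp p.2.1
      have h2 : 0 ≤ ∑ j, p.1 j ^ 2 := by positivity
      unfold zsq at hz; linarith
    have ht := kp p
    have e1 : ∀ x : Fin n → ℝ, 1 + ‖x‖^2 ≤ wt p → wt p ^ (-(n / 2 + d)) ≤ (1 + ‖x‖ ^ 2) ^ (-(2 * (n/2 + d)) / 2) := by
      intro x hx
      rw [show -(2 * ((n:ℝ)/2 + d)) / 2 = -(n/2 + d) by ring]
      exact ga (by positivity) hx (by have : (0:ℝ) ≤ n := (by positivity); linarith)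
    have e3 : wt p ^ (-(1 + d)) ≤ (1 + ‖p.2.2‖ ^ 2) ^ (-(1 + d) / 2) := by
      rw [show -(1 + d) / 2 = (1/2) * (-(1+d)) by ring, qn (by positivity)]
      refine ga (by positivity) ?_ (by linarith)
      simpa using ht
    have a := e1 _ hx
    have b := e1 _ hy
    gcongr
lemma ln (g : (Fin n → ℝ) → (Fin n → ℝ) → ℝ) (hg : Measurable (Function.uncurry g)) :
    MeasurePreserving (fun p : Pt n => ((p.1, p.2.1, p.2.2 + g p.1 p.2.1) : Pt n)) volume volume := by
  refine (MeasurePreserving.id (volume : Measure (Fin n → ℝ))).skew_product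
    (μc := (volume : Measure ((Fin n → ℝ) × ℝ))) (μd := (volume : Measure ((Fin n → ℝ) × ℝ)))
    (g := fun x q => (q.1, q.2 + g x q.1)) ?_ ?_
  · have : Measurable fun q : (Fin n → ℝ) × ((Fin n → ℝ) × ℝ) => g q.1 q.2.1 :=
      hg.comp (measurable_fst.prodMk (measurable_fst.comp mr))
    simp only [ej]
    fun_prop
  · refine ab fun x => ?_
    refine ((MeasurePreserving.id (volume : Measure (Fin n → ℝ))).skew_product
      (μc := (volume : Measure ℝ)) (μd := (volume : Measure ℝ))
      (g := fun y t => t + g x y) ?_ ?_).map_eq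
    · have : Measurable fun q : (Fin n → ℝ) × ℝ => g x q.1 :=
        hg.comp (dd.prodMk measurable_fst)
      simp only [ej]
      fun_prop
    · exact ab fun y => (measurePreserving_add_right volume (g x y)).map_eq
def Xv (j : Fin n) (p : Pt n) : Pt n := ex n j + (2 * p.2.1 j) • et n
def Yv (j : Fin n) (p : Pt n) : Pt n := ey n j - (2 * p.1 j) • et n
def XC (j : Fin n) (F : Pt n → ℂ) (p : Pt n) : ℂ := fderiv ℝ F p (Xv j p)
def YC (j : Fin n) (F : Pt n → ℂ) (p : Pt n) : ℂ := fderiv ℝ F p (Yv j p)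
structure Dec (s : ℝ) (F : Pt n → ℂ) : Prop where
  diff : Differentiable ℝ F
  bd : ∃ C : ℝ, 0 ≤ C ∧ (∀ p, ‖F p‖ ≤ C * wt p ^ (-s)) ∧
    ∀ j p, ‖XC j F p‖ ≤ C * wt p ^ (-s - 1/2) ∧ ‖YC j F p‖ ≤ C * wt p ^ (-s - 1/2)
lemma fd (F : Pt n → ℂ) (j : Fin n) : Measurable (XC j F) := by
  have h : XC j F = fun p => fderiv ℝ F p (ex n j) + (2 * p.2.1 j : ℝ) • fderiv ℝ F p (et n) := by
    ext1 p; simp [XC, Xv]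
  rw [h]
  have := fk ℝ F (ex n j)
  have := fk ℝ F (et n)
  fun_prop
lemma fc (F : Pt n → ℂ) (j : Fin n) : Measurable (YC j F) := by
  have h : YC j F = fun p => fderiv ℝ F p (ey n j) - (2 * p.1 j : ℝ) • fderiv ℝ F p (et n) := by
    ext1 p; simp [YC, Yv]
  rw [h]
  have := fk ℝ F (ey n j)
  have := fk ℝ F (et n)
  fun_prop
lemma bn {F : Pt n → ℂ} {s C : ℝ} (hs : (n:ℝ) + 1 < s)
    (hm : AEStronglyMeasurable F volume) (hb : ∀ p, ‖F p‖ ≤ C * wt p ^ (-s)) : Integrable F :=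
  ((fh hs).const_mul C).mono' hm (ab hb)
lemma oe (F : Pt n → ℂ) (hF : Differentiable ℝ F) (v : Pt n) (Ψ : Pt n → Pt n)
    (hΨ : MeasurePreserving Ψ volume volume) (W : Pt n → Pt n)
    (hd : ∀ p, HasLineDerivAt ℝ Ψ (W (Ψ p)) p v)
    (hm : Measurable (fun p => fderiv ℝ F p (W p)))
    (h1 : Integrable F) (h2 : Integrable (fun p => fderiv ℝ F p (W p))) :
    ∫ p, fderiv ℝ F p (W p) = 0 := by
  have h1' : Integrable (fun p => F (Ψ p)) := (hΨ.integrable_comp h1.aestronglyMeasurable).2 h1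
  have h2' : Integrable (fun p => fderiv ℝ F (Ψ p) (W (Ψ p))) :=
    (hΨ.integrable_comp (g := fun p => fderiv ℝ F p (W p)) h2.aestronglyMeasurable).2 h2
  have i1 : Measure.IsAddHaarMeasure (volume : Measure ((Fin n → ℝ) × ℝ)) := by
    rw [aw]; infer_instance
  have i2 : Measure.IsAddHaarMeasure (volume : Measure (Pt n)) := by
    rw [aw]; exact kc _ _
  have key := integral_bilinear_hasLineDerivAt_right_eq_neg_left_of_integrable (μ := (volume : Measure (Pt n)))
    (f := fun _ : Pt n => (1 : ℝ)) (f' := fun _ => 0) (g := fun p => F (Ψ p))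
    (g' := fun p => fderiv ℝ F (Ψ p) (W (Ψ p))) (v := v) (B := ContinuousLinearMap.lsmul ℝ ℝ)
    (by simp) (by simpa using h2') (by simpa using h1') (fun x _ => by simp [HasLineDerivAt, hasDerivAt_const])
    (fun x _ => by
      have h0 : HasDerivAt (fun t : ℝ => Ψ (x + t • v)) (W (Ψ x)) 0 := hd x
      have h3 : HasFDerivAt F (fderiv ℝ F (Ψ x)) (Ψ (x + (0:ℝ) • v)) := by
        simpa using (hF (Ψ x)).hasFDerivAt
      exact h3.comp_hasDerivAt (0:ℝ) h0)
  simp only [ContinuousLinearMap.lsmul_apply, one_smul, zero_smul, integral_zero, neg_zero] at key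
  rw [← key]
  have hmap := hΨ.map_eq
  conv_lhs => rw [← hmap]
  rw [qu hΨ.measurable.aemeasurable]
  exact hm.aestronglyMeasurable
lemma fg (x : Fin n → ℝ) (j : Fin n) :
    HasDerivAt (fun t : ℝ => x + t • (Pi.single j 1 : Fin n → ℝ)) (Pi.single j 1) 0 := by
  simpa using ((hasDerivAt_id (0:ℝ)).smul_const (Pi.single j 1 : Fin n → ℝ)).const_add x
lemma Dec.integrable {s : ℝ} {F : Pt n → ℂ} (h : Dec s F) (hs : (n:ℝ) + 1 < s) : Integrable F := by
  obtain ⟨C, _, h1, _⟩ := h.bd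
  exact bn hs h.diff.continuous.aestronglyMeasurable h1
lemma Dec.integrableX {s : ℝ} {F : Pt n → ℂ} (h : Dec s F) (hs : (n:ℝ) + 1/2 < s) (j : Fin n) :
    Integrable (XC j F) := by
  obtain ⟨C, _, _, h1⟩ := h.bd
  refine bn (s := s + 1/2) (C := C) (by linarith) (fd F j).aestronglyMeasurable fun p => ?_
  rw [eo]; exact (h1 j p).1
lemma Dec.integrableY {s : ℝ} {F : Pt n → ℂ} (h : Dec s F) (hs : (n:ℝ) + 1/2 < s) (j : Fin n) :
    Integrable (YC j F) := by
  obtain ⟨C, _, _, h1⟩ := h.bd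
  refine bn (s := s + 1/2) (C := C) (by linarith) (fc F j).aestronglyMeasurable fun p => ?_
  rw [eo]; exact (h1 j p).2
lemma Dec.intX {s : ℝ} {F : Pt n → ℂ} (h : Dec s F) (hs : (n:ℝ) + 1 < s) (j : Fin n) :
    ∫ p, XC j F p = 0 := by
  refine oe F h.diff (ex n j) (fun p : Pt n => ((p.1, p.2.1, p.2.2 + 2 * p.1 j * p.2.1 j) : Pt n))
    (ln (fun x y => 2 * x j * y j) (by simp only [ej]; fun_prop)) (Xv j) ?_ (fd F j)
    (h.integrable hs) (h.integrableX (by linarith) j)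
  intro p
  unfold HasLineDerivAt
  have h1 := fg p.1 j
  have h2 : HasDerivAt (fun t : ℝ => p.2.2 + 2 * (p.1 j + t) * p.2.1 j) (2 * p.2.1 j) 0 := by
    simpa using ((((hasDerivAt_id (0:ℝ)).const_add (p.1 j)).const_mul 2).mul_const (p.2.1 j)).const_add p.2.2
  have := h1.prodMk ((hasDerivAt_const (0:ℝ) p.2.1).prodMk h2)
  convert! this using 1
  · ext t i <;> simp [ex]
  · simp [Xv, ex, et]
lemma Dec.intY {s : ℝ} {F : Pt n → ℂ} (h : Dec s F) (hs : (n:ℝ) + 1 < s) (j : Fin n) :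
    ∫ p, YC j F p = 0 := by
  refine oe F h.diff (ey n j) (fun p : Pt n => ((p.1, p.2.1, p.2.2 + (-(2 * p.1 j * p.2.1 j))) : Pt n))
    (ln (fun x y => -(2 * x j * y j)) (by simp only [ej]; fun_prop)) (Yv j) ?_ (fc F j)
    (h.integrable hs) (h.integrableY (by linarith) j)
  intro p
  unfold HasLineDerivAt
  have h1 := fg p.2.1 j
  have h2 : HasDerivAt (fun t : ℝ => p.2.2 + -(2 * p.1 j * (p.2.1 j + t))) (-(2 * p.1 j)) 0 := by
    simpa using ((((hasDerivAt_id (0:ℝ)).const_add (p.2.1 j)).const_mul (2 * p.1 j)).neg).const_add p.2.2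
  have := (hasDerivAt_const (0:ℝ) p.1).prodMk (h1.prodMk h2)
  convert! this using 1
  · ext t i <;> simp [ey]
  · simp [Yv, ey, et]
lemma Dec.mul {s r : ℝ} {F G : Pt n → ℂ} (hF : Dec s F) (hG : Dec r G) :
    Dec (s + r) (fun p => F p * G p) := by
  obtain ⟨C, hC, h1, h2⟩ := hF.bd
  obtain ⟨D, hD, k1, k2⟩ := hG.bd
  refine ⟨hF.diff.mul hG.diff, 2 * (C * D), by positivity, fun p => ?_, fun j p => ?_⟩
  · have hw := ad p
    rw [am, neg_add, ce hw]
    calc _ ≤ (C * wt p ^ (-s)) * (D * wt p ^ (-r)) := ax (h1 p) (k1 p) (ai _) (by positivity)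
      _ ≤ _ := by
        have : 0 ≤ C * D * (wt p ^ (-s) * wt p ^ (-r)) := by positivity
        linarith
  · have hw := ad p
    have e : wt p ^ (-(s + r) - 1/2) = wt p ^ (-s) * wt p ^ (-r - 1/2) := by
      rw [← ce hw]; ring_nf
    have e' : wt p ^ (-(s + r) - 1/2) = wt p ^ (-s - 1/2) * wt p ^ (-r) := by
      rw [← ce hw]; ring_nf
    have gen : ∀ v : Pt n, ‖fderiv ℝ F p v‖ ≤ C * wt p ^ (-s - 1/2) → ‖fderiv ℝ G p v‖ ≤ D * wt p ^ (-r - 1/2) →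
        ‖fderiv ℝ (fun p => F p * G p) p v‖ ≤ 2 * (C * D) * wt p ^ (-(s + r) - 1/2) := by
      intro v a b
      rw [fderiv_fun_mul (hF.diff p) (hG.diff p)]
      simp only [add_apply, smul_apply, ak]
      calc _ ≤ ‖F p‖ * ‖fderiv ℝ G p v‖ + ‖G p‖ * ‖fderiv ℝ F p v‖ := by
            refine (bu _ _).trans ?_
            rw [am, am]
        _ ≤ (C * wt p ^ (-s)) * (D * wt p ^ (-r - 1/2)) + (D * wt p ^ (-r)) * (C * wt p ^ (-s - 1/2)) := by
            gcongr
            · exact h1 p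
            · exact k1 p
        _ = C * D * (wt p ^ (-s) * wt p ^ (-r - 1/2)) + C * D * (wt p ^ (-s - 1/2) * wt p ^ (-r)) := by ring
        _ = _ := by rw [← e, ← e']; ring
    exact ⟨gen _ (h2 j p).1 (k2 j p).1, gen _ (h2 j p).2 (k2 j p).2⟩
lemma Dec.add {s : ℝ} {F G : Pt n → ℂ} (hF : Dec s F) (hG : Dec s G) :
    Dec s (fun p => F p + G p) := by
  obtain ⟨C, hC, h1, h2⟩ := hF.bd
  obtain ⟨D, hD, k1, k2⟩ := hG.bd
  refine ⟨hF.diff.add hG.diff, C + D, by positivity, fun p => ?_, fun j p => ?_⟩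
  · rw [add_mul]; exact ka (h1 p) (k1 p)
  · simp only [XC, YC, fderiv_fun_add (hF.diff p) (hG.diff p), add_apply, add_mul]
    exact ⟨ka (h2 j p).1 (k2 j p).1, ka (h2 j p).2 (k2 j p).2⟩
lemma Dec.const (c : ℂ) : Dec 0 (fun _ : Pt n => c) := by
  refine ⟨differentiable_const c, ‖c‖, ai c, by simp, fun j p => ?_⟩
  have := ad p
  simp [XC, YC, qm]; positivity
lemma Dec.smul {s : ℝ} {F : Pt n → ℂ} (hF : Dec s F) (c : ℂ) : Dec s (fun p => c * F p) := by
  simpa using (Dec.const c).mul hF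
lemma Dec.sum {ι : Type*} {s : ℝ} (t : Finset ι) (F : ι → Pt n → ℂ) (h : ∀ i ∈ t, Dec s (F i)) :
    Dec s (fun p => ∑ i ∈ t, F i p) := by
  classical
  induction t using Finset.induction_on with
  | empty =>
    refine ⟨by simp, 0, le_rfl, by simp, fun j p => by simp [XC, YC, qm]⟩
  | insert a t ha ih =>
    simp only [Finset.sum_insert ha]
    exact (h a (by simp)).add (ih fun i hi => h i (by simp [hi]))
lemma Dec.mono {s r : ℝ} {F : Pt n → ℂ} (hF : Dec s F) (h : r ≤ s) : Dec r F := by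
  obtain ⟨C, hC, h1, h2⟩ := hF.bd
  refine ⟨hF.diff, C, hC, fun p => (h1 p).trans ?_, fun j p => ⟨(h2 j p).1.trans ?_, (h2 j p).2.trans ?_⟩⟩ <;>
  · gcongr
    exact bx p
lemma jt {F G : Pt n → ℂ} (hF : Differentiable ℝ F) (hG : Differentiable ℝ G) (j : Fin n) (p : Pt n) :
    XC j (fun p => F p * G p) p = F p * XC j G p + XC j F p * G p := by
  simp only [XC, fderiv_fun_mul (hF p) (hG p)]; simp [bk]
lemma jq {F G : Pt n → ℂ} (hF : Differentiable ℝ F) (hG : Differentiable ℝ G) (j : Fin n) (p : Pt n) :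
    YC j (fun p => F p * G p) p = F p * YC j G p + YC j F p * G p := by
  simp only [YC, fderiv_fun_mul (hF p) (hG p)]; simp [bk]
lemma oy {F G : Pt n → ℂ} (hF : Differentiable ℝ F) (hG : Differentiable ℝ G) (j : Fin n) (p : Pt n) :
    XC j (fun p => F p + G p) p = XC j F p + XC j G p := by
  simp only [XC, fderiv_fun_add (hF p) (hG p)]; simp
lemma ox {F G : Pt n → ℂ} (hF : Differentiable ℝ F) (hG : Differentiable ℝ G) (j : Fin n) (p : Pt n) :
    YC j (fun p => F p + G p) p = YC j F p + YC j G p := by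
  simp only [YC, fderiv_fun_add (hF p) (hG p)]; simp
lemma jr {F : Pt n → ℂ} (hF : Differentiable ℝ F) (c : ℂ) (j : Fin n) (p : Pt n) :
    XC j (fun p => c * F p) p = c * XC j F p := by
  rw [jt (differentiable_const c) hF]; simp [XC, qm]
lemma jp {F : Pt n → ℂ} (hF : Differentiable ℝ F) (c : ℂ) (j : Fin n) (p : Pt n) :
    YC j (fun p => c * F p) p = c * YC j F p := by
  rw [jq (differentiable_const c) hF]; simp [YC, qm]
lemma Dec.integrable_mulX {s r : ℝ} {F G : Pt n → ℂ} (hF : Dec s F) (hG : Dec r G) (h : (n:ℝ) + 1/2 < s + r)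
    (j : Fin n) : Integrable (fun p => F p * XC j G p) := by
  obtain ⟨C, hC, h1, h2⟩ := hF.bd
  obtain ⟨D, hD, k1, k2⟩ := hG.bd
  refine bn (s := s + r + 1/2) (C := C * D) (by linarith)
    (hF.diff.continuous.aestronglyMeasurable.mul (fd G j).aestronglyMeasurable) fun p => ?_
  have hw := ad p
  rw [am, show -(s + r + 1/2) = -s + (-r - 1/2) by ring, ce hw]
  calc _ ≤ (C * wt p ^ (-s)) * (D * wt p ^ (-r - 1/2)) :=
        ax (h1 p) (k2 j p).1 (ai _) (by positivity)
    _ = _ := by ring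
lemma Dec.integrable_mulY {s r : ℝ} {F G : Pt n → ℂ} (hF : Dec s F) (hG : Dec r G) (h : (n:ℝ) + 1/2 < s + r)
    (j : Fin n) : Integrable (fun p => F p * YC j G p) := by
  obtain ⟨C, hC, h1, h2⟩ := hF.bd
  obtain ⟨D, hD, k1, k2⟩ := hG.bd
  refine bn (s := s + r + 1/2) (C := C * D) (by linarith)
    (hF.diff.continuous.aestronglyMeasurable.mul (fc G j).aestronglyMeasurable) fun p => ?_
  have hw := ad p
  rw [am, show -(s + r + 1/2) = -s + (-r - 1/2) by ring, ce hw]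
  calc _ ≤ (C * wt p ^ (-s)) * (D * wt p ^ (-r - 1/2)) :=
        ax (h1 p) (k2 j p).2 (ai _) (by positivity)
    _ = _ := by ring
lemma ibpX {s r : ℝ} {F G : Pt n → ℂ} (hF : Dec s F) (hG : Dec r G) (h : (n:ℝ) + 1 < s + r)
    (j : Fin n) : ∫ p, F p * XC j G p = - ∫ p, XC j F p * G p := by
  have h0 := (hF.mul hG).intX h j
  simp only [jt hF.diff hG.diff] at h0
  have i2 : Integrable (fun p => XC j F p * G p) := by
    simpa [bk] using hG.integrable_mulX hF (by linarith) j
  rw [ep (hF.integrable_mulX hG (by linarith) j) i2] at h0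
  exact pz h0
lemma ibpY {s r : ℝ} {F G : Pt n → ℂ} (hF : Dec s F) (hG : Dec r G) (h : (n:ℝ) + 1 < s + r)
    (j : Fin n) : ∫ p, F p * YC j G p = - ∫ p, YC j F p * G p := by
  have h0 := (hF.mul hG).intY h j
  simp only [jq hF.diff hG.diff] at h0
  have i2 : Integrable (fun p => YC j F p * G p) := by
    simpa [bk] using hG.integrable_mulY hF (by linarith) j
  rw [ep (hF.integrable_mulY hG (by linarith) j) i2] at h0
  exact pz h0
end HW
namespace HW
open scoped ComplexConjugate
variable {n : ℕ}
def zL (j : Fin n) : Pt n →L[ℝ] ℂ :=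
  Complex.ofRealCLM.comp ((ContinuousLinearMap.proj j).comp (ContinuousLinearMap.fst ℝ _ _)) +
  Complex.I • Complex.ofRealCLM.comp ((ContinuousLinearMap.proj j).comp
    ((ContinuousLinearMap.fst ℝ _ _).comp (ContinuousLinearMap.snd ℝ _ _)))
lemma ec (j : Fin n) (p : Pt n) : zL j p = zc p j := by
  apply bz <;> simp [zL, zc]
def tL : Pt n →L[ℝ] ℂ :=
  Complex.ofRealCLM.comp ((ContinuousLinearMap.snd ℝ _ _).comp (ContinuousLinearMap.snd ℝ _ _))
lemma lh (p : Pt n) : tL p = (p.2.2 : ℂ) := by simp [tL]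
def cL : ℂ →L[ℝ] ℂ := Complex.conjCLE.toContinuousLinearMap
lemma ck (z : ℂ) : cL z = conj z := rfl
lemma lg (p : Pt n) : tau p = ∑ j, zc p j * conj (zc p j) - Complex.I * p.2.2 := by
  apply bz
  · simp [tau, zsq, zc, ← ao, pow_two]
  · simp [tau, zc, bk]
def dA (b : Fin n → ℂ) (p : Pt n) : Pt n →L[ℝ] ℂ :=
  ∑ j, ((conj (zc p j) + b j) • zL j + zc p j • (cL.comp (zL j))) - Complex.I • tL
lemma ng (b : Fin n → ℂ) (c : ℂ) (p : Pt n) : HasFDerivAt (Acl b c) (dA b p) p := by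
  have e : Acl b c = fun p => (∑ j, (zL j p * cL (zL j p) + b j * zL j p)) - Complex.I * tL p + c := by
    ext1 p
    simp only [Acl, lg, ec, ck, lh, ao]; ring
  rw [e]
  have h1 : ∀ j, HasFDerivAt (fun p : Pt n => zL j p * cL (zL j p) + b j * zL j p)
      ((conj (zc p j) + b j) • zL j + zc p j • (cL.comp (zL j))) p := by
    intro j
    have a := (zL j).hasFDerivAt (x := p)
    have b' := (cL.comp (zL j)).hasFDerivAt (x := p)
    have := (a.mul b').add (a.const_mul (b j))
    refine this.congr_fderiv ?_
    ext v <;> simp [ec, ck] <;> ring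
  have h2 := HasFDerivAt.fun_sum (u := Finset.univ) fun j _ => h1 j
  have h3 := ((tL (n := n)).hasFDerivAt (x := p)).const_mul Complex.I
  exact (h2.sub h3).add_const c
def ell (b : Fin n → ℂ) (j : Fin n) (p : Pt n) : ℂ := 2 * conj (zc p j) + b j
lemma la (i j : Fin n) (p : Pt n) : zc (Xv j p) i = if i = j then 1 else 0 := by
  apply bz <;> by_cases h : i = j <;> simp [zc, Xv, ex, et, Pi.single_apply, h]
lemma kz (i j : Fin n) (p : Pt n) : zc (Yv j p) i = if i = j then Complex.I else 0 := by
  apply bz <;> by_cases h : i = j <;> simp [zc, Yv, ey, et, Pi.single_apply, h]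
lemma go (p : Pt n) (j : Fin n) : zc p j = p.1 j + p.2.1 j * Complex.I := by
  apply bz <;> simp [zc]
lemma rc (p : Pt n) (j : Fin n) : conj (zc p j) = p.1 j - p.2.1 j * Complex.I := by
  apply bz <;> simp [zc]
lemma st (b : Fin n → ℂ) (j : Fin n) (p : Pt n) : dA b p (Xv j p) = ell b j p := by
  simp only [dA, sub_apply, sum_apply, add_apply,
    smul_apply, df, ec, la, ck, lh]
  simp only [apply_ite conj, map_one, map_zero, smul_ite, smul_zero, ak, ia]
  rw [ao]
  simp only [mul_ite, ia, mul_zero, Finset.sum_ite_eq', ct, if_true]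
  have : ((Xv j p).2.2 : ℂ) = 2 * p.2.1 j := by simp [Xv, ex, et]
  rw [this, ell, go]
  simp
  ring_nf
lemma ss (b : Fin n → ℂ) (j : Fin n) (p : Pt n) : dA b p (Yv j p) = Complex.I * ell b j p := by
  simp only [dA, sub_apply, sum_apply, add_apply,
    smul_apply, df, ec, kz, ck, lh]
  simp only [apply_ite conj, gh, map_zero, smul_ite, smul_zero, ak]
  rw [ao]
  simp only [mul_ite, ia, mul_zero, Finset.sum_ite_eq', ct, if_true]
  have : ((Yv j p).2.2 : ℂ) = - (2 * p.1 j) := by simp [Yv, ey, et]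
  rw [this, ell, rc, go]
  ring_nf
def Good (b : Fin n → ℂ) (c : ℂ) : Prop := ∑ j, ‖b j‖ ^ 2 < 4 * c.re
def disc (b : Fin n → ℂ) (c : ℂ) : ℝ := 4 * c.re - ∑ j, ‖b j‖ ^ 2
lemma sl (b : Fin n → ℂ) (j : Fin n) (p : Pt n) :
    ‖ell b j p‖ ^ 2 = 4 * ‖zc p j‖ ^ 2 + 4 * (b j * zc p j).re + ‖b j‖ ^ 2 := by
  simp only [ell, ← av, au]
  simp; ring
lemma jl (b : Fin n → ℂ) (c : ℂ) (p : Pt n) :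
    ∑ j, ‖ell b j p‖ ^ 2 = 4 * (Acl b c p).re - disc b c := by
  simp only [sl, ao, ← ap, ← iw, Acl, gi, disc,
    Complex.re_sum]
  simp [tau]; ring
lemma eu (b : Fin n → ℂ) (c : ℂ) (p : Pt n) : disc b c / 4 ≤ (Acl b c p).re := by
  have := jl b c p
  have h : 0 ≤ ∑ j, ‖ell b j p‖ ^ 2 := by positivity
  linarith
lemma Good.disc_pos {b : Fin n → ℂ} {c : ℂ} (h : Good b c) : 0 < disc b c := by
  unfold Good at h; unfold disc; linarith
lemma Good.re_pos {b : Fin n → ℂ} {c : ℂ} (h : Good b c) (p : Pt n) : 0 < (Acl b c p).re := by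
  linarith [eu b c p, h.disc_pos]
lemma Good.slit {b : Fin n → ℂ} {c : ℂ} (h : Good b c) (p : Pt n) : Acl b c p ∈ Complex.slitPlane :=
  Or.inl (h.re_pos p)
lemma Good.ne {b : Fin n → ℂ} {c : ℂ} (h : Good b c) (p : Pt n) : Acl b c p ≠ 0 :=
  Complex.slitPlane_ne_zero (h.slit p)
lemma Good.lower {b : Fin n → ℂ} {c : ℂ} (h : Good b c) :
    ∃ κ : ℝ, 0 < κ ∧ ∀ p, κ * wt p ≤ ‖Acl b c p‖ := by
  set d := disc b c
  have hd : 0 < d := h.disc_pos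
  set S := ∑ j, ‖b j‖ ^ 2 with hS
  have hS0 : 0 ≤ S := by positivity
  refine ⟨(3 + 4 * (2 * S + ‖c - 1‖) / d)⁻¹, by positivity, fun p => ?_⟩
  rw [inv_mul_le_iff₀ (by positivity)]
  have hA : AA p = Acl b c p - ∑ j, b j * zc p j - (c - 1) := by simp [AA, Acl]; ring
  have h1 : wt p ≤ ‖Acl b c p‖ + ‖∑ j, b j * zc p j‖ + ‖c - 1‖ := by
    rw [wt, hA]
    exact (dp _ _).trans (by gcongr; exact dp _ _)
  have h2 : ‖∑ j, b j * zc p j‖ ≤ ∑ j, (2 * ‖b j‖ ^ 2 + ‖ell b j p‖ ^ 2 / 2) := by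
    refine norm_sum_le_of_le _ fun j _ => ?_
    rw [am]
    have : 2 * ‖zc p j‖ ≤ ‖ell b j p‖ + ‖b j‖ := by
      have : 2 * conj (zc p j) = ell b j p - b j := by simp [ell]
      have h3 : ‖2 * conj (zc p j)‖ = 2 * ‖zc p j‖ := by simp
      rw [← h3, this]; exact dp _ _
    nlinarith [ai (b j), ed (‖b j‖ - ‖ell b j p‖), ai (zc p j), ed (‖b j‖)]
  have h3 : ∑ j, (2 * ‖b j‖ ^ 2 + ‖ell b j p‖ ^ 2 / 2) ≤ 2 * S + 2 * ‖Acl b c p‖ := by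
    rw [ao, ← ap, ← Finset.sum_div, jl b c p]
    have := fm (Acl b c p)
    linarith
  have h4 : 2 * S + ‖c - 1‖ ≤ (4 * (2 * S + ‖c - 1‖) / d) * ‖Acl b c p‖ := by
    have := eu b c p
    have h5 := fm (Acl b c p)
    have h6 : 1 ≤ 4 / d * ‖Acl b c p‖ := by
      rw [div_mul_eq_mul_div, bs hd]; linarith
    have h7 : 0 ≤ 2 * S + ‖c - 1‖ := by positivity
    calc _ ≤ (2 * S + ‖c - 1‖) * (4 / d * ‖Acl b c p‖) := bq h7 h6
      _ = _ := by ring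
  linarith
def VV (b : Fin n → ℂ) (c : ℂ) (α β : ℝ) (p : Pt n) : ℂ :=
  (Acl b c p) ^ (-(α : ℂ)) * conj ((Acl b c p) ^ (-(β : ℂ)))
lemma pa {b : Fin n → ℂ} {c : ℂ} (h : Good b c) (α β : ℝ) (p : Pt n) :
    ‖VV b c α β p‖ = ‖Acl b c p‖ ^ (-(α + β)) := by
  have hp : 0 < ‖Acl b c p‖ := dq.2 (h.ne p)
  have e : ∀ a : ℝ, ‖(Acl b c p) ^ (-(a : ℂ))‖ = ‖Acl b c p‖ ^ (-a) := by
    intro a; rw [← Complex.ofReal_neg, Complex.norm_cpow_real]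
  rw [VV, am, qo, e, e, ← ce hp, neg_add]
lemma pc {b : Fin n → ℂ} {c : ℂ} (α β : ℝ) (p : Pt n) :
    conj (VV b c α β p) = VV b c β α p := by
  simp [VV, bk]
lemma me {b : Fin n → ℂ} {c : ℂ} (h : Good b c) (α β : ℝ) (p : Pt n) :
    VV b c α β p = VV b c (α + 1) β p * Acl b c p := by
  have : (Acl b c p) ^ (-(α : ℂ)) = (Acl b c p) ^ (-((α + 1 : ℝ) : ℂ)) * Acl b c p := by
    have h1 := Complex.cpow_add (-((α + 1 : ℝ) : ℂ)) 1 (h.ne p)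
    rw [Complex.cpow_one] at h1
    rw [← h1]
    congr 1; push_cast; ring
  rw [VV, VV, this]; ring
lemma oz {b : Fin n → ℂ} {c : ℂ} (h : Good b c) (α β : ℝ) (p : Pt n) :
    VV b c α β p = VV b c α (β + 1) p * conj (Acl b c p) := by
  rw [← pc, me h, map_mul, pc]
lemma dk {b : Fin n → ℂ} {c : ℂ} (h : Good b c) (α β : ℝ) (p : Pt n) :
    HasFDerivAt (VV b c α β)
      ((-(α:ℂ) * VV b c (α + 1) β p) • dA b p + (-(β:ℂ) * VV b c α (β + 1) p) • (cL.comp (dA b p))) p := by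
  have hd := ng b c p
  have e : ∀ a : ℝ, HasFDerivAt (fun q => (Acl b c q) ^ (-(a : ℂ)))
      ((-(a:ℂ) * (Acl b c p) ^ (-((a + 1 : ℝ) : ℂ))) • dA b p) p := by
    intro a
    have h1 := (Complex.hasStrictDerivAt_cpow_const (c := -(a:ℂ)) (h.slit p)).hasDerivAt
    have h2 := h1.hasFDerivAt.restrictScalars ℝ
    refine (h2.comp p hd).congr_fderiv ?_
    ext v <;> simp [sub_eq_add_neg, bk, mul_left_comm, add_comm]
  have h3 := (cL.hasFDerivAt (x := (Acl b c p) ^ (-(β : ℂ)))).comp p (e β)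
  refine ((e α).mul h3).congr_fderiv ?_
  ext v <;> simp [VV, ck] <;> ring
lemma il {b : Fin n → ℂ} {c : ℂ} (h : Good b c) (α β : ℝ) (j : Fin n) (p : Pt n) :
    XC j (VV b c α β) p = -α * (VV b c (α + 1) β p * ell b j p)
      + -β * (VV b c α (β + 1) p * conj (ell b j p)) := by
  rw [XC, (dk h α β p).fderiv]
  simp only [add_apply, smul_apply, df, ck, st, ak]
  ring
lemma ik {b : Fin n → ℂ} {c : ℂ} (h : Good b c) (α β : ℝ) (j : Fin n) (p : Pt n) :
    YC j (VV b c α β) p = -(Complex.I * α) * (VV b c (α + 1) β p * ell b j p)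
      + (Complex.I * β) * (VV b c α (β + 1) p * conj (ell b j p)) := by
  rw [YC, (dk h α β p).fderiv]
  simp only [add_apply, smul_apply, df, ck, ss, ak,
    map_mul, gh]
  ring
lemma om (b : Fin n → ℂ) (j : Fin n) (p : Pt n) : ‖ell b j p‖ ≤ (2 + ‖b j‖) * wt p ^ (1/2 : ℝ) := by
  have h1 := rb p j
  have h2 : 1 ≤ wt p ^ (1/2:ℝ) := Real.one_le_rpow (bx p) (by norm_num)
  calc ‖ell b j p‖ ≤ ‖2 * conj (zc p j)‖ + ‖b j‖ := bu _ _
    _ = 2 * ‖zc p j‖ + ‖b j‖ := by simp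
    _ ≤ 2 * wt p ^ (1/2:ℝ) + ‖b j‖ * wt p ^ (1/2:ℝ) := by
      gcongr; exact bq (ai _) h2
    _ = _ := by ring
lemma pb {b : Fin n → ℂ} {c : ℂ} (h : Good b c) (s : ℝ) (hs : 0 ≤ s) :
    ∃ C : ℝ, 0 ≤ C ∧ ∀ α β p, α + β = s → ‖VV b c α β p‖ ≤ C * wt p ^ (-s) := by
  obtain ⟨κ, hκ, hl⟩ := h.lower
  refine ⟨κ ^ (-s), by positivity, fun α β p e => ?_⟩
  have hw := ad p
  rw [pa h, e, ← kj hκ.le hw.le]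
  exact ga (by positivity) (hl p) (by linarith)
lemma ff {b : Fin n → ℂ} {c : ℂ} (h : Good b c) {α β s : ℝ} (e : α + β = s) (hs : 0 ≤ s) :
    Dec s (VV b c α β) := by
  obtain ⟨C, hC, h1⟩ := pb h s hs
  obtain ⟨D, hD, h2⟩ := pb h (s + 1) (by linarith)
  set B := ∑ j, ‖b j‖
  have hB : ∀ j, ‖b j‖ ≤ B := fun j =>
    cz (f := fun j => ‖b j‖) (fun i _ => ai _) (ct j)
  have hB0 : 0 ≤ B := Finset.sum_nonneg fun i _ => ai _
  refine ⟨fun p => (dk h α β p).differentiableAt, C + (|α| + |β|) * (D * (2 + B)), by positivity,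
    fun p => (h1 α β p e).trans ?_, fun j p => ?_⟩
  · have := ad p
    gcongr
    have : 0 ≤ (|α| + |β|) * (D * (2 + B)) := by positivity
    linarith
  · have hw := ad p
    have e' : wt p ^ (-s - 1/2) = wt p ^ (-(s+1)) * wt p ^ (1/2:ℝ) := by
      rw [← ce hw]; ring_nf
    have hl : ‖ell b j p‖ ≤ (2 + B) * wt p ^ (1/2:ℝ) := (om b j p).trans (by gcongr; exact hB j)
    have a1 : ‖VV b c (α + 1) β p‖ * ‖ell b j p‖ ≤ D * (2 + B) * wt p ^ (-s - 1/2) := by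
      rw [e']
      calc _ ≤ (D * wt p ^ (-(s+1))) * ((2 + B) * wt p ^ (1/2:ℝ)) := by
            gcongr; exact h2 _ _ p (by linarith)
        _ = _ := by ring
    have a2 : ‖VV b c α (β + 1) p‖ * ‖ell b j p‖ ≤ D * (2 + B) * wt p ^ (-s - 1/2) := by
      rw [e']
      calc _ ≤ (D * wt p ^ (-(s+1))) * ((2 + B) * wt p ^ (1/2:ℝ)) := by
            gcongr; exact h2 _ _ p (by linarith)
        _ = _ := by ring
    have a3 : |α| * (‖VV b c (α + 1) β p‖ * ‖ell b j p‖) + |β| * (‖VV b c α (β + 1) p‖ * ‖ell b j p‖)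
        ≤ (C + (|α| + |β|) * (D * (2 + B))) * wt p ^ (-s - 1/2) := by
      have b1 := aa a1 (aq α)
      have b2 := aa a2 (aq β)
      have b3 : 0 ≤ C * wt p ^ (-s - 1/2) := by positivity
      nlinarith
    constructor
    · rw [il h]
      refine (bu _ _).trans (ew (kh ?_) a3)
      simp [am]
    · rw [ik h]
      refine (bu _ _).trans (ew (kh ?_) a3)
      simp [am]
lemma fj (b : Fin n → ℂ) (j : Fin n) (p : Pt n) :
    HasFDerivAt (ell b j) ((2:ℂ) • cL.comp (zL j)) p := by
  have : ell b j = fun p => 2 * (cL.comp (zL j)) p + b j := by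
    ext1 p; simp [ell, ec, ck]
  rw [this]
  exact ((cL.comp (zL j)).hasFDerivAt.const_mul 2).add_const _
lemma sn (b : Fin n → ℂ) (j : Fin n) (p : Pt n) : XC j (ell b j) p = 2 := by
  rw [XC, (fj b j p).fderiv]; simp [ec, ck, la]
lemma sm (b : Fin n → ℂ) (j : Fin n) (p : Pt n) : YC j (ell b j) p = -2 * Complex.I := by
  rw [YC, (fj b j p).fderiv]; simp [ec, ck, kz]
lemma ov {F : Pt n → ℂ} (hF : Differentiable ℝ F) (j : Fin n) (p : Pt n) :
    XC j (fun p => conj (F p)) p = conj (XC j F p) := by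
  have := (cL.hasFDerivAt (x := F p)).comp p (hF p).hasFDerivAt
  rw [XC, show (fun p => conj (F p)) = cL ∘ F from rfl, this.fderiv]; simp [ck, XC]
lemma ou {F : Pt n → ℂ} (hF : Differentiable ℝ F) (j : Fin n) (p : Pt n) :
    YC j (fun p => conj (F p)) p = conj (YC j F p) := by
  have := (cL.hasFDerivAt (x := F p)).comp p (hF p).hasFDerivAt
  rw [YC, show (fun p => conj (F p)) = cL ∘ F from rfl, this.fderiv]; simp [ck, YC]
lemma Dec.conj {s : ℝ} {F : Pt n → ℂ} (hF : Dec s F) : Dec s (fun p => conj (F p)) := by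
  obtain ⟨C, hC, h1, h2⟩ := hF.bd
  refine ⟨cL.differentiable.comp hF.diff, C, hC, by simpa using h1, fun j p => ?_⟩
  rw [ov hF.diff, ou hF.diff]; simpa using h2 j p
lemma fv (b : Fin n → ℂ) (j : Fin n) : Dec (-(1/2)) (ell b j) := by
  refine ⟨fun p => (fj b j p).differentiableAt, 2 + ‖b j‖, by positivity, fun p => ?_, fun i p => ?_⟩
  · simpa using om b j p
  · rw [XC, YC, (fj b j p).fderiv]
    by_cases h : j = i <;> simp [ec, ck, la, kz, h] <;> positivity
lemma ky {b : Fin n → ℂ} {c : ℂ} (h : Good b c) {α β s : ℝ} (e : α + β + 1/2 = s) (hs : 0 ≤ α + β)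
    (j : Fin n) : Dec s (XC j (VV b c α β)) := by
  have : XC j (VV b c α β) = _ := funext fun p => il h α β j p
  rw [this]
  refine Dec.add (Dec.smul ?_ _) (Dec.smul ?_ _)
  · have := (ff h (α := α + 1) (β := β) (s := s + 1/2) (by linarith) (by linarith)).mul (fv b j)
    simpa using this
  · have := (ff h (α := α) (β := β + 1) (s := s + 1/2) (by linarith) (by linarith)).mul (fv b j).conj
    simpa using this
lemma kx {b : Fin n → ℂ} {c : ℂ} (h : Good b c) {α β s : ℝ} (e : α + β + 1/2 = s) (hs : 0 ≤ α + β)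
    (j : Fin n) : Dec s (YC j (VV b c α β)) := by
  have : YC j (VV b c α β) = _ := funext fun p => ik h α β j p
  rw [this]
  refine Dec.add (Dec.smul ?_ _) (Dec.smul ?_ _)
  · have := (ff h (α := α + 1) (β := β) (s := s + 1/2) (by linarith) (by linarith)).mul (fv b j)
    simpa using this
  · have := (ff h (α := α) (β := β + 1) (s := s + 1/2) (by linarith) (by linarith)).mul (fv b j).conj
    simpa using this
def LapC (F : Pt n → ℂ) (p : Pt n) : ℂ := ∑ j, (XC j (XC j F) p + YC j (YC j F) p)
lemma pd {b : Fin n → ℂ} {c : ℂ} (h : Good b c) {α β : ℝ} (p : Pt n) :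
    LapC (VV b c α β) p = VV b c (α+1) (β+1) p * (-4 * n * α * conj (Acl b c p) - 4 * n * β * Acl b c p
      + 4 * α * β * ((4 * (Acl b c p).re - disc b c : ℝ) : ℂ)) := by
  have dV : ∀ a b', Differentiable ℝ (VV b c a b') := fun a b' p => (dk h a b' p).differentiableAt
  have dl : ∀ j, Differentiable ℝ (ell b j) := fun j => (fv b j).diff
  have dc : ∀ j, Differentiable ℝ (fun p => conj (ell b j p)) := fun j => (fv b j).conj.diff
  have key : ∀ j, XC j (XC j (VV b c α β)) p + YC j (YC j (VV b c α β)) p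
      = -4 * α * VV b c (α+1) β p - 4 * β * VV b c α (β+1) p
        + 4 * α * β * VV b c (α+1) (β+1) p * ((‖ell b j p‖ ^ 2 : ℝ) : ℂ) := by
    intro j
    have e1 : XC j (VV b c α β) = _ := funext fun p => il h α β j p
    have e2 : YC j (VV b c α β) = _ := funext fun p => ik h α β j p
    have d1 : Differentiable ℝ (fun p => VV b c (α + 1) β p * ell b j p) := (dV _ _).mul (dl j)
    have d2 : Differentiable ℝ (fun p => VV b c α (β + 1) p * conj (ell b j p)) := (dV _ _).mul (dc j)
    rw [e1, e2, oy (d1.const_mul _) (d2.const_mul _), ox (d1.const_mul _) (d2.const_mul _),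
      jr d1, jr d2, jp d1, jp d2, jt (dV _ _) (dl j), jt (dV _ _) (dc j),
      jq (dV _ _) (dl j), jq (dV _ _) (dc j), ov (dl j), ou (dl j), sn, sm,
      il h, il h, ik h, ik h]
    have e3 : ((‖ell b j p‖ ^ 2 : ℝ) : ℂ) = ell b j p * conj (ell b j p) := by
      rw [uf, av]
    rw [e3]
    simp only [map_mul, map_neg, gh, Complex.conj_ofNat]
    push_cast
    ring_nf
    simp only [Complex.I_sq]
    ring
  unfold LapC
  simp only [key]
  rw [ao, ← ap, ← Complex.ofReal_sum, jl b c p, Finset.sum_const,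
    Finset.card_univ, Fintype.card_fin, oz h (α+1) β, me h α (β+1)]
  simp only [nsmul_eq_mul]
  ring
end HW
namespace HW
open scoped ComplexConjugate
variable {n : ℕ}
lemma rpn (x : ℝ) (hx : 0 ≤ x) (k : ℕ) : x ^ (-(k:ℝ)) = (x ^ k)⁻¹ := by
  rw [Real.rpow_neg hx, gd]
lemma fx {b : Fin n → ℂ} {c : ℂ} (h : Good b c) (α : ℝ) (k : ℕ) (hk : 2 * α = k) (p : Pt n) :
    VV b c α α p = (((‖Acl b c p‖ ^ k)⁻¹ : ℝ) : ℂ) := by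
  have h1 := pa h α α p
  rw [← two_mul, hk, rpn _ (ai _)] at h1
  rw [← h1, VV, uf, aj, ac (Complex.normSq_nonneg _)]
lemma lx {b : Fin n → ℂ} {c : ℂ} (h : Good b c) {α β s : ℝ} {F : Pt n → ℂ} (hF : Dec s F)
    (hr : 0 ≤ α + β) (hs : (n:ℝ) + 1/2 < s + (α + β)) :
    ∫ p, F p * LapC (VV b c α β) p
      = - ∫ p, ∑ j, (XC j F p * XC j (VV b c α β) p + YC j F p * YC j (VV b c α β) p) := by
  have dX := fun j => ky h (α := α) (β := β) rfl hr j
  have dY := fun j => kx h (α := α) (β := β) rfl hr j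
  have iX := fun j => hF.integrable_mulX (dX j) (by linarith) j
  have iY := fun j => hF.integrable_mulY (dY j) (by linarith) j
  have jX : ∀ j, Integrable (fun p => XC j F p * XC j (VV b c α β) p) := fun j => by
    simpa [bk] using (dX j).integrable_mulX hF (by linarith) j
  have jY : ∀ j, Integrable (fun p => YC j F p * YC j (VV b c α β) p) := fun j => by
    simpa [bk] using (dY j).integrable_mulY hF (by linarith) j
  have kX : ∀ j, Integrable (fun p => XC j F p * XC j (VV b c α β) p + YC j F p * YC j (VV b c α β) p) :=
    fun j => (jX j).add (jY j)
  have kY : ∀ j, Integrable (fun p => F p * XC j (XC j (VV b c α β)) p + F p * YC j (YC j (VV b c α β)) p) :=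
    fun j => (iX j).add (iY j)
  rw [integral_finsetSum _ fun j _ => kX j, ← mx]
  simp only [LapC, ap, je]
  rw [integral_finsetSum _ fun j _ => kY j]
  refine cr rfl fun j _ => ?_
  rw [ep (iX j) (iY j), ep (jX j) (jY j), ibpX hF (dX j) (by linarith),
    ibpY hF (dY j) (by linarith)]
  ring
lemma green {b b' : Fin n → ℂ} {c c' : ℂ} (h : Good b c) (h' : Good b' c') {α β α' β' : ℝ}
    (hr : 0 ≤ α + β) (hr' : 0 ≤ α' + β') (hs : (n:ℝ) + 1/2 < (α + β) + (α' + β')) :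
    ∫ p, VV b c α β p * LapC (VV b' c' α' β') p = ∫ p, VV b' c' α' β' p * LapC (VV b c α β) p := by
  rw [lx h' (ff h rfl hr) hr' hs, lx h (ff h' rfl hr') hr (by linarith)]
  simp only [bk]
lemma jx {b : Fin n → ℂ} {c : ℂ} (h : Good b c) (p : Pt n) :
    LapC (VV b c (n/2) (n/2)) p = -((n^2 * disc b c * (‖Acl b c p‖ ^ (n + 2))⁻¹ : ℝ) : ℂ) := by
  rw [pd h, fx h ((n:ℝ)/2 + 1) (n + 2) (by push_cast; ring)]
  have : Acl b c p + conj (Acl b c p) = ((2 * (Acl b c p).re : ℝ) : ℂ) := Complex.add_conj _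
  push_cast at this ⊢
  linear_combination (-2 * (n:ℂ)^2) * (((‖Acl b c p‖:ℂ) ^ (n + 2))⁻¹) * this
lemma bv (μ s : ℝ) : Measurable (scalePt n μ s) := by unfold scalePt; fun_prop
lemma gv (μ s : ℝ) (hμ : 0 < μ) :
    (volume : Measure (Pt n)).map (scalePt n μ s) = ENNReal.ofReal ((μ ^ (2 * n + 2))⁻¹) • volume := by
  have i1 : Measure.IsAddHaarMeasure (volume : Measure ((Fin n → ℝ) × ℝ)) := by
    rw [aw]; infer_instance
  have i2 : Measure.IsAddHaarMeasure (volume : Measure (Pt n)) := by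
    rw [aw]; exact kc _ _
  let f : Pt n →ₗ[ℝ] Pt n := (μ • LinearMap.id).prodMap ((μ • LinearMap.id).prodMap (μ ^ 2 • LinearMap.id))
  have hdet : LinearMap.det f = μ ^ (2 * n + 2) := by
    simp only [f, LinearMap.det_prodMap, LinearMap.det_smul, LinearMap.det_id, Module.finrank_fin_fun,
      Module.finrank_self]
    ring
  have hne : LinearMap.det f ≠ 0 := by rw [hdet]; positivity
  have h1 := Measure.map_linearMap_addHaar_eq_smul_addHaar (μ := (volume : Measure (Pt n))) hne
  have e : scalePt n μ s = (fun p : Pt n => p + (0, 0, s)) ∘ f := by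
    ext1 p; simp [scalePt, f]; constructor <;> rfl
  have hf : Measurable f := f.continuous_of_finiteDimensional.measurable
  rw [e, ← Measure.map_map (measurable_add_const _) hf, h1, Measure.map_smul,
    (measurePreserving_add_right (volume : Measure (Pt n)) (0, 0, s)).map_eq, hdet, bm (by positivity)]
lemma jf (a : Pt n) : MeasurePreserving (heisMul n a) volume volume := by
  have i1 : Measure.IsAddHaarMeasure (volume : Measure ((Fin n → ℝ) × ℝ)) := by
    rw [aw]; infer_instance
  have i2 : Measure.IsAddHaarMeasure (volume : Measure (Pt n)) := by
    rw [aw]; exact kc _ _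
  have h1 := ln (n := n) (fun x y => 2 * (∑ j, x j * a.2.1 j) - 2 * (∑ j, a.1 j * y j))
    (by simp only [ej]; fun_prop)
  have h2 := (measurePreserving_add_left (volume : Measure (Pt n)) a).comp h1
  convert! h2 using 1
  ext1 p
  simp only [heisMul, Function.comp, Prod.ext_iff, Prod.fst_add, Prod.snd_add]
  refine ⟨rfl, rfl, ?_⟩
  ring
instance : NullSingletonClass (volume : Measure (Pt n)) := by
  have : NullSingletonClass (volume : Measure ((Fin n → ℝ) × ℝ)) := by
    rw [aw]; infer_instance
  rw [aw]; infer_instance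
def bK (ξ : Pt n) : Fin n → ℂ := fun j => -2 * conj (zc ξ j)
def KA (ξ η : Pt n) : ℂ := Acl (bK ξ) (conj (tau ξ)) η
def KAe (ξ : Pt n) (ε : ℝ) (η : Pt n) : ℂ := Acl (bK ξ) (conj (tau ξ) + (ε^2 : ℝ)) η
lemma fy (ξ : Pt n) (ε : ℝ) (η : Pt n) : KAe ξ ε η = KA ξ η + (ε^2 : ℝ) := by
  simp [KAe, KA, Acl]; ring
lemma jo (ξ : Pt n) (r : ℝ) : disc (bK ξ) (conj (tau ξ) + (r:ℂ)) = 4 * r := by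
  have : ∀ j, ‖bK ξ j‖ ^ 2 = 4 * ‖zc ξ j‖ ^ 2 := fun j => by simp [bK]; ring
  simp only [disc, this, ← ap, ← iw]
  simp [tau]; ring
lemma sk (ξ : Pt n) {ε : ℝ} (hε : 0 < ε) : Good (bK ξ) (conj (tau ξ) + (ε^2 : ℝ)) := by
  have := jo ξ (ε^2)
  unfold disc at this; unfold Good
  have h2 : 0 < ε ^ 2 := by positivity
  linarith
lemma ei (ξ η : Pt n) : KA ξ η = tau η + conj (tau ξ) - 2 * ∑ j, zc η j * conj (zc ξ j) := by
  simp only [KA, Acl, bK, ap]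
  rw [add_right_comm, sub_eq_add_neg, ← mx]
  congr 1; refine cr rfl fun j _ => ?_; ring
lemma td (ξ η : Pt n) : KA η ξ = conj (KA ξ η) := by
  rw [ei, ei]; simp [map_sum, bk, Complex.conj_ofNat]; ring
lemma gu (ξ η : Pt n) : ‖KA η ξ‖ = ‖KA ξ η‖ := by rw [td]; simp
lemma pm (ξ η : Pt n) : 0 ≤ (KA ξ η).re := by
  have := eu (bK ξ) (conj (tau ξ)) η
  have h2 := jo ξ 0
  simp at h2; rw [h2] at this; simpa [KA] using this
lemma te (ξ : Pt n) : KA ξ ξ = 0 := by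
  rw [ei, lg]
  simp [map_sum, bk, zc]; ring
lemma pl {ξ η : Pt n} (h : KA ξ η = 0) : η = ξ := by
  have h1 := jl (bK ξ) (conj (tau ξ)) η
  have h2 := jo ξ 0
  simp at h2
  rw [h2, show Acl (bK ξ) (conj (tau ξ)) η = KA ξ η from rfl, h] at h1
  have h3 : ∀ j, zc η j = zc ξ j := by
    intro j
    have : ‖ell (bK ξ) j η‖ ^ 2 = 0 := by
      refine (Finset.sum_eq_zero_iff_of_nonneg (f := fun i => ‖ell (bK ξ) i η‖ ^ 2) fun i _ => by positivity).1 (by simpa using h1) j (ct j)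
    have h4 : ell (bK ξ) j η = 0 := by simpa using this
    have h5 : conj (zc η j) = conj (zc ξ j) := by
      have : 2 * (conj (zc η j) - conj (zc ξ j)) = 0 := by rw [← h4, ell, bK]; ring
      simpa [gj] using this
    simpa using congrArg conj h5
  have h4 := ei ξ η
  simp only [h, h3, lg, map_sub, map_sum, map_mul, Complex.conj_conj, gh, ug] at h4
  have h5 : Complex.I * ((ξ.2.2:ℂ) - η.2.2) = 0 := by
    rw [h4]; simp only [bk (conj _)]; ring
  have h6 : ξ.2.2 = η.2.2 := by
    have : (ξ.2.2:ℂ) - η.2.2 = 0 := by simpa using h5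
    exact_mod_cast gj.1 this
  have hx : η.1 = ξ.1 := funext fun j => by simpa [zc] using congrArg Complex.re (h3 j)
  have hy : η.2.1 = ξ.2.1 := funext fun j => by simpa [zc] using congrArg Complex.im (h3 j)
  exact Prod.ext hx (Prod.ext hy h6.symm)
lemma tg (ξ ζ : Pt n) : KA ξ (heisMul n ξ ζ) = tau ζ := by
  rw [ei]
  apply bz
  · simp only [tau, zsq, heisMul, zc, ← ao]
    simp
    rw [ap, ← ao, ← Finset.sum_sub_distrib]
    refine cr rfl fun j _ => ?_
    ring
  · simp only [tau, zsq, heisMul, zc]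
    simp
    rw [ap, ap, ap, ← gj]
    ring_nf
    simp only [← mx, ← ao, ← Finset.sum_sub_distrib]
    refine Finset.sum_eq_zero fun j _ => ?_
    ring
lemma jb (μ s : ℝ) (p : Pt n) : tau (scalePt n μ s p) = (μ^2 : ℝ) * tau p - Complex.I * s := by
  apply bz
  · rw [Complex.sub_re, Complex.re_ofReal_mul]; simp [tau, scalePt, zsq, ci, ← ap]; ring
  · rw [Complex.sub_im, Complex.im_ofReal_mul]; simp [tau, scalePt, zsq, ci, ← ap]; ring
@[fun_prop] lemma fw (ξ : Pt n) : Continuous (KA ξ) := by unfold KA Acl; fun_prop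
lemma kb : Continuous (fun q : Pt n × Pt n => KA q.1 q.2) := by
  simp only [ei]
  have : ∀ j : Fin n, Continuous fun q : Pt n × Pt n => zc q.2 j := fun j => (ot j).comp continuous_snd
  have : ∀ j : Fin n, Continuous fun q : Pt n × Pt n => zc q.1 j := fun j => (ot j).comp continuous_fst
  have := (mc (n := n)).comp (continuous_fst (X := Pt n) (Y := Pt n))
  have := (mc (n := n)).comp (continuous_snd (X := Pt n) (Y := Pt n))
  fun_prop
def C0 (n : ℕ) : ℝ := ∫ p : Pt n, (wt p ^ (n + 2))⁻¹
lemma ca {k : ℕ} (hk : n + 1 < k) : Integrable (fun p : Pt n => (wt p ^ k)⁻¹) := by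
  have := fh (n := n) (s := k) (by exact_mod_cast hk)
  refine this.congr (ab fun p => ?_)
  exact rpn _ (ad p).le k
lemma cu : 0 < C0 n := by
  unfold C0
  rw [integral_pos_iff_support_of_nonneg (fun p => by have := ad p; positivity) (ca (by omega))]
  have : Function.support (fun p : Pt n => (wt p ^ (n + 2))⁻¹) = Set.univ := by
    ext p; have := ad p; simp; intro h; linarith
  rw [this]
  have i1 : Measure.IsOpenPosMeasure (volume : Measure ((Fin n → ℝ) × ℝ)) := by
    rw [aw]; infer_instance
  have i2 : Measure.IsOpenPosMeasure (volume : Measure (Pt n)) := by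
    rw [aw]; exact Measure.prod.instIsOpenPosMeasure
  exact isOpen_univ.measure_pos _ Set.univ_nonempty
lemma kv {E : Type*} [NormedAddCommGroup E] [NormedSpace ℝ E] (ξ : Pt n) {ε : ℝ} (hε : 0 < ε)
    (G : Pt n → E) (hG : AEStronglyMeasurable G volume) :
    ∫ η, G η = ε ^ (2 * n + 2) • ∫ ζ, G (heisMul n ξ (scalePt n ε 0 ζ)) := by
  have h1 : ∫ η, G η = ∫ ζ, G (heisMul n ξ ζ) := by
    conv_lhs => rw [← (jf ξ).map_eq]
    rw [qu (jf ξ).measurable.aemeasurable]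
    rw [(jf ξ).map_eq]; exact hG
  have hm : AEStronglyMeasurable (fun ζ => G (heisMul n ξ ζ)) volume := hG.comp_measurePreserving (jf ξ)
  have h2 : ∫ ζ, G (heisMul n ξ (scalePt n ε 0 ζ)) = (ε ^ (2 * n + 2))⁻¹ • ∫ ζ, G (heisMul n ξ ζ) := by
    have := qu (μ := (volume : Measure (Pt n))) (bv ε 0).aemeasurable
      (f := fun ζ => G (heisMul n ξ ζ)) (by rw [gv ε 0 hε]; exact hm.smul_measure _)
    rw [← this, gv ε 0 hε, integral_smul_measure, ch (by positivity)]
  rw [h2, h1, smul_smul, da (by positivity), one_smul]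
lemma sv (ξ : Pt n) : Continuous (heisMul n ξ) := by unfold heisMul; fun_prop
lemma su (μ s : ℝ) : Continuous (scalePt n μ s) := by unfold scalePt; fun_prop
lemma ps (ξ : Pt n) {ε : ℝ} (hε : 0 < ε) (V : Pt n → ℂ) (hV : Continuous V) :
    ∫ η, (((ε^2 * (‖KAe ξ ε η‖ ^ (n + 2))⁻¹ : ℝ) : ℂ) * V η)
      = ∫ ζ, (((wt ζ ^ (n + 2))⁻¹ : ℝ) : ℂ) * V (heisMul n ξ (scalePt n ε 0 ζ)) := by
  have hm : AEStronglyMeasurable (fun η => (((ε^2 * (‖KAe ξ ε η‖ ^ (n + 2))⁻¹ : ℝ) : ℂ) * V η)) volume := by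
    simp only [fy]
    refine cy ?_
    have := hV.measurable
    have := (fw ξ).measurable
    fun_prop
  rw [kv ξ hε _ hm, ← integral_smul]
  congr 1; ext1 ζ
  have e : KAe ξ ε (heisMul n ξ (scalePt n ε 0 ζ)) = ((ε^2:ℝ):ℂ) * AA ζ := by
    rw [fy, tg, jb, AA]; push_cast; ring
  rw [e, am, aj, ac (by positivity), ← wt, Complex.real_smul, ← bc,
    ← dz]
  congr 2
  have := ad ζ
  field_simp
  ring
lemma nb (ξ ζ : Pt n) : Tendsto (fun k : ℕ => heisMul n ξ (scalePt n (1 / ((k:ℝ) + 1)) 0 ζ)) atTop (𝓝 ξ) := by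
  have h1 : Continuous fun μ : ℝ => heisMul n ξ (scalePt n μ 0 ζ) := by
    unfold heisMul scalePt; fun_prop
  have h2 := (h1.tendsto 0).comp km
  have e : heisMul n ξ (scalePt n 0 0 ζ) = ξ := by simp [heisMul, scalePt]
  rw [e] at h2
  exact h2
lemma th (ξ : Pt n) (V : Pt n → ℂ) (hV : Continuous V) (C : ℝ) (hC : ∀ p, ‖V p‖ ≤ C) :
    Tendsto (fun k : ℕ => ∫ η, ((((1 / ((k:ℝ) + 1))^2 * (‖KAe ξ (1 / ((k:ℝ) + 1)) η‖ ^ (n + 2))⁻¹ : ℝ) : ℂ) * V η))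
      atTop (𝓝 (C0 n * V ξ)) := by
  have e : (C0 n : ℂ) * V ξ = ∫ ζ : Pt n, (((wt ζ ^ (n + 2))⁻¹ : ℝ) : ℂ) * V ξ := by
    rw [integral_mul_const, C0, bi]
  rw [e]
  have h0 : ∀ k : ℕ, 0 < 1 / ((k:ℝ) + 1) := fun k => by positivity
  simp only [fun k => ps ξ (h0 k) V hV]
  refine px (fun p => C * (wt p ^ (n + 2))⁻¹) ?_
    ((ca (by omega)).const_mul C) ?_ ?_
  · intro k
    refine cy ?_
    have := (hV.comp ((sv ξ).comp (su (1 / ((k:ℝ) + 1)) 0))).measurable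
    have h2 : Measurable fun a : Pt n => V (heisMul n ξ (scalePt n (1 / ((k:ℝ) + 1)) 0 a)) := this
    have := (bo (n := n)).measurable
    refine Measurable.mul ?_ h2
    fun_prop
  · intro k
    refine ab fun p => ?_
    have := ad p
    rw [am, aj, ac (by positivity), bk]
    gcongr; exact hC _
  · refine ab fun p => ?_
    exact ((hV.tendsto ξ).comp (nb ξ p)).const_mul _
lemma iv : Good (0 : Fin n → ℂ) 1 := by simp [Good]
lemma qv (p : Pt n) : Acl 0 1 p = AA p := by simp [Acl, AA, add_comm]
lemma tt : disc (0 : Fin n → ℂ) 1 = 4 := by simp [disc]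
lemma oj {b : Fin n → ℂ} {c : ℂ} (h : Good b c) {α β : ℝ} (hn : 1 ≤ n) (hr : 0 ≤ α + β) (hs : (n:ℝ) ≤ α + β)
    (ξ : Pt n) {ε : ℝ} (hε : 0 < ε) :
    ∫ η, (((‖KAe ξ ε η‖ ^ n)⁻¹ : ℝ) : ℂ) * LapC (VV b c α β) η
      = -(4 * n^2) * ∫ η, (((ε^2 * (‖KAe ξ ε η‖ ^ (n + 2))⁻¹ : ℝ) : ℂ) * VV b c α β η) := by
  have hg := sk ξ hε
  have hn' : (1:ℝ) ≤ n := by exact_mod_cast hn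
  have := green hg h (α := n/2) (β := n/2) (α' := α) (β' := β) (by positivity) hr (by linarith)
  simp only [fx hg ((n:ℝ)/2) n (by ring), jx hg, jo] at this
  simp only [KAe]
  rw [this, ← ah]
  congr 1; ext1 η; push_cast; ring
end HW
namespace HW
open scoped ComplexConjugate
variable {n : ℕ}
lemma ke (p : Pt n) : ‖Acl 0 1 p‖ = wt p := by rw [qv, wt]
lemma tc (ξ η : Pt n) (ε : ℝ) : ‖KA ξ η‖ ≤ ‖KAe ξ ε η‖ := by
  rw [fy]
  have h := pm ξ η
  rw [Complex.norm_def, Complex.norm_def]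
  apply Real.sqrt_le_sqrt
  rw [au, au]
  simp only [gi, Complex.add_im, ue, Complex.ofReal_im, add_zero]
  nlinarith [ed ε, nw h (ed ε)]
lemma nj (ξ η : Pt n) (ε : ℝ) : ε ^ 2 ≤ ‖KAe ξ ε η‖ := by
  rw [fy]
  have h := pm ξ η
  have := fm (KA ξ η + ((ε^2:ℝ):ℂ))
  rw [gi, ue] at this
  linarith
lemma lw (ξ : Pt n) (ε : ℝ) : Measurable (KAe ξ ε) := by
  have : KAe ξ ε = fun η => KA ξ η + ((ε^2:ℝ):ℂ) := funext fun η => fy ξ ε η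
  rw [this]; exact ((fw ξ).add br).measurable
lemma sg (ξ : Pt n) {ε : ℝ} (hε : 0 < ε) :
    Integrable (fun η => (‖KAe ξ ε η‖ ^ n)⁻¹ * (wt η ^ (n + 2))⁻¹) := by
  refine ((ca (n := n) (k := n + 2) (by omega)).const_mul (((ε^2) ^ n)⁻¹)).mono' ?_ ?_
  · have := (lw ξ ε)
    have := (bo (n := n)).measurable
    exact cy (by fun_prop)
  · refine ab fun η => ?_
    have h1 := nj ξ η ε
    have h2 := ad η
    rw [ac (by positivity)]
    gcongr
lemma sw (hn : 1 ≤ n) (ξ : Pt n) {ε : ℝ} (hε : 0 < ε) :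
    ∫ η, (‖KAe ξ ε η‖ ^ n)⁻¹ * (wt η ^ (n + 2))⁻¹ ≤ C0 n := by
  have hn' : (1:ℝ) ≤ n := by exact_mod_cast hn
  have h := oj (iv (n := n)) (α := n/2) (β := n/2) hn (by positivity) (by linarith) ξ hε
  have hV : Continuous (VV (0 : Fin n → ℂ) 1 (n/2) (n/2)) :=
    qf.2 fun p => (dk iv _ _ p).continuousAt
  rw [ps ξ hε _ hV] at h
  simp only [jx iv, fx iv ((n:ℝ)/2) n (by ring), tt, ke] at h
  have h2 : (∫ η, (‖KAe ξ ε η‖ ^ n)⁻¹ * (wt η ^ (n + 2))⁻¹)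
      = ∫ ζ : Pt n, (wt ζ ^ (n + 2))⁻¹ * (wt (heisMul n ξ (scalePt n ε 0 ζ)) ^ n)⁻¹ := by
    have e1 : ∀ x : Pt n, (((‖KAe ξ ε x‖ ^ n)⁻¹ : ℝ) : ℂ) * -((n^2 * 4 * (wt x ^ (n + 2))⁻¹ : ℝ) : ℂ)
        = -(4 * n^2) * ((((‖KAe ξ ε x‖ ^ n)⁻¹ * (wt x ^ (n + 2))⁻¹ : ℝ)) : ℂ) := fun x => by push_cast; ring
    simp only [e1] at h
    rw [ah] at h
    have h3 := mul_left_cancel₀ (by simp; omega) h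
    simp only [← dz] at h3
    rw [bi, bi] at h3
    exact_mod_cast h3
  rw [h2]
  refine integral_mono_of_nonneg (ab fun ζ => ?_) (ca (by omega)) (ab fun ζ => ?_)
  · have := ad ζ; have := ad (heisMul n ξ (scalePt n ε 0 ζ)); simp only [gm]; positivity
  · have := ad ζ; have h1 := bx (heisMul n ξ (scalePt n ε 0 ζ))
    simp only
    have : (wt (heisMul n ξ (scalePt n ε 0 ζ)) ^ n)⁻¹ ≤ 1 := bl (one_le_pow₀ h1)
    have h5 : 0 ≤ (wt ζ ^ (n + 2))⁻¹ := by positivity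
    nlinarith
lemma ni (ξ η : Pt n) : Tendsto (fun k : ℕ => KAe ξ (1 / ((k:ℝ) + 1)) η) atTop (𝓝 (KA ξ η)) := by
  have h1 : Continuous fun ε : ℝ => KA ξ η + ((ε^2:ℝ):ℂ) := by fun_prop
  have h2 := (h1.tendsto 0).comp km
  simp only [fy]
  simpa [cg] using h2
lemma kd {ξ η : Pt n} (h : η ≠ ξ) : Tendsto (fun k : ℕ => (‖KAe ξ (1 / ((k:ℝ) + 1)) η‖ ^ n)⁻¹) atTop
    (𝓝 ((‖KA ξ η‖ ^ n)⁻¹)) := by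
  have h0 : ‖KA ξ η‖ ^ n ≠ 0 := by
    refine pow_ne_zero _ (qd.2 fun h1 => h (pl h1))
  exact ((ni ξ η).norm.pow n).inv₀ h0
lemma md (ξ : Pt n) : ∀ᵐ η : Pt n, η ≠ ξ := by
  have : (volume : Measure (Pt n)) {ξ} = 0 := measure_singleton ξ
  rw [ae_iff]; simpa using this
lemma lz (hn : 1 ≤ n) (ξ : Pt n) : Integrable (fun η => (‖KA ξ η‖ ^ n)⁻¹ * (wt η ^ (n + 2))⁻¹) := by
  have m1 := (fw ξ).measurable
  have m2 := (bo (n := n)).measurable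
  refine ⟨cy (by fun_prop), ?_⟩
  have h0 : ∀ k : ℕ, 0 < 1 / ((k:ℝ) + 1) := fun k => by positivity
  let f : ℕ → Pt n → ENNReal := fun k η => ENNReal.ofReal ((‖KAe ξ (1 / ((k:ℝ) + 1)) η‖ ^ n)⁻¹ * (wt η ^ (n + 2))⁻¹)
  have hb : ∀ k, ∫⁻ η, f k η ≤ ENNReal.ofReal (C0 n) := by
    intro k
    rw [← fz (sg ξ (h0 k)) (ab fun η => by
      have := ad η; simp only [gm]; positivity)]
    exact de (sw hn ξ (h0 k))
  have hl : ∫⁻ η, liminf (fun k => f k η) atTop ≤ ENNReal.ofReal (C0 n) := by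
    refine (lintegral_liminf_le fun k => ?_).trans ?_
    · have := lw ξ (1 / ((k:ℝ) + 1)); fun_prop
    · exact (liminf_le_liminf (ab hb)).trans (by simp)
  rw [hasFiniteIntegral_iff_ofReal (ab fun η => by
      have := ad η; simp only [gm]; positivity)]
  refine eg ?_ (eg hl bg)
  refine gb ?_
  filter_upwards [md ξ] with η hη
  have : Tendsto (fun k => f k η) atTop (𝓝 (ENNReal.ofReal ((‖KA ξ η‖ ^ n)⁻¹ * (wt η ^ (n + 2))⁻¹))) :=
    (ENNReal.continuous_ofReal.tendsto _).comp ((kd hη).mul_const _)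
  rw [this.liminf_eq]
lemma oi {b : Fin n → ℂ} {c : ℂ} (h : Good b c) {α β : ℝ} (hn : 1 ≤ n) (hs : (n:ℝ) ≤ α + β)
    {C D : ℝ} (hD : ∀ p, ‖VV b c α β p‖ ≤ D)
    (hC : ∀ p, ‖LapC (VV b c α β) p‖ ≤ C * (wt p ^ (n + 2))⁻¹) (ξ : Pt n) :
    ∫ η, (((‖KA ξ η‖ ^ n)⁻¹ : ℝ) : ℂ) * LapC (VV b c α β) η = -(4 * n^2) * (C0 n * VV b c α β ξ) := by
  have hr : 0 ≤ α + β := ew (by positivity) hs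
  have h0 : ∀ k : ℕ, 0 < 1 / ((k:ℝ) + 1) := fun k => by positivity
  have hV : Continuous (VV b c α β) :=
    qf.2 fun p => (dk h _ _ p).continuousAt
  have l1 := (th ξ _ hV D hD).const_mul (-(4 * (n:ℂ)^2))
  simp only [fun k => (oj h hn hr hs ξ (h0 k)).symm] at l1
  refine tx ?_ l1
  have mL : Measurable (LapC (VV b c α β)) := by
    have : LapC (VV b c α β) = fun p => ∑ j, (XC j (XC j (VV b c α β)) p + YC j (YC j (VV b c α β)) p) := rfl
    rw [this]
    refine Finset.measurable_sum _ fun j _ => ?_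
    exact (fd _ _).add (fc _ _)
  refine px (fun η => C * ((‖KA ξ η‖ ^ n)⁻¹ * (wt η ^ (n + 2))⁻¹)) ?_
    ((lz hn ξ).const_mul C) ?_ ?_
  · intro k
    have := lw ξ (1 / ((k:ℝ) + 1))
    exact cy (by fun_prop)
  · intro k
    filter_upwards [md ξ] with η hη
    have h1 : 0 < ‖KA ξ η‖ := dq.2 fun h1 => hη (pl h1)
    have h2 := tc ξ η (1 / ((k:ℝ) + 1))
    rw [am, aj, ac (by positivity)]
    have h3 : (‖KAe ξ (1 / ((k:ℝ) + 1)) η‖ ^ n)⁻¹ ≤ (‖KA ξ η‖ ^ n)⁻¹ := by gcongr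
    calc _ ≤ (‖KA ξ η‖ ^ n)⁻¹ * (C * (wt η ^ (n + 2))⁻¹) := by
          gcongr
          exact hC η
      _ = _ := by ring
  · filter_upwards [md ξ] with η hη
    exact ((Complex.continuous_ofReal.tendsto _).comp (kd hη)).mul_const _
end HW
namespace HW
open scoped ComplexConjugate
variable {n : ℕ}
def mm (n : ℕ) : Measure (Pt n) := volume.withDensity (fun p => ENNReal.ofReal ((wt p ^ (2 * n + 2))⁻¹))
def kk (ξ η : Pt n) : ℝ := wt ξ ^ n * wt η ^ n / (C0 n * ‖KA ξ η‖ ^ n)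
def BB (p : Pt n) : ℂ := (AA p)⁻¹
lemma ig : Measurable (fun p : Pt n => ENNReal.ofReal ((wt p ^ (2 * n + 2))⁻¹)) := by
  have := (bo (n := n)).measurable
  fun_prop
lemma jh (f : Pt n → ENNReal) (hf : Measurable f) :
    ∫⁻ p, f p ∂(mm n) = ∫⁻ p, ENNReal.ofReal ((wt p ^ (2 * n + 2))⁻¹) * f p := by
  rw [mm, lintegral_withDensity_eq_lintegral_mul _ ig hf]; rfl
lemma fu {E : Type*} [NormedAddCommGroup E] [NormedSpace ℝ E] (f : Pt n → E) :
    ∫ p, f p ∂(mm n) = ∫ p, ((wt p ^ (2 * n + 2))⁻¹) • f p := by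
  rw [mm, mz ig (ab fun p => bg)]
  congr 1; ext1 p
  have := ad p
  rw [ch (by positivity)]
lemma nf {E : Type*} [NormedAddCommGroup E] [NormedSpace ℝ E] {f : Pt n → E} :
    Integrable f (mm n) ↔ Integrable (fun p => ((wt p ^ (2 * n + 2))⁻¹) • f p) := by
  rw [mm, py ig (ab fun p => bg)]
  have : ∀ p : Pt n, (ENNReal.ofReal ((wt p ^ (2 * n + 2))⁻¹)).toReal = (wt p ^ (2 * n + 2))⁻¹ := fun p => by
    have := ad p
    rw [ch (by positivity)]
  simp only [this]
lemma mm_ac : mm n ≪ volume := withDensity_absolutelyContinuous _ _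
lemma ow : volume ≪ mm n := withDensity_absolutelyContinuous' ig.aemeasurable
  (ab fun p => by have := ad p; simp; positivity)
instance mm_fin : IsFiniteMeasure (mm n) := by
  constructor
  rw [← lintegral_one, jh _ dd]
  simp only [ia]
  exact ((ca (n := n) (k := 2 * n + 2) (by omega)).lintegral_lt_top)
lemma ft (ξ η : Pt n) : 0 ≤ kk ξ η := by
  have := ad ξ; have := ad η; have := cu (n := n); unfold kk; positivity
lemma ji (ξ η : Pt n) : kk ξ η = kk η ξ := by
  unfold kk; rw [gu, bk (wt ξ ^ n)]
lemma dw : Measurable (fun q : Pt n × Pt n => kk q.1 q.2) := by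
  unfold kk
  have h := (kb (n := n)).measurable
  have h1 := ((bo (n := n)).comp (continuous_fst (X := Pt n) (Y := Pt n))).measurable
  have h2 := ((bo (n := n)).comp (continuous_snd (X := Pt n) (Y := Pt n))).measurable
  simp only [cg] at h1 h2
  fun_prop
lemma ie (ξ : Pt n) : Measurable (kk ξ) := by
  unfold kk
  have h := (fw ξ).measurable
  have h1 := (bo (n := n)).measurable
  fun_prop
lemma ly (ξ η : Pt n) : (wt η ^ (2 * n + 2))⁻¹ * kk ξ η
    = wt ξ ^ n / C0 n * ((‖KA ξ η‖ ^ n)⁻¹ * (wt η ^ (n + 2))⁻¹) := by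
  have h1 := ad η
  have h2 : wt η ^ (2 * n + 2) = wt η ^ n * wt η ^ (n + 2) := by rw [← tl]; congr 1; omega
  have h3 := cu (n := n)
  rw [h2, kk, az, mul_inv, mul_inv]
  field_simp
lemma VVB (a b : ℕ) (p : Pt n) :
    VV 0 1 (n/2 + a) (n/2 + b) p = (((wt p ^ n)⁻¹ : ℝ) : ℂ) * (BB p ^ a * conj (BB p) ^ b) := by
  have hA := pv p
  have hA' : conj (AA p) ≠ 0 := by simpa using hA
  have key : ∀ a : ℕ, VV 0 1 (n/2 + a) (n/2) p = (((wt p ^ n)⁻¹ : ℝ) : ℂ) * BB p ^ a := by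
    intro a
    induction a with
    | zero =>
      have := fx (iv (n := n)) (n/2) n (by ring) p
      rw [ke] at this
      simpa using this
    | succ a ih =>
      have h := me (iv (n := n)) (n/2 + a) (n/2) p
      rw [qv, ih] at h
      have e : ((n:ℝ)/2 + ((a + 1 : ℕ) : ℝ)) = n/2 + a + 1 := by push_cast; ring
      rw [e, pow_succ, ← bc, h, BB]
      field_simp
  induction b with
  | zero => simpa using key a
  | succ b ih =>
    have h := oz (iv (n := n)) (n/2 + a) (n/2 + b) p
    rw [qv, ih] at h
    have e : ((n:ℝ)/2 + ((b + 1 : ℕ) : ℝ)) = n/2 + b + 1 := by push_cast; ring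
    have h2 : conj (BB p) * conj (AA p) = 1 := by rw [← map_mul, BB, ub hA, map_one]
    rw [e]
    refine mul_right_cancel₀ hA' ?_
    rw [pow_succ]
    linear_combination (-1:ℂ) * h - ((((wt p ^ n)⁻¹ : ℝ) : ℂ) * (BB p ^ a * conj (BB p) ^ b)) * h2
def l0 (n a b : ℕ) : ℝ := 4 * (n/2 + a) * (n/2 + b) / n^2
def l1 (n a b : ℕ) : ℝ := 2 * (n/2 + a) * b / n^2
def mon (a b : ℕ) (B : ℂ) : ℂ := B ^ a * conj B ^ b
def Lmon (n a b : ℕ) (B : ℂ) : ℂ := l0 n a b * mon a b B - l1 n a b * mon a (b-1) B - l1 n b a * mon (a-1) b B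
lemma kq (a b : ℕ) (B : ℂ) : (l1 n a b : ℂ) * mon a (b-1) B * conj B = l1 n a b * mon a b B := by
  cases b with
  | zero => simp [l1]
  | succ b => simp [mon, pow_succ]; ring
lemma kr (a b : ℕ) (B : ℂ) : (l1 n b a : ℂ) * mon (a-1) b B * B = l1 n b a * mon a b B := by
  cases a with
  | zero => simp [l1]
  | succ a => simp [mon, pow_succ]; ring
lemma pu (p : Pt n) : ‖BB p‖ = (wt p)⁻¹ := by rw [BB, norm_inv, wt]
lemma jz (p : Pt n) : ‖BB p‖ ≤ 1 := by rw [pu]; exact bl (bx p)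
lemma ib (a b : ℕ) (B : ℂ) (h : ‖B‖ ≤ 1) : ‖mon a b B‖ ≤ 1 := by
  rw [mon, am, norm_pow, norm_pow, qo]
  exact mul_le_one₀ (pow_le_one₀ (ai _) h) (by positivity) (pow_le_one₀ (ai _) h)
lemma mi (hn : 1 ≤ n) (a b : ℕ) (p : Pt n) :
    LapC (VV 0 1 (n/2 + a) (n/2 + b)) p = -(4 * n^2) * ((((wt p ^ (n+2))⁻¹ : ℝ) : ℂ) * Lmon n a b (BB p)) := by
  have hA := pv p
  have hB : BB p ≠ 0 := inv_ne_zero hA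
  have hB' : conj (BB p) ≠ 0 := by simpa using hB
  have hn0 : (n:ℂ) ≠ 0 := by simp; omega
  have e1 := VVB (n := n) (a+1) (b+1) p
  have e2 : ∀ x : ℕ, ((n:ℝ)/2 + ((x + 1 : ℕ) : ℝ)) = n/2 + x + 1 := fun x => by push_cast; ring
  rw [e2, e2] at e1
  rw [pd iv, e1, qv, tt]
  have hA1 : AA p = (BB p)⁻¹ := by rw [BB, inv_inv]
  have hA2 : conj (AA p) = (conj (BB p))⁻¹ := by rw [hA1, map_inv₀]
  have hre : ((2 * (AA p).re : ℝ) : ℂ) = AA p + conj (AA p) := (Complex.add_conj _).symm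
  have hre2 : ((4 * (AA p).re - 4 : ℝ) : ℂ) = 2 * (AA p + conj (AA p)) - 4 := by rw [← hre]; push_cast; ring
  have hw : (((wt p ^ (n+2))⁻¹ : ℝ) : ℂ) = (((wt p ^ n)⁻¹ : ℝ) : ℂ) * (BB p * conj (BB p)) := by
    rw [uf, av, pu, ← dz, tl, mul_inv, inv_pow]
  rw [hre2, hw, hA2, hA1]
  have p1 := kq (n := n) a b (BB p)
  have p2 := kr (n := n) a b (BB p)
  have q1 : (l1 n a b : ℂ) * mon a (b-1) (BB p) = l1 n a b * mon a b (BB p) * (conj (BB p))⁻¹ := by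
    rw [← p1, bc _ (conj (BB p)), da hB', ia]
  have q2 : (l1 n b a : ℂ) * mon (a-1) b (BB p) = l1 n b a * mon a b (BB p) * (BB p)⁻¹ := by
    rw [← p2, bc _ (BB p), da hB, ia]
  rw [Lmon, q1, q2]
  simp only [mon, l0, l1]
  push_cast
  field_simp
  ring
lemma mh (a b : ℕ) (B : ℂ) (h : ‖B‖ ≤ 1) : ‖Lmon n a b B‖ ≤ |l0 n a b| + |l1 n a b| + |l1 n b a| := by
  have h1 := ib a b B h
  have h2 := ib a (b-1) B h
  have h3 := ib (a-1) b B h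
  unfold Lmon
  refine (dp _ _).trans (bw ((dp _ _).trans (bw ?_ ?_)) ?_)
  all_goals rw [am, aj, af]; exact cv (aq _) (by assumption)
lemma tv (hn : 1 ≤ n) (a b : ℕ) (ξ : Pt n) :
    ∫ η, (kk ξ η : ℂ) * Lmon n a b (BB η) ∂(mm n) = mon a b (BB ξ) := by
  have hn' : (1:ℝ) ≤ n := by exact_mod_cast hn
  have hn0 : (n:ℂ) ≠ 0 := by simp; omega
  have hC := cu (n := n)
  have hC' : (C0 n : ℂ) ≠ 0 := by exact_mod_cast hC.ne'
  have h := oi (iv (n := n)) (α := n/2 + a) (β := n/2 + b) hn (by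
      have : (0:ℝ) ≤ a := by positivity
      have : (0:ℝ) ≤ b := by positivity
      linarith) (D := 1) (C := 4 * n^2 * (|l0 n a b| + |l1 n a b| + |l1 n b a|)) (fun p => by
      rw [VVB, am, aj, ac (by have := ad p; positivity)]
      exact mul_le_one₀ (bl (one_le_pow₀ (bx p))) (ai _)
        (ib a b _ (jz p))) (fun p => by
      have := ad p
      rw [mi hn, am, am, aj, ac (by positivity)]
      have e : ‖(-(4 * (n:ℂ)^2))‖ = 4 * n^2 := by simp
      rw [e]
      have := mh (n := n) a b _ (jz p)
      have h5 : 0 ≤ (wt p ^ (n + 2))⁻¹ := by positivity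
      calc _ = 4 * (n:ℝ)^2 * (wt p ^ (n + 2))⁻¹ * ‖Lmon n a b (BB p)‖ := by ring
        _ ≤ 4 * (n:ℝ)^2 * (wt p ^ (n + 2))⁻¹ * (|l0 n a b| + |l1 n a b| + |l1 n b a|) := by gcongr
        _ = _ := by ring) ξ
  simp only [mi hn, VVB] at h
  rw [fu]
  have e : ∀ η, ((wt η ^ (2 * n + 2))⁻¹) • ((kk ξ η : ℂ) * Lmon n a b (BB η))
      = -((wt ξ ^ n / C0 n : ℝ) : ℂ) / (4 * n^2) * ((((‖KA ξ η‖ ^ n)⁻¹ : ℝ) : ℂ)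
        * (-(4 * n^2) * ((((wt η ^ (n+2))⁻¹ : ℝ) : ℂ) * Lmon n a b (BB η)))) := by
    intro η
    rw [Complex.real_smul, ← bc, ← dz, ly]
    push_cast
    field_simp
  simp only [e]
  rw [ah, h]
  have hw : (wt ξ : ℂ) ≠ 0 := by exact_mod_cast (ad ξ).ne'
  push_cast
  rw [mon]
  field_simp
lemma jy (hn : 1 ≤ n) (ξ : Pt n) : Integrable (kk ξ) (mm n) := by
  rw [nf]
  simp only [ak, ly]
  exact (lz hn ξ).const_mul _
lemma tw (hn : 1 ≤ n) (ξ : Pt n) : ∫ η, kk ξ η ∂(mm n) = 1 := by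
  have h := tv hn 0 0 ξ
  have hn0 : (n:ℂ) ≠ 0 := by simp; omega
  have e : ∀ B, Lmon n 0 0 B = 1 := fun B => by
    simp [Lmon, mon, l0, l1]; field_simp; norm_num
  simp only [e, ia, mon, pow_zero] at h
  rw [bi] at h
  exact_mod_cast h
lemma pp (hn : 1 ≤ n) (ξ : Pt n) : ∫⁻ η, ENNReal.ofReal (kk ξ η) ∂(mm n) = 1 := by
  rw [← fz (jy hn ξ) (ab fun η => ft ξ η), tw hn]; simp
end HW
namespace HW
open scoped ComplexConjugate
variable {n : ℕ}
lemma kw {b : Fin n → ℂ} {c : ℂ} (h : Good b c) (hn : 1 ≤ n) (ξ : Pt n) :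
    Integrable (fun η => (‖KA ξ η‖ ^ n)⁻¹ * (‖Acl b c η‖ ^ (n + 2))⁻¹) ∧
    ∫ η, (‖KA ξ η‖ ^ n)⁻¹ * (‖Acl b c η‖ ^ (n + 2))⁻¹ = 4 * C0 n * (‖Acl b c ξ‖ ^ n)⁻¹ / disc b c := by
  obtain ⟨κ, hκ, hl⟩ := h.lower
  have hn' : (1:ℝ) ≤ n := by exact_mod_cast hn
  have hd := h.disc_pos
  have hb : ∀ p : Pt n, (‖Acl b c p‖ ^ (n + 2))⁻¹ ≤ (κ ^ (n + 2))⁻¹ * (wt p ^ (n + 2))⁻¹ := fun p => by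
    have := ad p
    rw [← mul_inv, ← ci]
    have := hl p
    gcongr
  constructor
  · refine ((lz hn ξ).const_mul ((κ ^ (n + 2))⁻¹)).mono' ?_ (ab fun η => ?_)
    · have h1 := (fw ξ).measurable
      have h2 : Measurable (Acl b c) := Continuous.measurable (by unfold Acl; fun_prop)
      exact cy (by fun_prop)
    · rw [ac (by positivity)]
      calc _ ≤ (‖KA ξ η‖ ^ n)⁻¹ * ((κ ^ (n + 2))⁻¹ * (wt η ^ (n + 2))⁻¹) := by gcongr; exact hb η
        _ = _ := by ring
  have g := oi h (α := n/2) (β := n/2) hn (by linarith) (D := (κ ^ n)⁻¹)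
    (C := n^2 * disc b c * (κ ^ (n + 2))⁻¹) (fun p => by
      rw [fx h ((n:ℝ)/2) n (by ring), aj, ac (by positivity)]
      have h1 := bx p
      have h2 := hl p
      have h3 : κ ≤ ‖Acl b c p‖ := by nlinarith
      gcongr) (fun p => by
      rw [jx h, tm, aj, ac (by positivity), bc _ _ (wt p ^ (n+2))⁻¹]
      have := hb p
      gcongr) ξ
  simp only [jx h, fx h ((n:ℝ)/2) n (by ring)] at g
  have e : ∀ η, (((‖KA ξ η‖ ^ n)⁻¹ : ℝ) : ℂ) * -((n^2 * disc b c * (‖Acl b c η‖ ^ (n + 2))⁻¹ : ℝ) : ℂ)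
     = -(n^2 * disc b c) * (((‖KA ξ η‖ ^ n)⁻¹ * (‖Acl b c η‖ ^ (n + 2))⁻¹ : ℝ) : ℂ) := fun η => by push_cast; ring
  simp only [e] at g
  rw [ah, bi] at g
  have g2 : -(n^2 * disc b c) * (∫ η, (‖KA ξ η‖ ^ n)⁻¹ * (‖Acl b c η‖ ^ (n + 2))⁻¹)
     = -(4 * n^2) * (C0 n * (‖Acl b c ξ‖ ^ n)⁻¹) := by exact_mod_cast g
  rw [eq_div_iff hd.ne']
  have hn2 : (n:ℝ)^2 ≠ 0 := by positivity
  apply mul_left_cancel₀ hn2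
  linear_combination -g2
def kn (κ : ℝ) (ξ η : Pt n) : ℝ := if ‖KA ξ η‖ < κ * wt ξ * wt η then kk ξ η else 0
lemma sc (κ : ℝ) (ξ η : Pt n) : kn κ ξ η = kn κ η ξ := by
  unfold kn; rw [ji ξ η, gu η ξ, mul_right_comm]
lemma sd (κ : ℝ) (ξ η : Pt n) : 0 ≤ kn κ ξ η := by
  unfold kn; split_ifs; exacts [ft _ _, le_rfl]
lemma nd (κ : ℝ) : Measurable (fun q : Pt n × Pt n => kn κ q.1 q.2) := by
  unfold kn
  have h := (kb (n := n)).measurable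
  have h1 := ((bo (n := n)).comp (continuous_fst (X := Pt n) (Y := Pt n))).measurable
  have h2 := ((bo (n := n)).comp (continuous_snd (X := Pt n) (Y := Pt n))).measurable
  simp only [cg] at h1 h2
  refine Measurable.ite ?_ dw dd
  exact measurableSet_lt (by fun_prop) (by fun_prop)
lemma ic (κ : ℝ) (ξ : Pt n) : Measurable (kn κ ξ) := by
  unfold kn
  have h := (fw ξ).measurable
  have h1 := (bo (n := n)).measurable
  refine Measurable.ite ?_ (ie ξ) dd
  exact measurableSet_lt (by fun_prop) (by fun_prop)
lemma ks {κ : ℝ} (hκ : 0 < κ) (ξ η : Pt n) : kk ξ η ≤ kn κ ξ η + (C0 n * κ ^ n)⁻¹ := by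
  have hC := cu (n := n)
  unfold kn; split_ifs with h
  · have : 0 ≤ (C0 n * κ ^ n)⁻¹ := by positivity
    linarith
  · have h1 := ad ξ; have h2 := ad η
    rw [not_lt] at h
    rw [zero_add, kk]
    have h3 : (κ * wt ξ * wt η) ^ n ≤ ‖KA ξ η‖ ^ n := by gcongr
    have h4 : 0 < (κ * wt ξ * wt η) ^ n := by positivity
    rw [inv_eq_one_div, mu (mul_pos hC (h4.trans_le h3)) (by positivity)]
    rw [ci, ci] at h3
    nlinarith
lemma tu (hn : 1 ≤ n) {κ : ℝ} (hκ : 0 < κ) (ξ : Pt n) :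
    ∫⁻ η, ENNReal.ofReal (kn κ ξ η) ∂(mm n) ≤ ENNReal.ofReal (2 ^ (n + 2) * κ) := by
  set s : ℂ := conj (AA ξ) with hs
  set a : ℂ := 1 + κ * s with ha
  set b : Fin n → ℂ := fun j => bK ξ j / a with hb
  set c : ℂ := ((1 + κ) * s - 1) / a with hc
  have hC := cu (n := n)
  have hw := ad ξ
  have hsw : ‖s‖ = wt ξ := by rw [hs, qo, wt]
  have hsre : s.re = 1 + zsq ξ := by rw [hs, Complex.conj_re, ml]
  have hare : 1 ≤ a.re := by
    rw [ha, gi, Complex.re_ofReal_mul, hsre, Complex.one_re]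
    have := ez ξ; nlinarith
  have ha0 : a ≠ 0 := fun h => by rw [h] at hare; simp at hare; linarith
  have hna : 0 < ‖a‖ := dq.2 ha0
  have hdisc : disc b c = 4 * κ * (1 + κ) * wt ξ ^ 2 / ‖a‖ ^ 2 := by
    have h1 : ∀ j, ‖b j‖ ^ 2 = 4 / ‖a‖^2 * ‖zc ξ j‖ ^ 2 := fun j => by
      simp only [hb, bK, norm_div, am, tm, qo, Complex.norm_ofNat]; ring
    simp only [disc, h1, ← ap, ← iw]
    have h2 : c.re = ((((1 + κ) * s - 1) * conj a).re) / ‖a‖ ^ 2 := by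
      rw [hc, Complex.div_re, Complex.mul_re, Complex.conj_re, Complex.conj_im, av]; ring
    have h3 : (((1 + κ) * s - 1) * conj a).re = zsq ξ + κ * (1 + κ) * wt ξ ^ 2 := by
      have : wt ξ ^ 2 = s.re ^ 2 + s.im ^ 2 := by
        rw [← hsw, ← av, au]; ring
      rw [this, ha]
      simp [Complex.mul_re, Complex.mul_im]
      rw [hsre]; ring
    rw [h2, h3]; field_simp; ring
  have hg : Good b c := by
    have : 0 < disc b c := by rw [hdisc]; positivity
    unfold disc at this; unfold Good; linarith
  have hAcl : ∀ η, a * Acl b c η = KA ξ η + κ * s * AA η := by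
    intro η
    have h1 : a * ∑ j, b j * zc η j = ∑ j, bK ξ j * zc η j := by
      rw [ap]; refine cr rfl fun j _ => ?_
      simp only [hb]; field_simp
    have h2 : a * c = (1 + κ) * s - 1 := by rw [hc]; field_simp
    have h3 : s = 1 + conj (tau ξ) := by rw [hs, AA, map_add, map_one]
    rw [Acl, je, je, h1, h2, KA, Acl, AA, ha]
    linear_combination h3
  have hself : ‖Acl b c ξ‖ = κ * wt ξ ^ 2 / ‖a‖ := by
    rw [eq_div_iff hna.ne', bk, ← am, hAcl, te, zero_add, am, am, hsw, aj,
      ac hκ.le, ← wt]; ring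
  obtain ⟨hi, he⟩ := kw hg hn ξ
  have key : ∀ η, (wt η ^ (2 * n + 2))⁻¹ * kn κ ξ η
      ≤ wt ξ ^ n / C0 n * ((2 * κ * wt ξ) ^ (n + 2) * (‖a‖ ^ (n+2))⁻¹) * ((‖KA ξ η‖ ^ n)⁻¹ * (‖Acl b c η‖ ^ (n + 2))⁻¹) := by
    intro η
    have h2 := ad η
    unfold kn
    split_ifs with h
    · rw [ly]
      have h5 : ‖a‖ * ‖Acl b c η‖ ≤ 2 * κ * wt ξ * wt η := by
        rw [← am, hAcl]
        refine (bu _ _).trans ?_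
        rw [am, am, hsw, aj, ac hκ.le, ← wt]
        linarith
      have h6 : 0 < ‖Acl b c η‖ := dq.2 (hg.ne η)
      have h7 : (wt η ^ (n + 2))⁻¹ ≤ (2 * κ * wt ξ) ^ (n + 2) * (‖a‖ ^ (n+2))⁻¹ * (‖Acl b c η‖ ^ (n + 2))⁻¹ := by
        rw [bc, ← mul_inv, ← ci, ← az, inv_eq_one_div, mu (by positivity) (by positivity),
          nt, ← ci]
        gcongr
      calc _ ≤ wt ξ ^ n / C0 n * ((‖KA ξ η‖ ^ n)⁻¹ * ((2 * κ * wt ξ) ^ (n + 2) * (‖a‖ ^ (n+2))⁻¹ * (‖Acl b c η‖ ^ (n + 2))⁻¹)) := by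
            gcongr
        _ = _ := by ring
    · rw [mul_zero]; positivity
  rw [jh _ (ic κ ξ).ennreal_ofReal]
  calc _ ≤ ∫⁻ η, ENNReal.ofReal (wt ξ ^ n / C0 n * ((2 * κ * wt ξ) ^ (n + 2) * (‖a‖ ^ (n+2))⁻¹) * ((‖KA ξ η‖ ^ n)⁻¹ * (‖Acl b c η‖ ^ (n + 2))⁻¹)) := by
        refine lintegral_mono fun η => ?_
        have := ad η
        rw [← ar (by positivity)]
        exact de (key η)
    _ = ENNReal.ofReal (wt ξ ^ n / C0 n * ((2 * κ * wt ξ) ^ (n + 2) * (‖a‖ ^ (n+2))⁻¹) * (4 * C0 n * (‖Acl b c ξ‖ ^ n)⁻¹ / disc b c)) := by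
        rw [← fz (hi.const_mul _) (ab fun η => by
          simp only [gm]; positivity), ah, he]
    _ ≤ _ := by
        apply de
        rw [hdisc, hself]
        have : wt ξ ^ n / C0 n * ((2 * κ * wt ξ) ^ (n + 2) * (‖a‖ ^ (n+2))⁻¹) * (4 * C0 n * ((κ * wt ξ ^ 2 / ‖a‖) ^ n)⁻¹ / (4 * κ * (1 + κ) * wt ξ ^ 2 / ‖a‖ ^ 2))
          = 2 ^ (n + 2) * κ / (1 + κ) := by
          rw [mo, ci, ci, ci]
          field_simp
          ring
        rw [this]
        exact div_le_self (by positivity) (by linarith)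
lemma rj (hn : 1 ≤ n) {κ : ℝ} (hκ : 0 < κ) {W : Pt n → ENNReal} (hW : Measurable W) {a C : ENNReal}
    (ha : a * ENNReal.ofReal (2 ^ (n + 2) * κ) ≤ 1/2) (hC : C ≠ ⊤) (hfin : ∫⁻ ξ, W ξ ∂(mm n) ≠ ⊤)
    (h : ∀ᵐ ξ ∂(mm n), W ξ ≤ C + a * ∫⁻ η, ENNReal.ofReal (kn κ ξ η) * W η ∂(mm n)) :
    ∀ᵐ ξ ∂(mm n), W ξ ≤ 2 * C := by
  set v : Pt n → ENNReal := fun ξ => W ξ - 2 * C with hv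
  have mv : Measurable v := hW.sub dd
  set κ' := ENNReal.ofReal (2 ^ (n + 2) * κ)
  have h1 : ∀ᵐ ξ ∂(mm n), v ξ ≤ a * ∫⁻ η, ENNReal.ofReal (kn κ ξ η) * v η ∂(mm n) := by
    filter_upwards [h] with ξ hξ
    simp only [hv]
    rw [tsub_le_iff_left]
    refine hξ.trans ?_
    have e1 : ∫⁻ η, ENNReal.ofReal (kn κ ξ η) * W η ∂(mm n)
        ≤ (∫⁻ η, ENNReal.ofReal (kn κ ξ η) ∂(mm n)) * (2 * C) + ∫⁻ η, ENNReal.ofReal (kn κ ξ η) * v η ∂(mm n) := by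
      rw [← ua _ (ic κ ξ).ennreal_ofReal,
        ← mn ((ic κ ξ).ennreal_ofReal.mul_const _)]
      refine lintegral_mono fun η => ?_
      rw [← je]
      gcongr
      exact le_add_tsub
    calc _ ≤ C + a * ((∫⁻ η, ENNReal.ofReal (kn κ ξ η) ∂(mm n)) * (2 * C) + ∫⁻ η, ENNReal.ofReal (kn κ ξ η) * v η ∂(mm n)) := by gcongr
      _ ≤ C + a * (κ' * (2 * C) + ∫⁻ η, ENNReal.ofReal (kn κ ξ η) * v η ∂(mm n)) := by gcongr; exact tu hn hκ ξ
      _ = C + (a * κ') * (2 * C) + a * ∫⁻ η, ENNReal.ofReal (kn κ ξ η) * v η ∂(mm n) := by ring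
      _ ≤ C + (1/2) * (2 * C) + a * ∫⁻ η, ENNReal.ofReal (kn κ ξ η) * v η ∂(mm n) := by gcongr
      _ = _ := by
        rw [← bc, one_div, ENNReal.inv_mul_cancel (by simp) (by simp), nt, ← two_mul]
  have mk : Measurable (fun q : Pt n × Pt n => ENNReal.ofReal (kn κ q.1 q.2) * v q.2) :=
    (nd κ).ennreal_ofReal.mul (mv.comp mr)
  have h2 : ∫⁻ ξ, v ξ ∂(mm n) ≤ (1/2) * ∫⁻ ξ, v ξ ∂(mm n) := by
    calc _ ≤ ∫⁻ ξ, a * ∫⁻ η, ENNReal.ofReal (kn κ ξ η) * v η ∂(mm n) ∂(mm n) := gb h1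
      _ = a * ∫⁻ η, ∫⁻ ξ, ENNReal.ofReal (kn κ ξ η) * v η ∂(mm n) ∂(mm n) := by
        rw [db _ mk.lintegral_prod_right', lintegral_lintegral_swap mk.aemeasurable]
      _ ≤ a * ∫⁻ η, κ' * v η ∂(mm n) := by
        gcongr with η
        simp only [sc κ _ η]
        rw [ua _ (ic κ η).ennreal_ofReal]
        gcongr
        exact tu hn hκ η
      _ = (a * κ') * ∫⁻ η, v η ∂(mm n) := by rw [db _ mv, bc]
      _ ≤ _ := by gcongr
  have h3 : ∫⁻ ξ, v ξ ∂(mm n) ≠ ⊤ := ne_top_of_le_ne_top hfin (lintegral_mono fun ξ => tsub_le_self)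
  have h4 : ∫⁻ ξ, v ξ ∂(mm n) = 0 := by
    by_contra h0
    have : (1/2) * ∫⁻ ξ, v ξ ∂(mm n) < ∫⁻ ξ, v ξ ∂(mm n) := by
      rw [one_div, bk, ← az]; exact ENNReal.half_lt_self h0 h3
    exact absurd h2 (not_le.2 this)
  rw [lintegral_eq_zero_iff mv] at h4
  filter_upwards [h4] with ξ hξ
  exact tsub_eq_zero_iff_le.1 hξ
def rho (μ s : ℝ) (ξ : Pt n) : ℝ := μ * wt ξ / wt (scalePt n μ s ξ)
lemma jc {μ : ℝ} (hμ : 0 < μ) (s : ℝ) (ξ : Pt n) : 0 < rho μ s ξ := by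
  have := ad ξ; have := ad (scalePt n μ s ξ); unfold rho; positivity
lemma ra (μ s : ℝ) (p : Pt n) (j : Fin n) : zc (scalePt n μ s p) j = μ * zc p j := by
  apply bz <;> simp [zc, scalePt]
lemma tf (μ s : ℝ) (ξ η : Pt n) : KA (scalePt n μ s ξ) (scalePt n μ s η) = (μ^2 : ℝ) * KA ξ η := by
  rw [ei, ei, jb, jb]
  simp only [ra, map_mul, map_sub, ug, gh]
  have : ∀ j, (μ:ℂ) * zc η j * (μ * conj (zc ξ j)) = (μ^2 : ℝ) * (zc η j * conj (zc ξ j)) := fun j => by push_cast; ring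
  simp only [this, ← ap]; ring
lemma se {μ : ℝ} (hμ : 0 < μ) (s : ℝ) (ξ η : Pt n) :
    kk ξ η = rho μ s ξ ^ n * rho μ s η ^ n * kk (scalePt n μ s ξ) (scalePt n μ s η) := by
  have h1 := ad ξ; have h2 := ad η; have h3 := ad (scalePt n μ s ξ); have h4 := ad (scalePt n μ s η)
  have h5 := cu (n := n)
  unfold kk rho
  rw [tf, am, aj, ac (by positivity), mo, mo, ci, ci, ci]
  rcases eq_or_ne (‖KA ξ η‖ ^ n) 0 with h0 | h0
  · rw [h0]; simp
  field_simp
  ring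
lemma lu (μ s : ℝ) : Measurable (rho (n := n) μ s) := by
  unfold rho
  have h1 := (bo (n := n)).measurable
  have h2 := (bo (n := n)).measurable.comp (bv μ s)
  simp only [cg] at h2
  exact (dd.mul h1).div h2
lemma ry {μ : ℝ} (hμ : 0 < μ) (s : ℝ) {f : Pt n → ENNReal} (hf : Measurable f) :
    ∫⁻ η, f (scalePt n μ s η) * ENNReal.ofReal (rho μ s η ^ (2 * n + 2)) ∂(mm n) = ∫⁻ η, f η ∂(mm n) := by
  have mS := bv (n := n) μ s
  have m0 : Measurable (fun η => f (scalePt n μ s η) * ENNReal.ofReal (rho μ s η ^ (2 * n + 2))) :=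
    (hf.comp mS).mul ((lu μ s).pow_const _).ennreal_ofReal
  rw [jh _ m0, jh _ hf]
  have e : ∀ η : Pt n, ENNReal.ofReal ((wt η ^ (2 * n + 2))⁻¹) * (f (scalePt n μ s η) * ENNReal.ofReal (rho μ s η ^ (2 * n + 2)))
      = ENNReal.ofReal (μ ^ (2 * n + 2)) * (fun p => ENNReal.ofReal ((wt p ^ (2 * n + 2))⁻¹) * f p) (scalePt n μ s η) := by
    intro η
    have h2 := ad η; have h4 := ad (scalePt n μ s η)
    have : ENNReal.ofReal ((wt η ^ (2 * n + 2))⁻¹) * ENNReal.ofReal (rho μ s η ^ (2 * n + 2))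
       = ENNReal.ofReal (μ ^ (2 * n + 2)) * ENNReal.ofReal ((wt (scalePt n μ s η) ^ (2 * n + 2))⁻¹) := by
      rw [← ar (by positivity), ← ar (by positivity)]
      congr 1
      rw [rho, mo, ci]; field_simp
    rw [mul_left_comm, this]; ring
  have mg : Measurable (fun p : Pt n => ENNReal.ofReal ((wt p ^ (2 * n + 2))⁻¹) * f p) := ig.mul hf
  simp only [e]
  have mgS : Measurable (fun p : Pt n => ENNReal.ofReal ((wt (scalePt n μ s p) ^ (2 * n + 2))⁻¹) * f (scalePt n μ s p)) := mg.comp mS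
  rw [db _ mgS, ← lintegral_map (f := fun p => ENNReal.ofReal ((wt p ^ (2 * n + 2))⁻¹) * f p) mg mS, gv μ s hμ, lintegral_smul_measure, ak, ← bc,
    ← ar (by positivity), da (by positivity), ENNReal.ofReal_one, nt]
end HW
namespace HW
open InnerProductSpace
open scoped RealInnerProductSpace
lemma os {ι H : Type*} [NormedAddCommGroup H] [InnerProductSpace ℝ H] [CompleteSpace H]
    (b : HilbertBasis ι ℝ H) (c : ι → ℝ) {C : ℝ} (hC0 : 0 ≤ C) (hC : ∀ i, |c i| ≤ C) :
    ∃ D : H →L[ℝ] H, ‖D‖ ≤ C ∧ ∀ x i, ⟪b i, D x⟫ = c i * ⟪b i, x⟫ := by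
  have h2 : (0:ℝ) < (2 : ENNReal).toReal := by norm_num
  have mem : ∀ f : lp (fun _ : ι => ℝ) 2, Memℓp (fun i => c i * f i) 2 := fun f => by
    have h1 := ((lp.memℓp f).norm.const_smul C)
    refine h1.mono fun i => ?_
    simp only [cq, ak, am, af]
    exact ag (hC i) (aq _)
  let D0 : lp (fun _ : ι => ℝ) 2 →ₗ[ℝ] lp (fun _ : ι => ℝ) 2 :=
    { toFun := fun f => ⟨fun i => c i * f i, mem f⟩
      map_add' := fun f g => by ext i; simp [je]; rfl
      map_smul' := fun r f => by ext i; simp; ring }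
  have hD0 : ∀ f, ‖D0 f‖ ≤ C * ‖f‖ := fun f => by
    refine lp.norm_le_of_forall_sum_le h2 (by positivity) fun s => ?_
    have h3 := lp.sum_rpow_le_norm_rpow h2 f s
    rw [kj hC0 (ai _)]
    refine ew ?_ (aa h3 (by positivity))
    rw [ap]
    refine Finset.sum_le_sum fun i _ => ?_
    rw [← kj hC0 (ai _)]
    refine Real.rpow_le_rpow (ai _) ?_ h2.le
    simp only [D0, LinearMap.coe_mk, AddHom.coe_mk, am, af]
    exact ag (hC i) (aq _)
  let D1 := D0.mkContinuous C hD0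
  refine ⟨(b.repr.symm.toContinuousLinearEquiv.toContinuousLinearMap ∘L D1) ∘L
    b.repr.toContinuousLinearEquiv.toContinuousLinearMap, ?_, ?_⟩
  · refine ContinuousLinearMap.opNorm_le_bound _ hC0 fun x => ?_
    simp only [df]
    have := hD0 (b.repr x)
    simpa [D1] using this
  · intro x i
    rw [← HilbertBasis.repr_apply_apply, ← HilbertBasis.repr_apply_apply]
    simp [D1, D0]
lemma ij {ι H : Type*} [NormedAddCommGroup H] [InnerProductSpace ℝ H] [CompleteSpace H]
    (b : HilbertBasis ι ℝ H) {x y : H} (h : ∀ i, ⟪b i, x⟫ = ⟪b i, y⟫) : x = y := by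
  apply b.repr.injective
  ext i
  rw [b.repr_apply_apply, b.repr_apply_apply, h]
abbrev FV := ℕ →₀ ℝ
def ev (m : ℕ) : FV := Finsupp.single m 1
def Wm (m : ℕ) : Submodule ℝ FV := Submodule.span ℝ (ev '' Set.Iio m)
lemma ju {k m : ℕ} (h : k ≤ m) : Wm k ≤ Wm m := uc (Set.image_mono (Set.Iio_subset_Iio h))
theorem spectral {H : Type*} [NormedAddCommGroup H] [InnerProductSpace ℝ H] [CompleteSpace H]
    (E : FV →ₗ[ℝ] H) (hE : DenseRange E) (Lc : FV →ₗ[ℝ] FV) (l : ℕ → ℝ)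
    (htri : ∀ m, Lc (ev m) - l m • ev m ∈ Wm m)
    (hsym : ∀ x y, ⟪E (Lc x), E y⟫ = ⟪E x, E (Lc y)⟫)
    (hl : ∀ m, 1 ≤ l m) (p d : ℝ) (hd : 0 < d) (hp : p ≠ 0) (hgap : ∀ m, l m ≠ p → d ≤ |1 - p / l m|) (M : ℕ)
    (hM : ∀ m, l m = p → m ≤ M) :
    ∃ T R : H →L[ℝ] H, ‖T‖ ≤ 1 ∧ (∀ x y, ⟪T x, y⟫ = ⟪x, T y⟫) ∧ (∀ x, T (E (Lc x)) = E x) ∧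
      DenseRange (fun x => E (Lc x)) ∧
      (∀ y, p • T (R y - p • T (R y) - y) = R y - p • T (R y) - y) ∧
      (∀ y x, p • T x = x → ⟪R y, x⟫ = 0) ∧
      (∀ x, (∀ y, p • T y = y → ⟪x, y⟫ = 0) → R (x - p • T x) = x) ∧
      (∀ x, p • T x = x → R x = 0) ∧
      (∀ x, p • T x = x → x ∈ Submodule.span ℝ ((fun k => E (ev k)) '' Set.Iic M)) := by
  set f : ℕ → H := fun k => E (ev k) with hf
  set g : ℕ → H := gramSchmidt ℝ f with hg
  have mapW : ∀ m, (Wm m).map E = Submodule.span ℝ (f '' Set.Iio m) := fun m => by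
    rw [Wm, Submodule.map_span, Set.image_image]
  have orthW : ∀ m, ∀ x ∈ Wm m, ⟪g m, E x⟫ = 0 := fun m x hx => by
    have h1 : E x ∈ Submodule.span ℝ (g '' Set.Iio m) := by
      rw [hg, tz, ← mapW]; exact Submodule.mem_map_of_mem hx
    refine cx (p := fun y _ => ⟪g m, y⟫ = 0) ?_ (by simp) ?_ ?_ h1
    · rintro _ ⟨k, hk, rfl⟩
      exact gramSchmidt_orthogonal ℝ f (ne_of_gt hk)
    · intro a b _ _ ha hb; rw [ql, ha, hb, add_zero]
    · intro r a _ ha; rw [ds, ha, mul_zero]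
  have hx : ∀ m, ∃ y ∈ Wm m, E (ev m + y) = g m := fun m => by
    have h1 : g m - f m ∈ (Wm m).map E := by
      rw [mapW, ← tz ℝ]
      rw [hg, gramSchmidt_def, sub_sub_cancel_left]
      refine Submodule.neg_mem _ (Submodule.sum_mem _ fun i hi => ?_)
      have h3 := Submodule.starProjection_apply_mem (ℝ ∙ gramSchmidt ℝ f i) (f m)
      refine uc ?_ h3
      rintro _ rfl
      exact ⟨i, by simpa using hi, rfl⟩
    obtain ⟨y, hy, hyE⟩ := h1
    exact ⟨y, hy, by rw [map_add, hyE]; simp [hf]⟩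
  choose y hyW hyE using hx
  set X : ℕ → FV := fun m => ev m + y m with hX
  have evW : ∀ m, ev m ∈ Wm (m+1) := fun m => bt ⟨m, by simp, rfl⟩
  have LcW : ∀ m, ∀ x ∈ Wm m, Lc x ∈ Wm m := fun m x hx => by
    refine cx (p := fun y _ => Lc y ∈ Wm m) ?_ (by simp) ?_ ?_ hx
    · rintro _ ⟨k, hk, rfl⟩
      have h1 := htri k
      have h2 : Lc (ev k) = (Lc (ev k) - l k • ev k) + l k • ev k := by simp
      rw [h2]
      exact gc _ (ju (le_of_lt hk) h1) (cf _ _ (ju hk (evW k)))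
    · intro a b _ _ ha hb; rw [map_add]; exact gc _ ha hb
    · intro r a _ ha; rw [map_smul]; exact cf _ _ ha
  have XW : ∀ m, X m ∈ Wm (m+1) := fun m => gc _ (evW m) (ju (Nat.le_succ m) (hyW m))
  have eig : ∀ m, E (Lc (X m)) = l m • g m := fun m => by
    have h1 : Lc (X m) - l m • X m ∈ Wm m := by
      have : Lc (X m) - l m • X m = (Lc (ev m) - l m • ev m) + (Lc (y m) - l m • y m) := by
        simp only [hX, map_add, smul_add]; abel
      rw [this]
      exact gc _ (htri m) (Submodule.sub_mem _ (LcW m _ (hyW m)) (cf _ _ (hyW m)))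
    set v := E (Lc (X m)) - l m • g m with hv
    have hv2 : v = E (Lc (X m) - l m • X m) := by rw [map_sub, map_smul, hyE]
    have h2 : v ∈ Submodule.span ℝ (g '' Set.Iio m) := by
      rw [hg, tz, ← mapW, hv2]; exact Submodule.mem_map_of_mem h1
    have h3 : ∀ w ∈ Submodule.span ℝ (g '' Set.Iio m), ⟪v, w⟫ = 0 := by
      intro w hw
      refine cx (p := fun y _ => ⟪v, y⟫ = 0) ?_ (by simp) ?_ ?_ hw
      · rintro _ ⟨k, hk, rfl⟩
        have e1 : ⟪g m, g k⟫ = 0 := gramSchmidt_orthogonal ℝ f (ne_of_gt hk)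
        rw [hv, dr, el, e1, mul_zero, tk, ← hyE k, hsym, hyE m]
        exact orthW m _ (LcW m _ (ju hk (XW k)))
      · intro a b _ _ ha hb; rw [ql, ha, hb, add_zero]
      · intro r a _ ha; rw [ds, ha, mul_zero]
    have h4 := h3 v h2
    rw [qe] at h4
    exact gj.1 h4
  let ι := {m : ℕ // g m ≠ 0}
  let v : ι → H := fun i => (‖g i.1‖⁻¹) • g i.1
  have hv : Orthonormal ℝ v := by
    constructor
    · intro i
      simp only [v]
      rw [norm_smul, norm_inv, norm_norm, ub (qd.2 i.2)]
    · intro i j hij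
      simp only [v]
      rw [el, ds, gramSchmidt_orthogonal ℝ f (fun h => hij (Subtype.ext h))]; simp
  have allg : ∀ x : H, (∀ m, ⟪g m, x⟫ = 0) → x = 0 := by
    intro x hx
    have h1 : ∀ u : FV, ⟪E u, x⟫ = 0 := by
      intro u
      have : E u ∈ Submodule.span ℝ (Set.range g) := by
        rw [hg, span_gramSchmidt]
        induction u using ek with
        | zero => simp
        | add a b ha hb => rw [map_add]; exact gc _ ha hb
        | single k r =>
          have : (Finsupp.single k r : FV) = r • ev k := by simp [ev]
          rw [this, map_smul]
          exact cf _ _ (bt ⟨k, rfl⟩)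
      refine cx (p := fun y _ => ⟪y, x⟫ = 0) ?_ (by simp) ?_ ?_ this
      · rintro _ ⟨k, rfl⟩; exact hx k
      · intro a b _ _ ha hb; rw [inner_add_left, ha, hb, add_zero]
      · intro r a _ ha; rw [el, ha, mul_zero]
    have h2 : ∀ u : H, ⟪u, x⟫ = 0 := fun u => by
      refine hE.induction_on (p := fun u => ⟪u, x⟫ = 0) u (isClosed_eq (by fun_prop) br) h1
    exact qe.1 (h2 x)
  have allv : ∀ x : H, (∀ i, ⟪v i, x⟫ = 0) → x = 0 := by
    intro x hx
    refine allg x fun m => ?_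
    by_cases hm : g m = 0
    · rw [hm, inner_zero_left]
    · have := hx ⟨m, hm⟩
      simp only [v, el] at this
      rcases qj.1 this with h | h
      · exfalso; simp at h; exact hm h
      · exact h
  have hbot : (Submodule.span ℝ (Set.range v))ᗮ = ⊥ := by
    rw [eq_bot_iff]
    intro x hx
    rw [Submodule.mem_bot]
    exact allv x fun i => (Submodule.mem_orthogonal _ _).1 hx _ (bt ⟨i, rfl⟩)
  let b := HilbertBasis.mkOfOrthogonalEqBot hv hbot
  have hb : ∀ i, b i = v i := fun i => by simp [b]
  have lpos : ∀ m, 0 < l m := fun m => lt_of_lt_of_le one_pos (hl m)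
  obtain ⟨T, hT, hTb⟩ := os b (fun i => (l i.1)⁻¹) (C := 1) zero_le_one (fun i => by
    rw [bm (ii.2 (lpos _))]; exact bl (hl _))
  obtain ⟨R, hR, hRb⟩ := os b (fun i => if l i.1 = p then 0 else (1 - p / l i.1)⁻¹) (C := d⁻¹) (by positivity) (fun i => by
    split_ifs with h
    · simp; exact hd.le
    · rw [abs_inv]; exact inv_anti₀ hd (hgap _ h))
  have gapne : ∀ i : ι, l i.1 ≠ p → 1 - p / l i.1 ≠ 0 := fun i h => by
    have := lt_of_lt_of_le hd (hgap _ h)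
    exact abs_pos.1 this
  have eqp : ∀ i : ι, l i.1 = p → p * (l i.1)⁻¹ = 1 := fun i h => by rw [h, da hp]
  have Nchar : ∀ x, p • T x = x → ∀ i, l i.1 ≠ p → ⟪b i, x⟫ = 0 := by
    intro x hx i hi
    have h1 : ⟪b i, p • T x⟫ = ⟪b i, x⟫ := by rw [hx]
    rw [ds, hTb] at h1
    have h2 : (1 - p / l i.1) * ⟪b i, x⟫ = 0 := by rw [az]; linear_combination -h1
    exact (qj.1 h2).resolve_left (gapne i hi)
  have bN : ∀ i, l i.1 = p → p • T (b i) = b i := by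
    intro i hi
    refine ij b fun j => ?_
    rw [ds, hTb]
    by_cases hij : j = i
    · rw [hij, ← bc, eqp i hi, nt]
    · rw [b.orthonormal.2 hij]; simp
  have Tsym : ∀ x y, ⟪T x, y⟫ = ⟪x, T y⟫ := by
    intro x y
    rw [← b.tsum_inner_mul_inner, ← b.tsum_inner_mul_inner]
    congr 1; ext1 i
    rw [hTb, dn, hTb, dn (b i) x]; ring
  refine ⟨T, R, hT, Tsym, ?_, ?_, ?_, ?_, ?_, ?_, ?_⟩
  · intro x
    refine ij b fun i => ?_
    rw [hTb, hb]
    simp only [v, el]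
    rw [← hyE i.1, ← hsym, eig, el, hyE]
    have := (lpos i.1).ne'
    simp; field_simp
  · have : (LinearMap.range (E ∘ₗ Lc)).topologicalClosure = ⊤ := by
      rw [Submodule.topologicalClosure_eq_top_iff, eq_bot_iff]
      intro x hx
      rw [Submodule.mem_bot]
      refine allg x fun m => ?_
      have h1 := (Submodule.mem_orthogonal _ _).1 hx (E (Lc (X m))) ⟨X m, rfl⟩
      rw [eig, el] at h1
      exact (qj.1 h1).resolve_left (by simpa using (lpos m).ne')
    have h2 := (Submodule.dense_iff_topologicalClosure_eq_top.2 this)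
    rw [LinearMap.coe_range] at h2
    exact h2
  · intro y
    refine ij b fun i => ?_
    simp only [ds, hTb, gk, hRb]
    split_ifs with h
    · have := eqp i h; linear_combination (-⟪b i, y⟫) * this
    · have h1 := gapne i h
      rw [az] at h1
      have h2 : (1 - p * (l i.1)⁻¹) * (1 - p / l i.1)⁻¹ = 1 := by rw [az]; exact da h1
      linear_combination (p * (l i.1)⁻¹ - 1) * ⟪b i, y⟫ * h2
  · intro y x hx
    rw [← b.tsum_inner_mul_inner]
    convert tsum_zero with i
    rw [dn, hRb]
    split_ifs with h
    · simp
    · rw [Nchar x hx i h]; simp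
  · intro x hx
    refine ij b fun i => ?_
    simp only [ds, hTb, gk, hRb]
    split_ifs with h
    · rw [zero_mul, dn, hx _ (bN i h)]
    · have h2 : (1 - p / l i.1)⁻¹ * (1 - p / l i.1) = 1 := ub (gapne i h)
      rw [az] at h2 ⊢
      linear_combination ⟪b i, x⟫ * h2
  · intro x hx
    refine ij b fun i => ?_
    rw [hRb, inner_zero_right]
    split_ifs with h
    · simp
    · rw [Nchar x hx i h, mul_zero]
  · intro x hx
    have h1 := b.hasSum_repr x
    have hfin : {i : ι | l i.1 = p}.Finite := by
      refine Set.Finite.of_injOn (f := Subtype.val) (t := Set.Iic M) (fun i hi => hM _ hi) Subtype.val_injective.injOn (Set.finite_Iic M)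
    have h2 : x = ∑ i ∈ hfin.toFinset, b.repr x i • b i := by
      refine h1.unique (hasSum_sum_of_ne_finset_zero fun i hi => ?_)
      rw [b.repr_apply_apply, Nchar x hx i (by simpa using hi), zero_smul]
    rw [h2]
    refine Submodule.sum_mem _ fun i hi => cf _ _ ?_
    rw [hb]
    refine cf _ _ ?_
    rw [← span_gramSchmidt_Iic ℝ f M]
    exact bt ⟨i.1, hM _ (by simpa using hi), rfl⟩
end HW
namespace HW
open scoped ComplexConjugate RealInnerProductSpace ENNReal
variable {n : ℕ}
def nu (n : ℕ) : Measure ℂ := (mm n).map tau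
abbrev HH (n : ℕ) := Lp ℝ 2 (nu n)
def B1 (τ : ℂ) : ℂ := (1 + τ)⁻¹
def pr (e : ℕ) (z : ℂ) : ℝ := if e = 0 then z.re else z.im
def bf (m : ℕ) (τ : ℂ) : ℝ := pr (m % 2) (mon (m / 2).unpair.1 (m / 2).unpair.2 (B1 τ))
def ef : FV →ₗ[ℝ] (ℂ → ℝ) := Finsupp.linearCombination ℝ bf
def ix (a b e : ℕ) : ℕ := 2 * Nat.pair a b + e
def lv (n m : ℕ) : ℝ := l0 n (m / 2).unpair.1 (m / 2).unpair.2
def Lv (n m : ℕ) : FV := lv n m • ev m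
  - l1 n (m / 2).unpair.1 (m / 2).unpair.2 • ev (ix (m / 2).unpair.1 ((m / 2).unpair.2 - 1) (m % 2))
  - l1 n (m / 2).unpair.2 (m / 2).unpair.1 • ev (ix ((m / 2).unpair.1 - 1) (m / 2).unpair.2 (m % 2))
def Lc (n : ℕ) : FV →ₗ[ℝ] FV := Finsupp.linearCombination ℝ (Lv n)
lemma mtau : Measurable (tau (n := n)) := mc.measurable
instance nu_fin : IsFiniteMeasure (nu n) := by unfold nu; infer_instance
lemma lm {P : ℂ → Prop} (hP : MeasurableSet {τ | P τ}) : (∀ᵐ τ ∂(nu n), P τ) ↔ ∀ᵐ p ∂(mm n), P (tau p) :=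
  ae_map_iff mtau.aemeasurable hP
lemma fn (p : Pt n) : 0 ≤ (tau p).re := ez p
lemma di : ∀ᵐ τ ∂(nu n), 0 ≤ τ.re :=
  (lm (measurableSet_le dd iu)).2 (ab fn)
lemma cn {P : ℂ → Prop} (h : ∀ᵐ τ ∂(nu n), P τ) : ∀ᵐ p ∂(mm n), P (tau p) := ae_of_ae_map mtau.aemeasurable h
lemma gx (p : Pt n) : B1 (tau p) = BB p := rfl
lemma one_le {τ : ℂ} (h : 0 ≤ τ.re) : 1 ≤ ‖1 + τ‖ := by
  have := cb (1 + τ)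
  have h2 := qk (1 + τ).re
  simp at this h2; linarith
lemma gy {τ : ℂ} (h : 0 ≤ τ.re) : ‖B1 τ‖ ≤ 1 := by
  rw [B1, norm_inv]; exact bl (one_le h)
lemma cj : Measurable B1 := by unfold B1; fun_prop
lemma rt (e : ℕ) (z : ℂ) : |pr e z| ≤ ‖z‖ := by
  unfold pr; split_ifs
  · exact cb z
  · exact ir z
lemma rz (e : ℕ) : Measurable (pr e) := by
  unfold pr; split_ifs
  · exact iu
  · exact Complex.measurable_im
lemma sa (m : ℕ) : Measurable (bf m) := by
  have h : Measurable (mon (m / 2).unpair.1 (m / 2).unpair.2) := by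
    unfold mon
    exact (measurable_id.pow_const _).mul (Complex.continuous_conj.measurable.pow_const _)
  exact (rz _).comp (h.comp cj)
lemma sx (m : ℕ) {τ : ℂ} (h : 0 ≤ τ.re) : |bf m τ| ≤ 1 := (rt _ _).trans (ib _ _ _ (gy h))
lemma cd (m : ℕ) : ef (ev m) = bf m := by simp [ef, ev]
lemma ip (m : ℕ) : Lc n (ev m) = Lv n m := by simp [Lc, ev]
lemma fb (x : FV) : Measurable (ef x) := by
  induction x using ek with
  | zero => rw [map_zero]; exact dd
  | add f g hf hg => rw [map_add]; exact hf.add hg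
  | single m r => rw [ef, Finsupp.linearCombination_single]; exact (sa m).const_smul r
lemma jn (x : FV) : ∃ C, ∀ τ : ℂ, 0 ≤ τ.re → |ef x τ| ≤ C := by
  induction x using ek with
  | zero => exact ⟨0, fun τ h => by simp⟩
  | add f g hf hg =>
    obtain ⟨C, hC⟩ := hf; obtain ⟨D, hD⟩ := hg
    refine ⟨C + D, fun τ h => ?_⟩
    rw [map_add, en]
    exact (ba _ _).trans (bw (hC τ h) (hD τ h))
  | single m r =>
    refine ⟨|r|, fun τ h => ?_⟩
    rw [ef, Finsupp.linearCombination_single, cq, ak, bh]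
    exact cv (aq _) (sx m h)
lemma ny {f : ℂ → ℝ} (hf : AEStronglyMeasurable f (nu n)) {C : ℝ} (h : ∀ τ : ℂ, 0 ≤ τ.re → |f τ| ≤ C) {p : ℝ≥0∞} :
    MemLp f p (nu n) := MemLp.of_bound hf C (di.mono fun τ hτ => h τ hτ)
lemma jm (x : FV) : MemLp (ef x) 2 (nu n) := by
  obtain ⟨C, hC⟩ := jn x
  exact ny (fb x).aestronglyMeasurable hC
def EE (n : ℕ) : FV →ₗ[ℝ] HH n where
  toFun x := (jm x).toLp (ef x)
  map_add' x y := by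
    rw [← MemLp.toLp_add]; exact qp _ _ (by rw [map_add])
  map_smul' r x := by
    rw [RingHom.id_apply, ← MemLp.toLp_const_smul]; exact qp _ _ (by rw [map_smul])
lemma dj (x : FV) : EE n x =ᵐ[nu n] ef x := (jm x).coeFn_toLp
lemma ku (hn : 1 ≤ n) (ξ : Pt n) {f : Pt n → ℝ} (hf : AEStronglyMeasurable f (mm n)) {C : ℝ} (hC : ∀ᵐ η ∂(mm n), |f η| ≤ C) :
    Integrable (fun η => kk ξ η * f η) (mm n) := (jy hn ξ).mul_bdd (c := C) hf hC
lemma po (hn : 1 ≤ n) (x : FV) (ξ : Pt n) : ∫ η, kk ξ η * ef (Lc n x) (tau η) ∂(mm n) = ef x (tau ξ) := by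
  have hi : ∀ x, Integrable (fun η => kk ξ η * ef x (tau η)) (mm n) := fun x => by
    obtain ⟨C, hC⟩ := jn x
    exact ku hn ξ ((fb x).comp mtau).aestronglyMeasurable (C := C) (ab fun η => hC _ (fn η))
  induction x using ek with
  | zero => simp
  | add f g hf hg =>
    simp only [map_add, en, je]
    rw [ep (hi _) (hi _), hf, hg]
  | single m r =>
    have h1 : Finsupp.single m r = r • ev m := by simp [ev]
    simp only [h1, map_smul, ip, cq, ak, mul_left_comm _ r]
    rw [ah]
    congr 1
    rw [cd, bf]
    set a := (m / 2).unpair.1; set b := (m / 2).unpair.2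
    have hix : ∀ a b τ, bf (ix a b (m % 2)) τ = pr (m % 2) (mon a b (B1 τ)) := fun a b τ => by
      have hm : m % 2 < 2 := Nat.mod_lt _ (by norm_num)
      have e1 : ix a b (m % 2) / 2 = Nat.pair a b := by unfold ix; omega
      have e2 : ix a b (m % 2) % 2 = m % 2 := by unfold ix; omega
      rw [bf, e1, e2, gn]
    have h2 : ∀ τ, ef (Lv n m) τ = pr (m % 2) (Lmon n a b (B1 τ)) := fun τ => by
      rw [Lv, map_sub, map_sub, map_smul, map_smul, map_smul, cd, cd, cd]
      simp only [ay, cq, hix]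
      simp only [bf, lv, pr, Lmon]
      split_ifs <;> simp <;> rfl
    simp only [h2, gx]
    rw [← tv hn a b ξ]
    have hI : Integrable (fun η => (kk ξ η : ℂ) * Lmon n a b (BB η)) (mm n) := by
      refine (jy hn ξ).ofReal.mul_bdd (c := |l0 n a b| + |l1 n a b| + |l1 n b a|) ?_ (ab fun η => mh a b _ (jz η))
      have h3 : Measurable (Lmon n a b) := by
        unfold Lmon mon
        have := Complex.continuous_conj.measurable
        fun_prop
      exact (h3.comp (cj.comp mtau)).aestronglyMeasurable
    have hp : ∀ (e : ℕ) (r : ℝ) (z : ℂ), r * pr e z = pr e (r * z) := fun e r z => by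
      unfold pr; split_ifs <;> simp
    simp only [hp]
    unfold pr
    split_ifs
    · exact integral_re hI
    · exact integral_im hI
lemma du (f g : HH n) : ⟪f, g⟫ = ∫ τ, f τ * g τ ∂(nu n) := by
  rw [ud]; congr 1; ext τ; simp [bk]
lemma jj {f : ℂ → ℝ} (hf : AEStronglyMeasurable f (nu n)) : ∫ τ, f τ ∂(nu n) = ∫ p, f (tau p) ∂(mm n) :=
  qu mtau.aemeasurable hf
lemma ti (hn : 1 ≤ n) (x y : FV) : ⟪EE n (Lc n x), EE n y⟫ = ⟪EE n x, EE n (Lc n y)⟫ := by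
  have key : ∀ x y : FV, ⟪EE n (Lc n x), EE n y⟫ =
      ∫ ξ, ∫ η, ef (Lc n x) (tau ξ) * (kk ξ η * ef (Lc n y) (tau η)) ∂(mm n) ∂(mm n) := fun x y => by
    simp only [ah, po hn]
    rw [du, ← jj (f := fun τ => ef (Lc n x) τ * ef y τ) ((fb _).mul (fb _)).aestronglyMeasurable]
    refine al ?_
    filter_upwards [dj (n := n) (Lc n x), dj (n := n) y] with τ h1 h2
    rw [h1, h2]
  rw [dn (EE n (Lc n y)), key, key, integral_integral_swap]
  · congr 1; ext ξ; congr 1; ext η; rw [ji]; ring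
  · obtain ⟨C, hC⟩ := jn (Lc n x)
    obtain ⟨D, hD⟩ := jn (Lc n y)
    have hk : Integrable (fun q : Pt n × Pt n => kk q.1 q.2) ((mm n).prod (mm n)) := by
      rw [integrable_prod_iff dw.aestronglyMeasurable]
      refine ⟨ab fun ξ => jy hn ξ, ?_⟩
      simp only [ac (ft _ _), tw hn]
      exact integrable_const _
    have m1 : Measurable (fun q : Pt n × Pt n => ef (Lc n x) (tau q.1)) := (fb _).comp (mtau.comp measurable_fst)
    have m2 : Measurable (fun q : Pt n × Pt n => ef (Lc n y) (tau q.2)) := (fb _).comp (mtau.comp mr)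
    have h1 := hk.bdd_mul m1.aestronglyMeasurable (ab fun q => hC _ (fn q.1))
    have h2 := h1.mul_bdd m2.aestronglyMeasurable (ab fun q => hD _ (fn q.2))
    refine h2.congr (ab fun q => ?_)
    simp only [Function.uncurry]; ring
end HW
namespace HW
open scoped ComplexConjugate RealInnerProductSpace ENNReal
variable {n : ℕ}
lemma rp (P : ℂ → ℂ) (hP : P ∈ Submodule.span ℂ (Set.range fun q : ℕ × ℕ => mon q.1 q.2)) :
    ∀ c : ℂ, ∃ x : FV, ∀ τ, (c * P (B1 τ)).re = ef x τ := by
  induction hP using cx with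
  | mem P h =>
    obtain ⟨⟨a, b⟩, rfl⟩ := h
    intro c
    refine ⟨c.re • ev (ix a b 0) - c.im • ev (ix a b 1), fun τ => ?_⟩
    have e1 : ∀ e < 2, bf (ix a b e) τ = pr e (mon a b (B1 τ)) := fun e he => by
      have e1 : ix a b e / 2 = Nat.pair a b := by unfold ix; omega
      have e2 : ix a b e % 2 = e := by unfold ix; omega
      rw [bf, e1, e2, gn]
    rw [map_sub, map_smul, map_smul, cd, cd]
    simp [e1, pr]
  | zero => exact fun c => ⟨0, fun τ => by simp⟩
  | add P Q _ _ hP hQ =>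
    intro c
    obtain ⟨x, hx⟩ := hP c; obtain ⟨y, hy⟩ := hQ c
    exact ⟨x + y, fun τ => by rw [map_add, en, en, je, gi, hx, hy]⟩
  | smul r P _ hP =>
    intro c
    obtain ⟨x, hx⟩ := hP (c * r)
    exact ⟨x, fun τ => by rw [← hx, cq, ak, bc]⟩
lemma rl (P : C(Metric.closedBall (0:ℂ) 1, ℂ)) (hP : P ∈ (polynomialFunctions (Metric.closedBall (0:ℂ) 1)).starClosure) :
    ∃ P' ∈ Submodule.span ℂ (Set.range fun q : ℕ × ℕ => mon q.1 q.2), ∀ u, P u = P' u := by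
  rw [polynomialFunctions.starClosure_eq_adjoin_X] at hP
  set S := Submodule.span ℂ (Set.range fun q : ℕ × ℕ => mon q.1 q.2) with hS
  have hm : ∀ a b, mon a b ∈ S := fun a b => bt ⟨(a, b), rfl⟩
  induction hP using StarAlgebra.adjoin_induction with
  | mem P h =>
    rw [Set.mem_singleton_iff] at h
    refine ⟨mon 1 0, hm _ _, fun u => ?_⟩
    subst h; simp [mon]
  | algebraMap r => exact ⟨r • mon 0 0, S.smul_mem _ (hm _ _), fun u => by simp [mon]⟩
  | add P Q _ _ hP hQ =>
    obtain ⟨p, h1, h2⟩ := hP; obtain ⟨q, h3, h4⟩ := hQ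
    exact ⟨p + q, S.add_mem h1 h3, fun u => by simp [h2, h4]⟩
  | mul P Q _ _ hP hQ =>
    obtain ⟨p, h1, h2⟩ := hP; obtain ⟨q, h3, h4⟩ := hQ
    refine ⟨p * q, ?_, fun u => by simp [h2, h4]⟩
    have := Submodule.mul_mem_mul h1 h3
    rw [hS, Submodule.span_mul_span] at this
    refine uc ?_ this
    rintro _ ⟨_, ⟨⟨a, b⟩, rfl⟩, _, ⟨⟨c, d⟩, rfl⟩, rfl⟩
    refine ⟨(a + c, b + d), ?_⟩
    ext u; simp only [mon, Pi.mul_apply]; ring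
  | star P _ hP =>
    obtain ⟨p, h1, h2⟩ := hP
    refine ⟨fun u => conj (p u), ?_, fun u => by simp [h2]⟩
    clear h2
    induction h1 using cx with
    | mem p h =>
      obtain ⟨⟨a, b⟩, rfl⟩ := h
      convert hm b a using 1
      ext u; simp only [mon]; rw [map_mul, map_pow, map_pow, Complex.conj_conj, bk]
    | zero => simp only [gm, map_zero]; exact S.zero_mem
    | add p q _ _ hp hq =>
      convert S.add_mem hp hq using 1
      ext u; simp
    | smul r p _ hp =>
      convert S.smul_mem (conj r) hp using 1
      ext u; simp
lemma denseEE : DenseRange (EE n) := by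
  rw [Metric.denseRange_iff]
  intro f ε hε
  set M := (nu n Set.univ) ^ ((2:ℝ≥0∞).toReal⁻¹) with hM
  have hMt : M ≠ ⊤ := qy (by positivity) (measure_ne_top _ _)
  set δ := ε / 4 / (M.toReal + 1) with hδ
  have hδ0 : 0 < δ := by positivity
  have hBB : ∀ τ : ℂ, (B1 τ)⁻¹ - 1 = τ := fun τ => by rw [B1, inv_inv]; ring
  have hs : StronglyMeasurable (fun u : ℂ => f (u⁻¹ - 1)) :=
    (kl f).comp_measurable (by fun_prop)
  have hf' : MemLp (fun u : ℂ => f (u⁻¹ - 1)) 2 ((nu n).map B1) := by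
    rw [memLp_map_measure_iff hs.aestronglyMeasurable cj.aemeasurable]
    simp only [cg, hBB]
    exact jw f
  obtain ⟨g, hg1, hg2⟩ := hf'.exists_boundedContinuous_eLpNorm_sub_le (by norm_num) (ε := ENNReal.ofReal (ε / 4)) (by simpa using hε)
  have hg3 : eLpNorm (fun τ => f τ - g (B1 τ)) 2 (nu n) ≤ ENNReal.ofReal (ε / 4) := by
    rw [eLpNorm_map_measure (hs.aestronglyMeasurable.sub g.continuous.aestronglyMeasurable) cj.aemeasurable] at hg1
    simpa only [cg, ay, hBB] using hg1
  let g' : C(Metric.closedBall (0:ℂ) 1, ℂ) := ⟨fun u => (g u : ℂ), by fun_prop⟩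
  have hcl : g' ∈ (polynomialFunctions (Metric.closedBall (0:ℂ) 1)).starClosure.topologicalClosure := by
    rw [polynomialFunctions.starClosure_topologicalClosure]; trivial
  rw [← SetLike.mem_coe, StarSubalgebra.topologicalClosure_coe, Metric.mem_closure_iff] at hcl
  obtain ⟨P, hP, hPd⟩ := hcl δ hδ0
  obtain ⟨P', hP', hPP⟩ := rl P hP
  obtain ⟨x, hx⟩ := rp P' hP' 1
  refine ⟨x, ?_⟩
  have h4 : eLpNorm (fun τ => g (B1 τ) - ef x τ) 2 (nu n) ≤ M * ENNReal.ofReal δ := by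
    refine eLpNorm_le_of_ae_bound (di.mono fun τ hτ => ?_)
    have hm : B1 τ ∈ Metric.closedBall (0:ℂ) 1 := by simpa using gy hτ
    have h5 := (ContinuousMap.dist_apply_le_dist (f := g') (g := P) ⟨B1 τ, hm⟩).trans hPd.le
    rw [em, hPP] at h5
    have h6 := (cb _).trans h5
    rw [← hx, nt, af]
    simpa [g'] using h6
  have h5 : eLpNorm (fun τ => f τ - ef x τ) 2 (nu n) ≤ ENNReal.ofReal (ε / 4) + M * ENNReal.ofReal δ := by
    have : (fun τ => f τ - ef x τ) = (fun τ => f τ - g (B1 τ)) + (fun τ => g (B1 τ) - ef x τ) := by ext τ; simp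
    rw [this]
    refine (eLpNorm_add_le ?_ ?_ (by norm_num)).trans (bw hg3 h4)
    · exact ((kl f).aestronglyMeasurable).sub (g.continuous.measurable.comp cj).aestronglyMeasurable
    · exact (g.continuous.measurable.comp cj).aestronglyMeasurable.sub (fb x).aestronglyMeasurable
  have h6 : dist f (EE n x) = (eLpNorm (fun τ => f τ - ef x τ) 2 (nu n)).toReal := by
    rw [em, Lp.norm_def]
    congr 1
    refine eLpNorm_congr_ae ?_
    filter_upwards [bb f (EE n x), dj (n := n) x] with τ h1 h2
    rw [h1, ay, h2]
  rw [h6]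
  refine (ENNReal.toReal_mono (by finiteness) h5).trans_lt ?_
  rw [ENNReal.toReal_add (by finiteness) (by finiteness), ENNReal.toReal_mul, ch (by positivity), ch hδ0.le]
  have : M.toReal * δ ≤ ε / 4 := by
    rw [hδ]
    have hM0 : 0 ≤ M.toReal := ENNReal.toReal_nonneg
    rw [mul_div_assoc', dx (by positivity)]
    nlinarith
  linarith
def pn (n : ℕ) : ℝ := ((n:ℝ) + 2) / n
def nv (a b : ℝ) : FV := a • ((2:ℝ) • ev 4 - ev 0) + b • ((2:ℝ) • ev 5)
def wf (a b : ℝ) (τ : ℂ) : ℝ := a * (2 * (B1 τ).re - 1) + b * (2 * (B1 τ).im)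
lemma pw : Nat.unpair 0 = (0, 0) := gn 0 0
lemma ts : Nat.unpair 1 = (0, 1) := gn 0 1
lemma qr : Nat.unpair 2 = (1, 0) := gn 1 0
lemma fe (a b : ℝ) : ef (nv a b) = wf a b := by
  ext τ
  simp only [nv, map_add, map_sub, map_smul, cd, wf]
  simp [bf, pw, qr, pr, mon]
lemma mb : ef (ev 0) = 1 := by
  ext τ; simp [cd, bf, pw, pr, mon]
lemma pj (hn : 1 ≤ n) : Lc n (ev 0) = ev 0 := by
  have hn0 : (n:ℝ) ≠ 0 := by positivity
  rw [ip, Lv]; simp only [lv, pw, l0, l1, Nat.zero_div]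
  simp only [CharP.cast_eq_zero, mul_zero, zero_div, zero_smul, tk, add_zero]
  rw [show (4 * ((n:ℝ)/2) * (n/2) / n^2) = 1 by field_simp; norm_num, one_smul]
lemma tb (hn : 1 ≤ n) (a b : ℝ) : ef (Lc n (nv a b)) = pn n • wf a b := by
  have hn0 : (n:ℝ) ≠ 0 := by positivity
  have e0 : Nat.pair 0 0 = 0 := rfl
  ext τ
  simp only [nv, map_add, map_sub, map_smul, pj hn, mb]
  simp only [ip, Lv, lv, ix, map_add, map_sub, map_smul, cd]
  simp [bf, pw, qr, pr, mon, l0, l1, pn, wf, e0]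
  field_simp
  ring
lemma oa (hn : 1 ≤ n) (m : ℕ) : lv n m = (n + 2 * (m/2).unpair.1) * (n + 2 * (m/2).unpair.2) / n^2 := by
  have hn0 : (n:ℝ) ≠ 0 := by positivity
  unfold lv l0; field_simp; ring
structure SP (n : ℕ) where
  T : HH n →L[ℝ] HH n
  R : HH n →L[ℝ] HH n
  nT : ‖T‖ ≤ 1
  sym : ∀ x y, ⟪T x, y⟫ = ⟪x, T y⟫
  hE : ∀ x, T (EE n (Lc n x)) = EE n x
  dense : DenseRange (fun x => EE n (Lc n x))
  R1 : ∀ y, pn n • T (R y - pn n • T (R y) - y) = R y - pn n • T (R y) - y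
  R2 : ∀ y x, pn n • T x = x → ⟪R y, x⟫ = 0
  R3 : ∀ x, (∀ y, pn n • T y = y → ⟪x, y⟫ = 0) → R (x - pn n • T x) = x
  R4 : ∀ x, pn n • T x = x → R x = 0
  T1 : T (EE n (ev 0)) = EE n (ev 0)
  TN : ∀ a b, pn n • T (EE n (nv a b)) = EE n (nv a b)
  N : ∀ x, pn n • T x = x → ∃ a b, x = EE n (nv a b)
lemma mj {x y : FV} (h : ef x = ef y) : EE n x = EE n y := qp (jm x) (jm y) (by rw [h])
theorem exSP (hn : 1 ≤ n) : Nonempty (SP n) := by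
  have hn1 : (1:ℝ) ≤ n := by exact_mod_cast hn
  have hn0 : (0:ℝ) < n := by linarith
  have hp : 0 < pn n := by unfold pn; positivity
  have hp1 : pn n - 1 ≠ 0 := by
    have : pn n - 1 = 2 / n := by unfold pn; field_simp; ring
    rw [this]; positivity
  have htri : ∀ m, Lc n (ev m) - lv n m • ev m ∈ Wm m := fun m => by
    rw [ip, Lv, sub_right_comm, sub_right_comm (lv n m • ev m), sub_self, zero_sub]
    have hm := Nat.div_add_mod m 2
    have hpr := Nat.pair_unpair (m / 2)
    have hin : ∀ k < m, ev k ∈ Wm m := fun k hk => bt ⟨k, hk, rfl⟩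
    refine Submodule.sub_mem _ (Submodule.neg_mem _ ?_) ?_
    · rcases Nat.eq_zero_or_pos (m / 2).unpair.2 with h | h
      · rw [h]; simp [l1]
      · refine cf _ _ (hin _ ?_)
        have := Nat.pair_lt_pair_right (m / 2).unpair.1 (show (m / 2).unpair.2 - 1 < (m / 2).unpair.2 by omega)
        unfold ix; omega
    · rcases Nat.eq_zero_or_pos (m / 2).unpair.1 with h | h
      · rw [h]; simp [l1]
      · refine cf _ _ (hin _ ?_)
        have := Nat.pair_lt_pair_left (m / 2).unpair.2 (show (m / 2).unpair.1 - 1 < (m / 2).unpair.1 by omega)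
        unfold ix; omega
  have hl : ∀ m, 1 ≤ lv n m := fun m => by
    rw [oa hn, bs (by positivity)]
    have h1 : (0:ℝ) ≤ (m/2).unpair.1 := by positivity
    have h2 : (0:ℝ) ≤ (m/2).unpair.2 := by positivity
    nlinarith [nw h1 h2]
  have hdich : ∀ m, lv n m = 1 ∨ (m ≤ 5 ∧ lv n m = pn n) ∨ (n + 4)/n ≤ lv n m := fun m => by
    have hpr := Nat.pair_unpair (m / 2)
    rw [oa hn]
    set a := (m/2).unpair.1; set b := (m/2).unpair.2
    by_cases h0 : a = 0 ∧ b = 0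
    · left; rw [h0.1, h0.2]; field_simp; norm_num
    by_cases h1 : (a = 0 ∧ b = 1) ∨ (a = 1 ∧ b = 0)
    · right; left
      rcases h1 with h1 | h1 <;> rw [h1.1, h1.2] at hpr <;> rw [h1.1, h1.2]
      · have : Nat.pair 0 1 = 1 := rfl
        exact ⟨by omega, by unfold pn; field_simp; norm_num⟩
      · have : Nat.pair 1 0 = 2 := rfl
        exact ⟨by omega, by unfold pn; field_simp; norm_num; ring⟩
    · right; right
      have h2 : 2 ≤ a + b := by omega
      have h2' : (2:ℝ) ≤ a + b := by exact_mod_cast h2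
      have ha : (0:ℝ) ≤ a := by positivity
      have hb : (0:ℝ) ≤ b := by positivity
      rw [mu hn0 (by positivity)]
      nlinarith [nw ha hb, nw hn0.le (nw ha hb), aa h2' (mul_pos hn0 hn0).le]
  have hgap : ∀ m, lv n m ≠ pn n → 2/((n:ℝ)+4) ≤ |1 - pn n / lv n m| := fun m hm => by
    rcases hdich m with h | h | h
    · rw [h, div_one, abs_sub_comm]
      refine ew ?_ (qk _)
      have : pn n - 1 = 2 / n := by unfold pn; field_simp; ring
      rw [this]; gcongr; linarith
    · exact absurd h.2 hm
    · refine ew ?_ (qk _)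
      have h1 : pn n / lv n m ≤ pn n / ((n+4)/n) := by gcongr
      have h2 : pn n / ((n+4)/n) = 1 - 2/((n:ℝ)+4) := by unfold pn; field_simp; ring
      linarith
  have hM : ∀ m, lv n m = pn n → m ≤ 5 := fun m hm => by
    rcases hdich m with h | h | h
    · exact absurd (by rw [← hm, h]; ring) hp1
    · exact h.1
    · rw [hm, pn, div_le_div_iff_of_pos_right hn0] at h; linarith
  obtain ⟨T, R, h1, h2, h3, h4, h5, h6, h7, h8, h9⟩ := spectral (EE n) denseEE (Lc n) (lv n) htri (ti hn) hl (pn n)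
    (2/((n:ℝ)+4)) (by positivity) hp.ne' hgap 5 hM
  have T1 : T (EE n (ev 0)) = EE n (ev 0) := by
    have := h3 (ev 0); rwa [pj hn] at this
  have TN : ∀ a b, pn n • T (EE n (nv a b)) = EE n (nv a b) := fun a b => by
    rw [← map_smul, ← map_smul, mj (y := Lc n (nv a b)), h3]
    rw [map_smul, fe, tb hn]
  refine ⟨⟨T, R, h1, h2, h3, h4, h5, h6, h7, h8, T1, TN, fun x hx => ?_⟩⟩
  have hsp : x ∈ Submodule.span ℝ {EE n (ev 0), EE n (nv 1 0), EE n (nv 0 1)} := by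
    refine Submodule.span_le.2 ?_ (h9 x hx)
    rintro _ ⟨k, hk, rfl⟩
    set S := Submodule.span ℝ {EE n (ev 0), EE n (nv 1 0), EE n (nv 0 1)} with hS
    have a1 : EE n (ev 0) ∈ S := bt (by simp)
    have a2 : EE n (nv 1 0) ∈ S := bt (by simp)
    have a3 : EE n (nv 0 1) ∈ S := bt (by simp)
    have key : ∀ c d e : ℝ, bf k = ef (c • ev 0 + d • nv 1 0 + e • nv 0 1) → EE n (ev k) ∈ S := fun c d e h => by
      rw [mj (x := ev k) ((cd k).trans h), map_add, map_add, map_smul, map_smul, map_smul]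
      exact S.add_mem (S.add_mem (S.smul_mem _ a1) (S.smul_mem _ a2)) (S.smul_mem _ a3)
    have hk5 : k ≤ 5 := hk
    have gen : ∀ c d e : ℝ, ef (c • ev 0 + d • nv 1 0 + e • nv 0 1) = fun τ => c + d * (2 * (B1 τ).re - 1) + e * (2 * (B1 τ).im) := fun c d e => by
      rw [map_add, map_add, map_smul, map_smul, map_smul, mb, fe, fe]; ext τ; simp [wf]
    interval_cases k
    · exact a1
    · refine key 0 0 0 ?_; rw [gen]; ext τ; simp [bf, pw, pr, mon]
    · refine key (1/2) (1/2) 0 ?_; rw [gen]; ext τ; simp [bf, ts, pr, mon]; ring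
    · refine key 0 0 (-1/2) ?_; rw [gen]; ext τ; simp [bf, ts, pr, mon]; ring
    · refine key (1/2) (1/2) 0 ?_; rw [gen]; ext τ; simp [bf, qr, pr, mon]; ring
    · refine key 0 0 (1/2) ?_; rw [gen]; ext τ; simp [bf, qr, pr, mon]
  obtain ⟨c, a, b, rfl⟩ := Submodule.mem_span_triple.1 hsp
  have e : a • EE n (nv 1 0) + b • EE n (nv 0 1) = EE n (nv a b) := by
    rw [← map_smul, ← map_smul, ← map_add]
    refine mj ?_
    rw [map_add, map_smul, map_smul, fe, fe, fe]; ext τ; simp [wf]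
  refine ⟨a, b, ?_⟩
  rw [add_assoc, e] at hx ⊢
  rw [map_add, smul_add, TN, map_smul, T1] at hx
  have h10 : (pn n - 1) • (c • EE n (ev 0)) = 0 := by
    rw [sub_smul, one_smul, gj]
    exact add_right_cancel hx
  rw [(smul_eq_zero.1 h10).resolve_left hp1, zero_add]
end HW
namespace HW
open scoped ComplexConjugate RealInnerProductSpace ENNReal
variable {n : ℕ}
lemma pk (hn : 1 ≤ n) {W : Pt n → ℝ≥0∞} (hW : Measurable W) :
    ∫⁻ ξ, ∫⁻ η, ENNReal.ofReal (kk ξ η) * W η ∂(mm n) ∂(mm n) = ∫⁻ η, W η ∂(mm n) := by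
  have hk : Measurable (fun q : Pt n × Pt n => ENNReal.ofReal (kk q.1 q.2) * W q.2) :=
    (dw.ennreal_ofReal).mul (hW.comp mr)
  rw [lintegral_lintegral_swap hk.aemeasurable]
  congr 1; ext1 η
  rw [ua _ (by simp only [ji _ η]; exact (ie η).ennreal_ofReal)]
  simp only [ji _ η, pp hn, nt]
def Mn (n : ℕ) : ℝ≥0∞ := nu n Set.univ ^ ((1:ℝ) / 2)
lemma io : Mn n ≠ ⊤ := qy (by positivity) (measure_ne_top _ _)
lemma cc (g : HH n) : Measurable g := (kl g).measurable
lemma co (g : HH n) : Measurable (fun p : Pt n => g (tau p)) := (cc g).comp mtau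
lemma dm (g : HH n) : ∫⁻ p, ‖g (tau p)‖ₑ ∂(mm n) ≤ ENNReal.ofReal ‖g‖ * Mn n := by
  have h := eLpNorm_le_eLpNorm_mul_rpow_measure_univ (μ := nu n) (p := 1) (q := 2) (by norm_num) (gg g)
  rw [eLpNorm_one_eq_lintegral_enorm] at h
  have h2 : ∫⁻ τ, ‖g τ‖ₑ ∂(nu n) = ∫⁻ p, ‖g (tau p)‖ₑ ∂(mm n) := lintegral_map (cc g).enorm mtau
  rw [← h2, Lp.norm_def, ENNReal.ofReal_toReal (Lp.eLpNorm_ne_top g)]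
  convert h using 2
  rw [Mn]; norm_num
lemma gq (hn : 1 ≤ n) (g : HH n) : ∀ᵐ ξ ∂(mm n), Integrable (fun η => kk ξ η * g (tau η)) (mm n) := by
  have h1 : ∫⁻ ξ, ∫⁻ η, ENNReal.ofReal (kk ξ η) * ‖g (tau η)‖ₑ ∂(mm n) ∂(mm n) ≠ ⊤ := by
    rw [pk hn (co g).enorm]
    exact ((dm g).trans_lt (ENNReal.mul_lt_top bg io.lt_top)).ne
  have hm : Measurable (fun q : Pt n × Pt n => ENNReal.ofReal (kk q.1 q.2) * ‖g (tau q.2)‖ₑ) :=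
    (dw.ennreal_ofReal).mul ((co g).comp mr).enorm
  filter_upwards [ae_lt_top hm.lintegral_prod_right' h1] with ξ hξ
  refine ⟨((ie ξ).mul (co g)).aestronglyMeasurable, ?_⟩
  rw [hasFiniteIntegral_iff_enorm]
  refine lt_of_eq_of_lt ?_ hξ
  congr 1; ext1 η
  rw [enorm_mul, qg (ft _ _)]
theorem Tker (S : SP n) (hn : 1 ≤ n) (h : HH n) :
    ∀ᵐ ξ ∂(mm n), S.T h (tau ξ) = ∫ η, kk ξ η * h (tau η) ∂(mm n) := by
  set e : Pt n → ℝ := fun ξ => S.T h (tau ξ) - ∫ η, kk ξ η * h (tau η) ∂(mm n) with he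
  have hm : Measurable e := by
    refine (co _).sub ?_
    have : StronglyMeasurable (fun q : Pt n × Pt n => kk q.1 q.2 * h (tau q.2)) :=
      (dw.mul ((co h).comp mr)).stronglyMeasurable
    exact this.integral_prod_right'.measurable
  have key : ∀ x : FV, ∫⁻ ξ, ‖e ξ‖ₑ ∂(mm n) ≤ ENNReal.ofReal (2 * ‖EE n (Lc n x) - h‖) * Mn n := fun x => by
    set g := EE n (Lc n x) - h with hg
    have hTg : S.T h = EE n x - S.T g := by rw [hg, map_sub, S.hE]; abel
    have b1 : ∀ᵐ ξ ∂(mm n), ‖e ξ‖ₑ ≤ ‖S.T g (tau ξ)‖ₑ + ∫⁻ η, ENNReal.ofReal (kk ξ η) * ‖g (tau η)‖ₑ ∂(mm n) := by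
      have c1 := cn (bb (EE n x) (S.T g))
      rw [← hTg] at c1
      have c2 := cn (dj (n := n) x)
      have c3 := cn (bb (EE n (Lc n x)) h)
      have c4 := cn (dj (n := n) (Lc n x))
      filter_upwards [c1, c2, gq hn h, gq hn g] with ξ d1 d2 d3 d4
      have : e ξ = -S.T g (tau ξ) + ∫ η, kk ξ η * g (tau η) ∂(mm n) := by
        have e1 : ∫ η, kk ξ η * ef (Lc n x) (tau η) ∂(mm n) = ∫ η, (kk ξ η * g (tau η) + kk ξ η * h (tau η)) ∂(mm n) := by
          refine al ?_
          filter_upwards [c3, c4] with η f3 f4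
          rw [f3, ay, f4]; ring
        rw [po hn, ep d4 d3] at e1
        simp only [he]
        rw [d1, ay, d2]; linarith
      rw [this]
      refine (enorm_add_le _ _).trans (bw (by rw [enorm_neg]) ?_)
      refine (tp _).trans (kh ?_)
      congr 1; ext1 η
      rw [enorm_mul, qg (ft _ _)]
    refine (gb b1).trans ?_
    rw [mn (co _).enorm, pk hn (co g).enorm]
    refine (bw (dm _) (dm _)).trans ?_
    rw [← add_mul, ← mq (ai _) (ai _)]
    gcongr
    have := (S.T.le_opNorm g).trans (tn (ai _) S.nT)
    linarith
  have h0 : ∫⁻ ξ, ‖e ξ‖ₑ ∂(mm n) = 0 := by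
    by_contra hne
    have hd := Metric.denseRange_iff.1 S.dense h
    obtain ⟨c, hc0, hc⟩ : ∃ c : ℝ, 0 < c ∧ ENNReal.ofReal (2 * c) * Mn n < ∫⁻ ξ, ‖e ξ‖ₑ ∂(mm n) := by
      have ht : Tendsto (fun c : ℝ => ENNReal.ofReal (2 * c) * Mn n) (𝓝[>] 0) (𝓝 0) := by
        have t1 : Tendsto (fun c : ℝ => ENNReal.ofReal (2 * c)) (𝓝[>] 0) (𝓝 0) := by
          have : Tendsto (fun c : ℝ => ENNReal.ofReal (2 * c)) (𝓝 0) (𝓝 (ENNReal.ofReal (2 * 0))) :=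
            (ENNReal.continuous_ofReal.comp (br.mul continuous_id)).tendsto 0
          simp only [mul_zero, ENNReal.ofReal_zero] at this
          exact this.mono_left nhdsWithin_le_nhds
        have := ENNReal.Tendsto.mul_const t1 (Or.inr (io (n := n)))
        simpa using this
      obtain ⟨c, h1, h2⟩ := ((ht.eventually (gt_mem_nhds (pos_iff_ne_zero.2 hne))).and self_mem_nhdsWithin).exists
      exact ⟨c, h2, h1⟩
    obtain ⟨x, hx⟩ := hd c hc0
    rw [dist_comm, em] at hx
    refine absurd (key x) (not_le.2 (eg ?_ hc))
    gcongr
  rw [lintegral_eq_zero_iff hm.enorm] at h0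
  filter_upwards [h0] with ξ hξ
  simp only [gm, enorm_eq_zero, he] at hξ
  linarith
def qa (μ s : ℝ) (τ : ℂ) : ℂ := (μ^2 : ℝ) * τ - Complex.I * s
def rq (μ s : ℝ) (τ : ℂ) : ℝ := μ * ‖1 + τ‖ / ‖1 + qa μ s τ‖
lemma fp (μ s : ℝ) (p : Pt n) : qa μ s (tau p) = tau (scalePt n μ s p) := (jb μ s p).symm
lemma gz (μ s : ℝ) (p : Pt n) : rq μ s (tau p) = rho μ s p := by rw [rq, fp]; rfl
lemma fq (μ s : ℝ) {τ : ℂ} (h : 0 ≤ τ.re) : 0 ≤ (qa μ s τ).re := by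
  simp [qa, -Complex.ofReal_pow]; positivity
lemma dt (μ s : ℝ) : Measurable (qa μ s) := by unfold qa; fun_prop
lemma jg (μ s : ℝ) : Measurable (rq μ s) := by
  have := dt μ s; unfold rq; fun_prop
lemma hj {μ : ℝ} (hμ : 0 < μ) (s : ℝ) {τ : ℂ} (h : 0 ≤ τ.re) : 0 < rq μ s τ := by
  have h1 := one_le h; have h2 := one_le (fq μ s h)
  unfold rq; positivity
lemma dv {τ : ℂ} (h : 0 ≤ τ.re) : ‖τ‖ ≤ ‖1 + τ‖ := by
  rw [← sq_le_sq₀ (ai _) (ai _), dy, dy, au, au]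
  simp; nlinarith
lemma lj {μ : ℝ} (hμ : 0 < μ) (s : ℝ) : ∃ C, 0 < C ∧ ∀ τ : ℂ, 0 ≤ τ.re → rq μ s τ ≤ C := by
  refine ⟨μ * (1 + (μ^2)⁻¹ * (1 + |s|)), by positivity, fun τ h => ?_⟩
  have h2 := one_le (fq μ s h)
  have h3 := dv (fq μ s h)
  have e : (1 + τ) = 1 + ((μ^2)⁻¹ : ℝ) * (qa μ s τ + Complex.I * s) := by
    have : (μ:ℂ) ≠ 0 := by exact_mod_cast hμ.ne'
    unfold qa; push_cast; field_simp; ring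
  have h4 : ‖1 + τ‖ ≤ 1 + (μ^2)⁻¹ * (‖qa μ s τ‖ + |s|) := by
    rw [e]
    refine (bu _ _).trans ?_
    rw [norm_one, am, aj, ac (by positivity)]
    gcongr
    refine (bu _ _).trans ?_
    simp
  rw [rq, dx (by linarith), bc]
  refine aa (h4.trans ?_) hμ.le
  have h5 : |s| ≤ |s| * ‖1 + qa μ s τ‖ := bq (aq _) h2
  have h6 : 0 ≤ (μ^2)⁻¹ := by positivity
  nlinarith [aa h3 h6, aa h5 h6]
lemma lo (μ s : ℝ) : Measurable (fun p : Pt n => ENNReal.ofReal (rho μ s p ^ (2 * n + 2))) := ((lu μ s).pow_const _).ennreal_ofReal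
lemma lq {μ : ℝ} (hμ : 0 < μ) (s : ℝ) :
    ((mm n).withDensity (fun p => ENNReal.ofReal (rho μ s p ^ (2 * n + 2)))).map (scalePt n μ s) = mm n := by
  refine Measure.ext fun A hA => ?_
  rw [mp (bv μ s) hA, withDensity_apply _ (bv μ s hA), ← lintegral_indicator (bv μ s hA)]
  have := ry hμ s (measurable_one.indicator hA : Measurable (A.indicator (1 : Pt n → ℝ≥0∞)))
  rw [lintegral_indicator_one hA] at this
  rw [← this]
  congr 1; ext1 η
  by_cases h : scalePt n μ s η ∈ A
  · rw [Set.indicator_of_mem (show η ∈ _ from h), Set.indicator_of_mem h]; simp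
  · rw [Set.indicator_of_notMem (show η ∉ _ from h), Set.indicator_of_notMem h]; simp
lemma gr {μ : ℝ} (hμ : 0 < μ) (s : ℝ) {f : Pt n → ℝ} (hf : Measurable f) :
    ∫ η, rho μ s η ^ (2 * n + 2) * f (scalePt n μ s η) ∂(mm n) = ∫ η, f η ∂(mm n) := by
  conv_rhs => rw [← lq hμ s]
  rw [qu (bv μ s).aemeasurable hf.aestronglyMeasurable,
    mz (lo μ s) (ab fun p => bg)]
  congr 1; ext1 η
  rw [ch (pow_nonneg (jc hμ s η).le _), ak]
lemma kt {μ : ℝ} (hμ : 0 < μ) (s : ℝ) {f : Pt n → ℝ} (hf : Integrable f (mm n)) :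
    Integrable (fun η => rho μ s η ^ (2 * n + 2) * f (scalePt n μ s η)) (mm n) := by
  rw [← lq hμ s] at hf
  have h1 := hf.comp_measurable (bv μ s)
  rw [py (lo μ s) (ab fun p => bg)] at h1
  refine h1.congr (ab fun η => ?_)
  simp only [Function.comp]
  rw [ch (pow_nonneg (jc hμ s η).le _), ak]
lemma nq {μ : ℝ} (hμ : 0 < μ) (s : ℝ) : Measure.QuasiMeasurePreserving (scalePt n μ s) (mm n) (mm n) := by
  refine ⟨bv μ s, ?_⟩
  have h : mm n ≪ (mm n).withDensity (fun p => ENNReal.ofReal (rho μ s p ^ (2 * n + 2))) :=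
    withDensity_absolutelyContinuous' (lo μ s).aemeasurable (ab fun p => by
      have := jc hμ s p; simp; positivity)
  have := h.map (bv (n := n) μ s)
  rwa [lq hμ s] at this
lemma fo {μ : ℝ} (hμ : 0 < μ) (s : ℝ) : Measure.QuasiMeasurePreserving (qa μ s) (nu n) (nu n) := by
  refine ⟨dt μ s, Measure.AbsolutelyContinuous.mk fun A hA h => ?_⟩
  rw [nu, mp mtau hA] at h
  rw [mp (dt μ s) hA, nu, mp mtau (dt μ s hA)]
  have := (nq hμ s).preimage_null h
  convert this using 2
  ext p; simp only [Set.mem_preimage, fp]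
lemma er {μ : ℝ} (hμ : 0 < μ) (s : ℝ) {f : ℂ → ℝ} (hf : Measurable f) :
    ∫ τ, rq μ s τ ^ (2 * n + 2) * f (qa μ s τ) ∂(nu n) = ∫ τ, f τ ∂(nu n) := by
  have hm : Measurable (fun τ => rq μ s τ ^ (2 * n + 2) * f (qa μ s τ)) := ((jg μ s).pow_const _).mul (hf.comp (dt μ s))
  rw [jj hf.aestronglyMeasurable, jj hm.aestronglyMeasurable, ← gr hμ s (f := fun p => f (tau p)) (hf.comp mtau)]
  simp only [gz, fp]
lemma od {f : ℂ → ℝ} (hf : Measurable f) : Integrable f (nu n) ↔ Integrable (fun p => f (tau p)) (mm n) :=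
  integrable_map_measure hf.aestronglyMeasurable mtau.aemeasurable
def trf (n : ℕ) (μ s : ℝ) (h : HH n) (τ : ℂ) : ℝ := h (qa μ s τ) * rq μ s τ ^ (n + 2)
lemma ls (μ s : ℝ) (h : HH n) : Measurable (trf n μ s h) :=
  ((cc h).comp (dt μ s)).mul ((jg μ s).pow_const _)
lemma nn {μ : ℝ} (hμ : 0 < μ) (s : ℝ) (h : HH n) : MemLp (trf n μ s h) 2 (nu n) := by
  rw [bj (ls μ s h).aestronglyMeasurable]
  have h1 := (bj (gg h)).1 (jw h)
  rw [od ((cc h).pow_const 2)] at h1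
  have h2 := kt hμ s h1
  obtain ⟨C, hC0, hC⟩ := lj hμ s
  have h3 := h2.mul_bdd (g := fun p => rho μ s p ^ 2) (c := C ^ 2) ((lu μ s).pow_const 2).aestronglyMeasurable
    (ab fun p => by
      have h5 := jc hμ s p
      rw [norm_pow, ac h5.le]
      have := hC _ (fn p); rw [gz] at this
      gcongr)
  rw [od ((ls μ s h).pow_const 2)]
  refine h3.congr (ab fun p => ?_)
  simp only [trf, fp, gz]; ring
def tr {μ : ℝ} (hμ : 0 < μ) (s : ℝ) (h : HH n) : HH n := (nn hμ s h).toLp _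
lemma dg {μ : ℝ} (hμ : 0 < μ) (s : ℝ) (h : HH n) : tr hμ s h =ᵐ[nu n] trf n μ s h := (nn hμ s h).coeFn_toLp
theorem jv (S : SP n) (hn : 1 ≤ n) {μ : ℝ} (hμ : 0 < μ) (s : ℝ) (h : HH n) :
    ∀ᵐ τ ∂(nu n), S.T (tr hμ s h) τ = S.T h (qa μ s τ) * rq μ s τ ^ n := by
  have hm : Measurable (fun τ => S.T h (qa μ s τ) * rq μ s τ ^ n) := ((cc _).comp (dt μ s)).mul ((jg μ s).pow_const _)
  rw [lm (measurableSet_eq_fun (cc _) hm)]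
  have h1 := (nq hμ s).ae (Tker S hn h)
  have h2 := cn (dg hμ s h)
  filter_upwards [Tker S hn (tr hμ s h), h1] with ξ e1 e2
  rw [e1, fp, gz, e2]
  rw [← gr hμ s (f := fun η => kk (scalePt n μ s ξ) η * h (tau η)) ((ie _).mul (co h)), ← integral_mul_const]
  refine al ?_
  filter_upwards [h2] with η e3
  simp only [e3, trf, fp, gz]
  rw [se hμ s ξ η]; ring
end HW
namespace HW
open scoped ComplexConjugate RealInnerProductSpace ENNReal
variable {n : ℕ}
structure NL (n : ℕ) (θ : ℝ) where
  δ : ℝ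
  hδ : 0 < δ
  hδ2 : δ ≤ 1/2
  F : ℝ → ℝ
  G : ℝ → ℝ
  F_cont : Continuous F
  G_cont : Continuous G
  F_eq : ∀ x, |x - 1| ≤ δ → F x = x ^ pn n
  F_lip : ∀ x y, |F x - F y - pn n * (x - y)| ≤ θ * |x - y|
  G_eq : ∀ x, |x - 1| ≤ δ → G x = x ^ (pn n + 1) / (pn n + 1)
  G_tay : ∀ x y, |G y - G x - F x * (y - x)| ≤ (pn n + θ) * (y - x)^2
lemma dh (hn : 1 ≤ n) : 1 < pn n := by
  have hn1 : (1:ℝ) ≤ n := by exact_mod_cast hn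
  rw [pn, lt_div_iff₀ (by linarith)]; linarith
theorem exNL (hn : 1 ≤ n) {θ : ℝ} (hθ : 0 < θ) : Nonempty (NL n θ) := by
  have hp := dh hn
  set p := pn n with hpdef
  have hd : HasStrictDerivAt (fun x : ℝ => x ^ p) (p * 1 ^ (p - 1)) 1 := Real.hasStrictDerivAt_rpow_const (Or.inl one_ne_zero)
  rw [Real.one_rpow, ia] at hd
  have h1 := hd.isLittleO.def hθ
  rw [nhds_prod_eq, ← nhds_prod_eq, Metric.eventually_nhds_iff] at h1
  obtain ⟨ε, hε, h1⟩ := h1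
  obtain ⟨δ, hδ, hδ2, hδε⟩ : ∃ δ : ℝ, 0 < δ ∧ δ ≤ 1/2 ∧ δ < ε := ⟨min (1/2) (ε/2), by positivity, kg _ _, (kf _ _).trans_lt (by linarith)⟩
  set cl : ℝ → ℝ := fun x => max (1 - δ) (min x (1 + δ)) with hcl
  have cl_mem : ∀ x, |cl x - 1| ≤ δ := fun x => by
    rw [eh]; constructor
    · have := le_max_left (1 - δ) (min x (1 + δ)); simp only [hcl]; linarith
    · have : cl x ≤ 1 + δ := max_le (by linarith) (kf _ _)
      linarith
  have cl_lip : ∀ x y, |cl x - cl y| ≤ |x - y| := fun x y => by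
    simp only [hcl]; rw [max_comm, max_comm (1 - δ)]
    refine (abs_max_sub_max_le_abs _ _ _).trans ((abs_min_sub_min_le_max _ _ _ _).trans ?_)
    simp
  have cl_eq : ∀ x, |x - 1| ≤ δ → cl x = x := fun x hx => by
    rw [eh] at hx
    simp only [hcl]; rw [min_eq_left (by linarith), max_eq_right (by linarith)]
  have cl_cont : Continuous cl := by fun_prop
  set F : ℝ → ℝ := fun x => p * x + ((cl x)^p - p * cl x) with hF
  have F_cont : Continuous F := by
    refine (br.mul continuous_id).add ((cl_cont.rpow_const fun x => Or.inr (by linarith)).sub (br.mul cl_cont))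
  have F_eq : ∀ x, |x - 1| ≤ δ → F x = x ^ p := fun x hx => by simp only [hF, cl_eq x hx]; ring
  have F_lip : ∀ x y, |F x - F y - p * (x - y)| ≤ θ * |x - y| := fun x y => by
    have h2 := h1 (y := (cl x, cl y)) (by
      rw [Prod.dist_eq, Real.dist_eq, Real.dist_eq]
      exact max_lt ((cl_mem x).trans_lt hδε) ((cl_mem y).trans_lt hδε))
    simp only [af] at h2
    have e : F x - F y - p * (x - y) = (cl x)^p - (cl y)^p - (ContinuousLinearMap.toSpanSingleton ℝ p) (cl x - cl y) := by
      simp [hF]; ring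
    rw [e]
    exact h2.trans (aa (cl_lip x y) hθ.le)
  have F_l2 : ∀ x y, |F x - F y| ≤ (p + θ) * |x - y| := fun x y => by
    have h3 : F x - F y = (F x - F y - p * (x - y)) + p * (x - y) := by ring
    rw [h3]
    refine (ba _ _).trans ?_
    rw [bh, bm (by linarith : 0 < p)]
    linarith [F_lip x y]
  have Fi : ∀ a b, IntervalIntegrable F volume a b := fun a b => F_cont.intervalIntegrable a b
  set G : ℝ → ℝ := fun x => 1 / (p + 1) + ∫ t in (1:ℝ)..x, F t with hG
  refine ⟨⟨δ, hδ, hδ2, F, G, F_cont, ?_, F_eq, F_lip, fun x hx => ?_, fun x y => ?_⟩⟩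
  · exact br.add (intervalIntegral.continuous_primitive Fi 1)
  · have h3 : ∫ t in (1:ℝ)..x, F t = ∫ t in (1:ℝ)..x, t ^ p := by
      refine intervalIntegral.integral_congr fun t ht => F_eq t ?_
      exact (qb ht).trans hx
    simp only [hG]
    rw [h3, integral_rpow (Or.inl (by linarith)), Real.one_rpow]; ring
  · have h3 : G y - G x - F x * (y - x) = ∫ t in x..y, (F t - F x) := by
      rw [intervalIntegral.integral_sub (Fi _ _) (by simp), intervalIntegral.integral_const]
      simp only [hG, ak]
      have := intervalIntegral.integral_add_adjacent_intervals (Fi 1 x) (Fi x y)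
      linarith
    rw [h3]
    have h4 := intervalIntegral.norm_integral_le_of_norm_le_const (f := fun t => F t - F x) (a := x) (b := y) (C := (p + θ) * |y - x|) fun t ht => by
      refine (F_l2 t x).trans (aa ?_ (by linarith))
      exact qb (Set.uIoc_subset_uIcc ht)
    rw [af] at h4
    refine h4.trans (kh ?_)
    rw [bc, abs_mul_abs_self]; ring
lemma NL.F_l2 (hn : 1 ≤ n) {θ : ℝ} (L : NL n θ) (x y : ℝ) : |L.F x - L.F y| ≤ (pn n + θ) * |x - y| := by
  have h3 : L.F x - L.F y = (L.F x - L.F y - pn n * (x - y)) + pn n * (x - y) := by ring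
  rw [h3]
  refine (ba _ _).trans ?_
  rw [bh, bm (by linarith [dh hn] : 0 < pn n)]
  linarith [L.F_lip x y]
lemma NL.F1 {θ : ℝ} (L : NL n θ) : L.F 1 = 1 := by
  rw [L.F_eq 1 (by simpa using L.hδ.le), Real.one_rpow]
def one (n : ℕ) : HH n := EE n (ev 0)
lemma fs : ∀ᵐ τ ∂(nu n), one n τ = 1 := by
  filter_upwards [dj (n := n) (ev 0)] with τ h; rw [one, h, mb]; rfl
structure Adm (η : ℝ) (K : ℂ → ℝ) : Prop where
  meas : Measurable K
  bd : ∀ τ, |K τ - 1| ≤ η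
lemma Adm.le {η : ℝ} {K : ℂ → ℝ} (h : Adm η K) (τ : ℂ) : |K τ| ≤ 1 + η := by
  have h1 := h.bd τ
  calc |K τ| = |1 + (K τ - 1)| := by ring_nf
    _ ≤ |1| + |K τ - 1| := ba _ _
    _ ≤ 1 + η := by rw [abs_one]; linarith
lemma nle {f g : HH n} {c : ℝ} (h : ∀ᵐ τ ∂(nu n), |f τ| ≤ c * |g τ|) : ‖f‖ ≤ c * ‖g‖ :=
  Lp.norm_le_mul_norm_of_ae_le_mul h
lemma qt {f : HH n} {c : ℝ} (h : ∀ᵐ τ ∂(nu n), |f τ| ≤ c) : ‖f‖ ≤ c * ‖one n‖ := nle (by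
  filter_upwards [h, fs (n := n)] with τ h1 h2; rw [h2, abs_one, ia]; exact h1)
variable {θ : ℝ} (S : SP n) (L : NL n θ)
lemma SP.T_le (h : HH n) : ‖S.T h‖ ≤ ‖h‖ := (S.T.le_opNorm h).trans (tn (ai _) S.nT)
def Nf (K : ℂ → ℝ) (h : HH n) (τ : ℂ) : ℝ := K τ * L.F (S.T h τ)
open Classical in
def Nl (K : ℂ → ℝ) (h : HH n) : HH n := if hm : MemLp (Nf S L K h) 2 (nu n) then hm.toLp _ else 0
lemma cp (hn : 1 ≤ n) {η : ℝ} {K : ℂ → ℝ} (hK : Adm η K) (h : HH n) : ∀ᵐ τ ∂(nu n), Nl S L K h τ = K τ * L.F (S.T h τ) := by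
  have hm : MemLp (Nf S L K h) 2 (nu n) := by
    have h1 : MemLp (fun τ => L.F (S.T h τ)) 2 (nu n) := by
      have h2 : MemLp (fun τ => |L.F 0| + (pn n + θ) * |S.T h τ|) 2 (nu n) :=
        (memLp_const (|L.F 0|)).add (((jw (S.T h)).norm).const_mul (pn n + θ))
      refine h2.mono' (L.F_cont.comp_stronglyMeasurable (kl _)).aestronglyMeasurable (ab fun τ => ?_)
      have := L.F_l2 hn (S.T h τ) 0
      rw [tk] at this
      have h3 := tq (L.F (S.T h τ)) (L.F 0)
      rw [af]; linarith
    have h4 : MemLp (fun τ => (1 + η) * L.F (S.T h τ)) 2 (nu n) := h1.const_mul _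
    refine h4.mono (hK.meas.mul ((L.F_cont.measurable).comp (cc _))).aestronglyMeasurable (ab fun τ => ?_)
    rw [Nf, am, am, af, af (1 + η)]
    exact ag ((hK.le τ).trans (qk _)) (ai _)
  rw [Nl, dif_pos hm]
  exact hm.coeFn_toLp
lemma gs (h h' : HH n) : ∀ᵐ τ ∂(nu n), S.T (h - h') τ = S.T h τ - S.T h' τ := by
  rw [map_sub]; exact bb _ _
lemma pe : ∀ᵐ τ ∂(nu n), S.T (one n) τ = 1 := by rw [one, S.T1]; exact fs
lemma ph (hn : 1 ≤ n) {η : ℝ} {K : ℂ → ℝ} (hK : Adm η K) (hη : 0 ≤ η) (hθ : 0 ≤ θ) (h h' : HH n) :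
    ‖(Nl S L K h - pn n • S.T h) - (Nl S L K h' - pn n • S.T h')‖ ≤ (θ + η * (pn n + θ)) * ‖h - h'‖ := by
  have hp := dh hn
  refine (nle (g := S.T (h - h')) (c := θ + η * (pn n + θ)) ?_).trans (aa (S.T_le _) (by positivity))
  filter_upwards [cp S L hn hK h, cp S L hn hK h', gs S h h', bb (Nl S L K h - pn n • S.T h) (Nl S L K h' - pn n • S.T h'),
    bb (Nl S L K h) (pn n • S.T h), bb (Nl S L K h') (pn n • S.T h'), Lp.coeFn_smul (pn n) (S.T h), Lp.coeFn_smul (pn n) (S.T h')]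
    with τ e1 e2 e3 e4 e5 e6 e7 e8
  rw [e3, e4, ay, e5, e6, ay, ay, e7, e8, e1, e2, cq, cq, ak, ak]
  set x := S.T h τ; set y := S.T h' τ
  have e : K τ * L.F x - pn n * x - (K τ * L.F y - pn n * y) = (L.F x - L.F y - pn n * (x - y)) + (K τ - 1) * (L.F x - L.F y) := by ring
  rw [e, add_mul]
  refine (ba _ _).trans (bw (L.F_lip x y) ?_)
  rw [bh, bc]
  exact ax (hK.bd τ) (L.F_l2 hn x y) (aq _) hη
lemma nh (hn : 1 ≤ n) {η : ℝ} {K : ℂ → ℝ} (hK : Adm η K) (hη : 0 ≤ η) (hθ : 0 ≤ θ) (h h' : HH n) :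
    ‖Nl S L K h - Nl S L K h'‖ ≤ (1 + η) * (pn n + θ) * ‖h - h'‖ := by
  have hp := dh hn
  have h1 := ph S L hn hK hη hθ h h'
  have e : Nl S L K h - Nl S L K h' = ((Nl S L K h - pn n • S.T h) - (Nl S L K h' - pn n • S.T h')) + pn n • S.T (h - h') := by
    rw [map_sub, smul_sub]; abel
  rw [e]
  refine (bu _ _).trans ?_
  rw [norm_smul, ac (by linarith)]
  have := aa (S.T_le (h - h')) (by linarith : 0 ≤ pn n)
  linarith
lemma pg (hn : 1 ≤ n) {η : ℝ} {K : ℂ → ℝ} (hK : Adm η K) : ‖Nl S L K (one n) - one n‖ ≤ η * ‖one n‖ := by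
  refine qt ?_
  filter_upwards [cp S L hn hK (one n), pe S, fs (n := n), bb (Nl S L K (one n)) (one n)] with τ e1 e2 e3 e4
  rw [e4, ay, e1, e2, e3, L.F1, ia]; exact hK.bd τ
def Ps (K : ℂ → ℝ) (h : HH n) : HH n := S.R (Nl S L K h - pn n • S.T h)
open Classical in
def hk (K : ℂ → ℝ) : HH n := if hx : ∃ h, Ps S L K h = h then hx.choose else 0
structure Sm (η : ℝ) : Prop where
  hn : 1 ≤ n
  hη : 0 < η
  hη1 : η ≤ 1
  hθ : 0 ≤ θ
  c : ‖S.R‖ * (θ + η * (pn n + θ)) ≤ 1/2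
variable {S L} {η : ℝ} (H : Sm (θ := θ) S η)
include H
lemma mf {K : ℂ → ℝ} (hK : Adm η K) (h h' : HH n) : ‖Ps S L K h - Ps S L K h'‖ ≤ 1/2 * ‖h - h'‖ := by
  rw [Ps, Ps, ← map_sub]
  refine (S.R.le_opNorm _).trans ?_
  refine (aa (ph S L H.hn hK H.hη.le H.hθ h h') (ai _)).trans ?_
  rw [← bc]; exact ag H.c (ai _)
lemma jk {K : ℂ → ℝ} (hK : Adm η K) : Ps S L K (hk S L K) = hk S L K := by
  have hc : ContractingWith (1/2) (Ps S L K) := by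
    refine ⟨by norm_num, LipschitzWith.of_dist_le_mul fun h h' => ?_⟩
    rw [em, em]
    simpa using mf H hK h h'
  have hx : ∃ h, Ps S L K h = h := ⟨_, hc.fixedPoint_isFixedPt⟩
  rw [hk, dif_pos hx]; exact hx.choose_spec
lemma ma {K : ℂ → ℝ} (hK : Adm η K) (v : HH n) : ‖v - hk S L K‖ ≤ 2 * ‖v - Ps S L K v‖ := by
  have h1 := mf (L := L) H hK v (hk S L K)
  rw [jk H hK] at h1
  have h2 : v - hk S L K = (v - Ps S L K v) + (Ps S L K v - hk S L K) := by abel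
  have h3 : ‖v - hk S L K‖ ≤ ‖v - Ps S L K v‖ + ‖Ps S L K v - hk S L K‖ := by
    conv_lhs => rw [h2]
    exact bu _ _
  linarith
lemma og {K : ℂ → ℝ} (hK : Adm η K) (a b : ℝ) : ⟪hk S L K, EE n (nv a b)⟫ = 0 := by
  rw [← jk H hK]; exact S.R2 _ _ (S.TN a b)
lemma si {K : ℂ → ℝ} (hK : Adm η K) : ∃ a b, Nl S L K (hk S L K) = hk S L K + EE n (nv a b) := by
  have h := S.R1 (Nl S L K (hk S L K) - pn n • S.T (hk S L K))
  have e : S.R (Nl S L K (hk S L K) - pn n • S.T (hk S L K)) = hk S L K := jk H hK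
  rw [e] at h
  obtain ⟨a, b, hab⟩ := S.N _ h
  refine ⟨-a, -b, ?_⟩
  have h2 : EE n (nv (-a) (-b)) = - EE n (nv a b) := by
    rw [← map_neg]; congr 1; simp only [nv, neg_smul]; abel
  rw [h2, ← hab]; abel
omit H in
lemma ns (S : SP n) (hn : 1 ≤ n) (a b : ℝ) : ⟪one n, EE n (nv a b)⟫ = 0 := by
  have hp := dh hn
  have h1 := S.sym (one n) (EE n (nv a b))
  have h2 : S.T (one n) = one n := S.T1
  have h3 : ⟪one n, EE n (nv a b)⟫ = pn n * ⟪one n, EE n (nv a b)⟫ := by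
    conv_lhs => rw [← S.TN, ds, ← h1, h2]
  have : (pn n - 1) * ⟪one n, EE n (nv a b)⟫ = 0 := by linarith
  exact (qj.1 this).resolve_left (by linarith)
lemma oh {K : ℂ → ℝ} (hK : Adm η K) : ‖hk S L K - one n‖ ≤ 2 * ‖S.R‖ * ‖one n‖ * η := by
  have h1 := ma (L := L) H hK (one n)
  have h2 : S.R (one n - pn n • S.T (one n)) = one n := S.R3 _ fun y hy => by
    obtain ⟨a, b, rfl⟩ := S.N y hy
    exact ns S H.hn a b
  have h3 : one n - Ps S L K (one n) = S.R (one n - Nl S L K (one n)) := by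
    have : one n - Ps S L K (one n) = S.R (one n - pn n • S.T (one n)) - S.R (Nl S L K (one n) - pn n • S.T (one n)) := by
      rw [h2]; rfl
    rw [this, ← map_sub]; congr 1; abel
  rw [h3, qh] at h1
  have h4 := (S.R.le_opNorm (one n - Nl S L K (one n)))
  rw [qh (one n)] at h4
  have h5 := aa (pg S L H.hn hK) (ai S.R)
  linarith
end HW
namespace HW
open scoped ComplexConjugate RealInnerProductSpace ENNReal
variable {n : ℕ}
lemma rk (S : SP n) (hn : 1 ≤ n) {Λ : ℝ} (hΛ : 0 < Λ) : ∃ C, 0 < C ∧ ∀ (d : HH n) (c : ℝ), 0 ≤ c →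
    (∀ᵐ τ ∂(nu n), |d τ| ≤ c + Λ * |S.T d τ|) → ∀ᵐ τ ∂(nu n), |S.T d τ| ≤ C * (c + ‖d‖) := by
  set κ : ℝ := (2 * Λ * 2 ^ (n + 2))⁻¹ with hκd
  have hκ : 0 < κ := by positivity
  set m : ℝ := (C0 n * κ ^ n)⁻¹ with hm
  have hm0 : 0 < m := by have := cu (n := n); positivity
  set M : ℝ := (Mn n).toReal
  have hM : 0 ≤ M := ENNReal.toReal_nonneg
  refine ⟨2 * (1 + Λ * m * M), by positivity, fun d c hc h => ?_⟩
  have ms : MeasurableSet {τ | |S.T d τ| ≤ 2 * (1 + Λ * m * M) * (c + ‖d‖)} :=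
    measurableSet_le (continuous_abs.measurable.comp (cc _)) dd
  rw [lm ms]
  set W : Pt n → ℝ≥0∞ := fun ξ => ‖S.T d (tau ξ)‖ₑ with hWd
  have mW : Measurable W := (co _).enorm
  set C : ℝ := c + Λ * m * (‖d‖ * M) with hCd
  have hC0 : 0 ≤ C := by positivity
  have hWi : ∫⁻ ξ, W ξ ∂(mm n) ≤ ENNReal.ofReal (‖d‖ * M) := by
    refine (dm (S.T d)).trans ?_
    rw [ar (ai _), ENNReal.ofReal_toReal io]
    gcongr; exact S.T_le d
  have key := rj hn hκ mW (a := ENNReal.ofReal Λ) (C := ENNReal.ofReal C) (by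
      rw [← ar hΛ.le, show Λ * (2 ^ (n + 2) * κ) = 1/2 by rw [hκd]; field_simp]
      rw [ENNReal.ofReal_div_of_pos (by norm_num)]; simp) my (hWi.trans_lt bg).ne (by
    have h' := cn h
    filter_upwards [Tker S hn d] with ξ hξ
    have mk := (ie ξ).ennreal_ofReal
    have mkn := (ic κ ξ).ennreal_ofReal
    calc W ξ ≤ ∫⁻ η, ‖kk ξ η * d (tau η)‖ₑ ∂(mm n) := by
          simp only [hWd]; rw [hξ]; exact tp _
      _ ≤ ∫⁻ η, (ENNReal.ofReal c * ENNReal.ofReal (kk ξ η) + ENNReal.ofReal Λ * (ENNReal.ofReal (kn κ ξ η) * W η + ENNReal.ofReal m * W η)) ∂(mm n) := by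
          refine gb ?_
          filter_upwards [h'] with η hη
          have hk0 := ft ξ η
          have hkn := sd κ ξ η
          rw [enorm_mul, qg hk0]
          simp only [hWd]
          rw [← qc, ← qc, af, af, ← ar hk0, ← ar hc, ← ar hkn,
            ← ar hm0.le, ← mq (by positivity) (by positivity), ← ar hΛ.le, ← mq (by positivity) (by positivity)]
          refine de ?_
          have h1 := aa hη hk0
          have h2 := ag (ks hκ ξ η) (by positivity : 0 ≤ Λ * |S.T d (tau η)|)
          rw [← hm] at h2
          linarith
      _ ≤ ENNReal.ofReal C + ENNReal.ofReal Λ * ∫⁻ η, ENNReal.ofReal (kn κ ξ η) * W η ∂(mm n) := by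
          have m1 : Measurable (fun η => ENNReal.ofReal (kn κ ξ η) * W η) := mkn.mul mW
          have m2 : Measurable (fun η => ENNReal.ofReal (kn κ ξ η) * W η + ENNReal.ofReal m * W η) := m1.add (mW.const_mul _)
          rw [mn (mk.const_mul _), db _ mk, pp hn, ia, db _ m2,
            mn m1, db _ mW, je, hCd, mq hc (by positivity),
            bc Λ, ar hΛ.le, ar hm0.le, add_assoc, add_comm (ENNReal.ofReal Λ * _)]
          gcongr)
  have hE : 2 * ENNReal.ofReal C = ENNReal.ofReal (2 * C) := by rw [ar (by norm_num)]; simp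
  filter_upwards [key] with ξ hξ
  simp only [hWd] at hξ
  rw [← qc, af, hE, ENNReal.ofReal_le_ofReal_iff (by positivity)] at hξ
  refine hξ.trans ?_
  have : 0 ≤ Λ * m * M * c := by positivity
  rw [hCd]; nlinarith [ai d]
def wz (τ : ℂ) : ℂ := 2 * B1 τ - 1
lemma iz (a b : ℝ) (τ : ℂ) : wf a b τ = a * (wz τ).re + b * (wz τ).im := by simp [wf, wz]
lemma fr {τ : ℂ} (h : 0 ≤ τ.re) : 1 + τ ≠ 0 := dq.1 (by linarith [one_le h])
lemma nk {τ : ℂ} (h : 0 ≤ τ.re) : ‖wz τ‖ ≤ 1 := by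
  have hne := fr h
  have e : wz τ = (1 - τ) / (1 + τ) := by rw [wz, B1]; field_simp; ring
  rw [e, norm_div, div_le_one (dq.2 hne)]
  refine qx ?_ (ai _) |>.2
  rw [dy, dy, au, au]
  simp; nlinarith
lemma ja (a b : ℝ) {τ : ℂ} (h : 0 ≤ τ.re) : |wf a b τ| ≤ |a| + |b| := by
  rw [iz]
  refine (ba _ _).trans ?_
  rw [bh, bh]
  have h1 := (cb (wz τ)).trans (nk h)
  have h2 := (ir (wz τ)).trans (nk h)
  exact bw (cv (aq _) h1) (cv (aq _) h2)
lemma fa (a b : ℝ) : ∀ᵐ τ ∂(nu n), EE n (nv a b) τ = wf a b τ := by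
  filter_upwards [dj (n := n) (nv a b)] with τ h; rw [h, fe]
lemma nz (a b : ℝ) : Measurable (wf a b) := by
  have := cj; unfold wf; fun_prop
lemma ll : ∃ c, 0 < c ∧ ∀ a b : ℝ, |a| ≤ c * ‖EE n (nv a b)‖ ∧ |b| ≤ c * ‖EE n (nv a b)‖ := by
  let f : ℝ × ℝ →ₗ[ℝ] HH n :=
    { toFun := fun q => EE n (nv q.1 q.2)
      map_add' := fun x y => by rw [← map_add]; congr 1; simp only [nv, Prod.fst_add, Prod.snd_add, add_smul]; abel
      map_smul' := fun r x => by
        rw [RingHom.id_apply, ← map_smul]; congr 1; simp only [nv, Prod.smul_fst, Prod.smul_snd, smul_add, smul_assoc] }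
  have hker : LinearMap.ker f = ⊥ := by
    rw [LinearMap.ker_eq_bot']
    rintro ⟨a, b⟩ h
    have h0 : EE n (nv a b) = 0 := h
    have h1 : ∀ᵐ τ ∂(nu n), wf a b τ = 0 := by
      filter_upwards [fa (n := n) a b, Lp.coeFn_zero ℝ 2 (nu n)] with τ e1 e2
      rw [← e1, h0, e2]; rfl
    have h2 : (fun p : Pt n => wf a b (tau p)) =ᵐ[volume] fun _ => 0 := ow.ae_le (cn h1)
    have hc : Continuous (fun p : Pt n => wf a b (tau p)) := by
      have : Continuous (fun p : Pt n => B1 (tau p)) := by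
        unfold B1; exact (by fun_prop : Continuous fun p : Pt n => 1 + tau p).inv₀ fun p => fr (fn p)
      have h1 := Complex.continuous_re.comp this
      have h2 := Complex.continuous_im.comp this
      exact (br.mul ((br.mul h1).sub br)).add (br.mul (br.mul h2))
    have h3 := (Continuous.ae_eq_iff_eq (volume : Measure (Pt n)) hc br).1 h2
    have t0 : tau ((0, 0, 0) : Pt n) = 0 := by apply bz <;> simp [tau, zsq]
    have t1 : tau ((0, 0, -1) : Pt n) = Complex.I := by apply bz <;> simp [tau, zsq]
    have e0 := congrFun h3 (0, 0, 0)
    have e1 := congrFun h3 (0, 0, -1)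
    simp only [t0, t1, wf, B1] at e0 e1
    simp [Complex.inv_re, Complex.inv_im, au] at e0 e1
    have ea : a = 0 := e0.resolve_right (by norm_num)
    rw [ea] at e1
    have eb : b = 0 := by linarith
    rw [ea, eb]; rfl
  obtain ⟨K, hK, hf⟩ := f.exists_antilipschitzWith hker
  refine ⟨K, by exact_mod_cast hK, fun a b => ?_⟩
  have h1 := hf.le_mul_norm (map_zero f) (a, b)
  exact ⟨(norm_fst_le (a, b)).trans h1, (norm_snd_le (a, b)).trans h1⟩
theorem sh (S : SP n) {θ : ℝ} (hθ : 0 ≤ θ) (hn : 1 ≤ n) : ∃ C, 0 < C ∧ ∀ (L : NL n θ) (η : ℝ), Sm (θ := θ) S η → ∀ K, Adm η K →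
    ∃ a b, Nl S L K (hk S L K) = hk S L K + EE n (nv a b) ∧ |a| ≤ C * η ∧ |b| ≤ C * η ∧
      (∀ᵐ τ ∂(nu n), |S.T (hk S L K) τ - 1| ≤ C * η) ∧ ∀ᵐ τ ∂(nu n), |hk S L K τ - 1| ≤ C * η := by
  have hp := dh hn
  obtain ⟨c, hc, hnv⟩ := ll (n := n)
  have hΛ : 0 < 2 * (pn n + θ) := by linarith
  obtain ⟨C1, hC1, hs⟩ := rk S hn hΛ
  set A := 2 * ‖S.R‖ * ‖one n‖ with hA
  have hA0 : 0 ≤ A := by positivity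
  set B := c * (2 * (pn n + θ) * A + ‖one n‖ + A) with hB
  have hB0 : 0 ≤ B := by have := ai (one n); positivity
  set C2 := C1 * (1 + 2 * B + A) with hC2
  have hC20 : 0 ≤ C2 := by positivity
  refine ⟨1 + 2 * B + 2 * (pn n + θ) * C2 + C2, by positivity, fun L η H K hK => ?_⟩
  obtain ⟨a, b, hab⟩ := si (L := L) H hK
  have h1 := oh (L := L) H hK
  rw [← hA] at h1
  have hη := H.hη
  have h2 : ‖EE n (nv a b)‖ ≤ (2 * (pn n + θ) * A + ‖one n‖ + A) * η := by
    have e : EE n (nv a b) = (Nl S L K (hk S L K) - Nl S L K (one n)) + (Nl S L K (one n) - one n) + (one n - hk S L K) := by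
      rw [hab]; abel
    rw [e]
    refine (norm_add₃_le).trans ?_
    have e1 := nh S L hn hK hη.le hθ (hk S L K) (one n)
    have e2 := pg S L hn hK
    rw [qh (one n)]
    have e3 : (1 + η) * (pn n + θ) * ‖hk S L K - one n‖ ≤ 2 * (pn n + θ) * (A * η) := by
      have := H.hη1
      gcongr; linarith
    linarith
  have ha : |a| ≤ B * η := by
    refine (hnv a b).1.trans ?_
    rw [hB, bc]; gcongr
  have hb : |b| ≤ B * η := by
    refine (hnv a b).2.trans ?_
    rw [hB, bc]; gcongr
  have h3 : ∀ᵐ τ ∂(nu n), |hk S L K τ - 1| ≤ (1 + 2 * B) * η + 2 * (pn n + θ) * |S.T (hk S L K) τ - 1| := by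
    have e1 := cp S L hn hK (hk S L K)
    rw [hab] at e1
    filter_upwards [e1, qq (hk S L K) (EE n (nv a b)), fa (n := n) a b, di (n := n)] with τ e1 e2 e3 e4
    rw [e2, en, e3] at e1
    have e5 : hk S L K τ - 1 = K τ * (L.F (S.T (hk S L K) τ) - L.F 1) + (K τ - 1) - wf a b τ := by rw [L.F1]; linarith
    have e6 := ja a b e4
    have e7 := hK.bd τ
    have e8 : |K τ * (L.F (S.T (hk S L K) τ) - L.F 1)| ≤ 2 * ((pn n + θ) * |S.T (hk S L K) τ - 1|) := by
      rw [bh]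
      exact ax ((hK.le τ).trans (by linarith [H.hη1])) (L.F_l2 hn _ _) (aq _) (by norm_num)
    rw [e5]
    refine (abs_sub _ _).trans ?_
    have := ba (K τ * (L.F (S.T (hk S L K) τ) - L.F 1)) (K τ - 1)
    linarith
  have hT : ∀ᵐ τ ∂(nu n), S.T (hk S L K - one n) τ = S.T (hk S L K) τ - 1 := by
    filter_upwards [gs S (hk S L K) (one n), pe S] with τ e1 e2
    rw [e1, e2]
  have h4 : ∀ᵐ τ ∂(nu n), |S.T (hk S L K) τ - 1| ≤ C2 * η := by
    have := hs (hk S L K - one n) ((1 + 2 * B) * η) (by positivity) (by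
      filter_upwards [h3, hT, bb (hk S L K) (one n), fs (n := n)] with τ e1 e2 e3 e4
      rw [e3, ay, e4, e2]; exact e1)
    filter_upwards [this, hT] with τ e1 e2
    rw [e2] at e1
    refine e1.trans ?_
    rw [hC2, bc]
    gcongr
    linarith
  have k1 : 0 ≤ 2 * (pn n + θ) * C2 := by positivity
  refine ⟨a, b, hab, ha.trans ?_, hb.trans ?_, ?_, ?_⟩
  · gcongr; linarith
  · gcongr; linarith
  · filter_upwards [h4] with τ e
    refine e.trans ?_
    gcongr; linarith
  · filter_upwards [h3, h4] with τ e1 e2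
    have := aa e2 hΛ.le
    have : 0 ≤ C2 * η := by positivity
    linarith
end HW
namespace HW
open scoped ComplexConjugate RealInnerProductSpace ENNReal
variable {n : ℕ}
lemma rv (k : ℕ) : ∃ C, 0 ≤ C ∧ ∀ z : ℝ, |z| ≤ 1 → |(1 + z) ^ k - 1 - k * z| ≤ C * z ^ 2 := by
  induction k with
  | zero => exact ⟨0, le_rfl, fun z _ => by simp⟩
  | succ k ih =>
    obtain ⟨C, hC, h⟩ := ih
    refine ⟨2 * C + k, by positivity, fun z hz => ?_⟩
    have e : (1 + z) ^ (k + 1) - 1 - (k + 1 : ℕ) * z = ((1 + z) ^ k - 1 - k * z) * (1 + z) + k * z ^ 2 := by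
      push_cast; ring
    rw [e]
    refine (ba _ _).trans ?_
    rw [bh, gl (by positivity : (0:ℝ) ≤ k * z ^ 2)]
    have h1 : |1 + z| ≤ 2 := (ba _ _).trans (by rw [abs_one]; linarith)
    have := ax (h z hz) h1 (aq _) (by positivity)
    linarith
def ee (μ s : ℝ) (τ : ℂ) : ℂ := ((μ^2 - 1 : ℝ) * τ - Complex.I * s) * B1 τ
lemma oq (μ s : ℝ) {τ : ℂ} (h : 0 ≤ τ.re) : 1 + qa μ s τ = (1 + τ) * (1 + ee μ s τ) := by
  have := fr h
  rw [ee, B1, qa]; field_simp; push_cast; ring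
lemma op (μ s : ℝ) {τ : ℂ} (h : 0 ≤ τ.re) : ‖ee μ s τ‖ ≤ |μ^2 - 1| + |s| := by
  have h1 := one_le h
  have h2 := dv h
  rw [ee, B1, am, norm_inv, ← az, dx (by linarith)]
  refine (dp _ _).trans ?_
  rw [am, am, aj, aj, Complex.norm_I, nt, af, af, add_mul]
  exact bw (aa h2 (aq _)) (bq (aq _) h1)
lemma sp (μ s : ℝ) {τ : ℂ} (h : 0 ≤ τ.re) : 2 * (ee μ s τ).re = (μ^2 - 1) - wf (μ^2 - 1) (-s) τ := by
  have hne := fr h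
  have e : ee μ s τ = ((μ^2 - 1 : ℝ) * (1 - wz τ) - Complex.I * s * (1 + wz τ)) / 2 := by
    rw [ee, wz, B1]; field_simp; push_cast; ring
  have e2 : 2 * ee μ s τ = ((μ^2 - 1 : ℝ) * (1 - wz τ) - Complex.I * s * (1 + wz τ)) := by rw [e]; ring
  have e3 := congrArg Complex.re e2
  rw [iz]
  simp [-Complex.ofReal_sub, -Complex.ofReal_pow] at e3
  linarith
lemma ro {μ : ℝ} (s : ℝ) {τ : ℂ} (h : 0 ≤ τ.re) : rq μ s τ = μ / ‖1 + ee μ s τ‖ := by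
  have := fr h
  rw [rq, oq μ s h, am, bk μ, mul_div_mul_left _ _ (qd.2 this)]
lemma rn {μ : ℝ} (hμ : 0 < μ) (s : ℝ) {τ : ℂ} (h : 0 ≤ τ.re) {d : ℝ} (hd : |μ^2 - 1| + |s| ≤ d) (hd4 : d ≤ 1/16) :
    |rq μ s τ - 1| ≤ 2 * d ∧ |rq μ s τ - 1 - wf (μ^2 - 1) (-s) τ / 2| ≤ 8 * d ^ 2 := by
  set e := ee μ s τ with he
  set m := μ^2 - 1 with hm
  set W := wf m (-s) τ with hW
  set r := rq μ s τ with hr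
  have hd0 : 0 ≤ d := ew (by positivity) hd
  have h1 : ‖e‖ ≤ d := (op μ s h).trans hd
  have h2 : |W| ≤ d := by have := ja m (-s) h; rw [abs_neg] at this; exact this.trans hd
  have h3 : |m| ≤ d := by linarith [aq s]
  have r0 : 0 < r := hj hμ s h
  have hN : ‖1 + e‖ ^ 2 = 1 + m - W + ‖e‖ ^ 2 := by
    have := sp μ s h
    rw [dy, dy, au, au]
    simp; rw [← he] at this; nlinarith
  have h4 : 3/4 ≤ ‖1 + e‖ ^ 2 := by rw [hN]; nlinarith [eh.1 h2, eh.1 h3, ed ‖e‖]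
  have hne : 0 < ‖1 + e‖ := by by_contra hh; have : ‖1 + e‖ = 0 := le_antisymm (not_lt.1 hh) (ai _); rw [this] at h4; norm_num at h4
  have hr2 : r ^ 2 * ‖1 + e‖ ^ 2 = 1 + m := by
    rw [hr, ro s h, ← he, mo, div_mul_cancel₀ _ (by positivity)]; rw [hm]; ring
  have hX : (r ^ 2 - 1 - W) * ‖1 + e‖ ^ 2 = -‖e‖^2 - m * W + W ^ 2 - W * ‖e‖ ^ 2 := by
    rw [sub_mul, sub_mul, hr2, hN]; ring
  have e2 : ‖e‖ ^ 2 ≤ d ^ 2 := be (ai _) h1 2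
  have hY : |-‖e‖^2 - m * W + W ^ 2 - W * ‖e‖ ^ 2| ≤ (3 + 1/16) * d ^ 2 := by
    have t1 : |m * W| ≤ d ^ 2 := by rw [bh, sq]; exact ax h3 h2 (aq _) hd0
    have t2 : |W ^ 2| ≤ d ^ 2 := by rw [abs_pow]; exact be (aq _) h2 2
    have t3 : |W * ‖e‖ ^ 2| ≤ 1/16 * d ^ 2 := by
      rw [bh, gl (ed ‖e‖)]; exact ax (h2.trans hd4) e2 (ed _) (by norm_num)
    rw [eh] at *
    constructor <;> nlinarith [ed ‖e‖]
  have hZ : |r ^ 2 - 1 - W| ≤ 5 * d ^ 2 := by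
    rw [← hX, bh, gl (ed ‖1 + e‖)] at hY
    nlinarith [aq (r ^ 2 - 1 - W), ed d]
  have hV : |r - 1| ≤ 2 * d := by
    have t1 : |r ^ 2 - 1| ≤ d + 5 * d ^ 2 := by
      have := ba (r ^ 2 - 1 - W) W
      rw [sub_add_cancel] at this; linarith
    have t2 : |r ^ 2 - 1| = |r - 1| * (r + 1) := by
      rw [← bm (by linarith : 0 < r + 1), ← bh]; congr 1; ring
    have : |r - 1| ≤ |r ^ 2 - 1| := by rw [t2]; exact bq (aq _) (by linarith)
    nlinarith
  refine ⟨hV, ?_⟩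
  have e3 : r - 1 - W / 2 = (r ^ 2 - 1 - W) / 2 - (r - 1) ^ 2 / 2 := by ring
  have t4 : (r - 1) ^ 2 ≤ (2 * d) ^ 2 := by rw [← sq_abs]; exact be (aq _) hV 2
  rw [e3, eh]
  rw [eh] at hZ
  constructor <;> nlinarith [ed (r - 1)]
lemma li (k : ℕ) : ∃ C, 0 ≤ C ∧ ∀ {μ : ℝ} (hμ : 0 < μ) (s : ℝ) {τ : ℂ} (h : 0 ≤ τ.re) {d : ℝ} (hd : |μ^2 - 1| + |s| ≤ d) (hd4 : d ≤ 1/16),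
    |rq μ s τ ^ k - 1| ≤ C * d ∧ |rq μ s τ ^ k - 1 - k / 2 * wf (μ^2 - 1) (-s) τ| ≤ C * d ^ 2 := by
  obtain ⟨C, hC, h0⟩ := rv k
  refine ⟨4 * C + 8 * k, by positivity, fun {μ} hμ s {τ} h {d} hd hd4 => ?_⟩
  have hd0 : 0 ≤ d := ew (by positivity) hd
  obtain ⟨h1, h2⟩ := rn hμ s h hd hd4
  set r := rq μ s τ
  have h3 := h0 (r - 1) (by linarith)
  rw [add_sub_cancel] at h3
  have h4 : (r - 1) ^ 2 ≤ (2 * d) ^ 2 := by rw [← sq_abs]; exact be (aq _) h1 2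
  have h5 : C * (r - 1) ^ 2 ≤ C * (2 * d) ^ 2 := aa h4 hC
  have k0 : (0:ℝ) ≤ k := by positivity
  constructor
  · have e : r ^ k - 1 = (r ^ k - 1 - k * (r - 1)) + k * (r - 1) := by ring
    rw [e]
    refine (ba _ _).trans ?_
    rw [bh, gl k0]
    have := aa h1 k0
    have : C * (2 * d) ^ 2 ≤ C * (4 * d) := aa (by nlinarith) hC
    have : 0 ≤ k * d := by positivity
    linarith
  · have e : r ^ k - 1 - k / 2 * wf (μ^2 - 1) (-s) τ = (r ^ k - 1 - k * (r - 1)) + k * (r - 1 - wf (μ^2 - 1) (-s) τ / 2) := by ring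
    rw [e]
    refine (ba _ _).trans ?_
    rw [bh, gl k0]
    have := aa h2 k0
    linarith
lemma rd (a b : ℝ) {μ : ℝ} (s : ℝ) {τ : ℂ} (h : 0 ≤ τ.re) {d : ℝ} (hd : |μ^2 - 1| + |s| ≤ d) (hd4 : d ≤ 1/16) :
    |wf a b (qa μ s τ) - wf a b τ| ≤ 4 * (|a| + |b|) * d := by
  have hd0 : 0 ≤ d := ew (by positivity) hd
  set e := ee μ s τ with he
  have h1 : ‖e‖ ≤ d := (op μ s h).trans hd
  have h2 : 1/2 ≤ ‖1 + e‖ := by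
    have := norm_sub_norm_le (1:ℂ) (-e)
    rw [norm_one, tm, sub_neg_eq_add] at this; linarith
  have hne : 1 + e ≠ 0 := dq.1 (by linarith)
  have hne1 := fr h
  have hw : wz (qa μ s τ) - wz τ = -(2 * B1 τ * (e / (1 + e))) := by
    rw [wz, wz, B1, B1, oq μ s h, ← he]; field_simp; ring
  have h3 : ‖wz (qa μ s τ) - wz τ‖ ≤ 4 * d := by
    rw [hw, tm, am, am, norm_div, Complex.norm_ofNat]
    have : ‖e‖ / ‖1 + e‖ ≤ 2 * d := by rw [dx (by linarith)]; nlinarith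
    have := ax (gy h) this (by positivity) (by norm_num)
    linarith
  rw [iz, iz]
  have e1 : a * (wz (qa μ s τ)).re + b * (wz (qa μ s τ)).im - (a * (wz τ).re + b * (wz τ).im) = a * (wz (qa μ s τ) - wz τ).re + b * (wz (qa μ s τ) - wz τ).im := by
    simp; ring
  rw [e1]
  refine (ba _ _).trans ?_
  rw [bh, bh]
  have t1 := aa ((cb _).trans h3) (aq a)
  have t2 := aa ((ir _).trans h3) (aq b)
  linarith
lemma nm (k : ℕ) : ∃ C, 0 ≤ C ∧ ∀ (a b : ℝ) {μ : ℝ} (hμ : 0 < μ) (s : ℝ) {τ : ℂ} (h : 0 ≤ τ.re) {d : ℝ} (hd : |μ^2 - 1| + |s| ≤ d) (hd4 : d ≤ 1/16),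
    |wf a b (qa μ s τ) * rq μ s τ ^ k - wf a b τ| ≤ C * (|a| + |b|) * d := by
  obtain ⟨C, hC, h0⟩ := li k
  refine ⟨C + 4, by positivity, fun a b {μ} hμ s {τ} h {d} hd hd4 => ?_⟩
  have h1 := (h0 hμ s h hd hd4).1
  have h2 := rd a b s h hd hd4
  have h3 := ja a b (fq μ s h)
  have e : wf a b (qa μ s τ) * rq μ s τ ^ k - wf a b τ = wf a b (qa μ s τ) * (rq μ s τ ^ k - 1) + (wf a b (qa μ s τ) - wf a b τ) := by ring
  rw [e]
  refine (ba _ _).trans ?_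
  rw [bh]
  have := ax h3 h1 (aq _) (by positivity)
  linarith
end HW
namespace HW
open scoped ComplexConjugate RealInnerProductSpace ENNReal
variable {n : ℕ}
lemma nr (μ s μ' s' : ℝ) (τ : ℂ) : qa μ s (qa μ' s' τ) = qa (μ * μ') (μ^2 * s' + s) τ := by
  simp only [qa]; push_cast; ring
lemma rr (τ : ℂ) : qa 1 0 τ = τ := by simp [qa]
lemma lk {μ : ℝ} (hμ : 0 < μ) (s : ℝ) (τ : ℂ) : qa μ s (qa μ⁻¹ (-s / μ^2) τ) = τ := by
  rw [nr, da hμ.ne', show μ^2 * (-s / μ^2) + s = 0 by field_simp; ring, rr]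
lemma rm {μ : ℝ} (hμ : 0 < μ) (s : ℝ) {τ : ℂ} (h : 0 ≤ τ.re) : rq μ s (qa μ⁻¹ (-s / μ^2) τ) * rq μ⁻¹ (-s / μ^2) τ = 1 := by
  rw [rq, rq, lk hμ]
  have h1 := one_le h
  have h2 := one_le (fq μ⁻¹ (-s / μ^2) h)
  have : ‖1 + τ‖ ≠ 0 := by linarith
  have : ‖1 + qa μ⁻¹ (-s / μ^2) τ‖ ≠ 0 := by linarith
  generalize ‖1 + qa μ⁻¹ (-s / μ^2) τ‖ = X at *
  field_simp
def gf (n : ℕ) (μ s a b : ℝ) (τ : ℂ) : ℝ := wf a b (qa μ s τ) * rq μ s τ ^ n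
lemma ok {μ : ℝ} (hμ : 0 < μ) (s a b : ℝ) : MemLp (gf n μ s a b) 2 (nu n) := by
  obtain ⟨C, hC, hr⟩ := lj hμ s
  refine ny (C := (|a| + |b|) * C ^ n) (((nz a b).comp (dt μ s)).mul ((jg μ s).pow_const _)).aestronglyMeasurable fun τ h => ?_
  show |wf a b (qa μ s τ) * rq μ s τ ^ n| ≤ _
  rw [bh, abs_pow, bm (hj hμ s h)]
  have := (hj hμ s h).le
  have := hr τ h
  exact ax (ja a b (fq μ s h)) (by gcongr) (by positivity) (by positivity)
def gE (n : ℕ) {μ : ℝ} (hμ : 0 < μ) (s a b : ℝ) : HH n := (ok hμ s a b).toLp _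
lemma ol {μ : ℝ} (hμ : 0 < μ) (s a b : ℝ) : gE n hμ s a b =ᵐ[nu n] gf n μ s a b := (ok hμ s a b).coeFn_toLp
lemma ld {μ : ℝ} (hμ : 0 < μ) (s : ℝ) (h : HH n) (a b : ℝ) :
    ⟪tr hμ s h, EE n (nv a b)⟫ = ⟪h, gE n (ii.2 hμ) (-s / μ^2) a b⟫ := by
  rw [du, du]
  have e1 : ∫ τ, tr hμ s h τ * EE n (nv a b) τ ∂(nu n) = ∫ τ, trf n μ s h τ * wf a b τ ∂(nu n) := by
    refine al ?_
    filter_upwards [dg hμ s h, fa (n := n) a b] with τ e1 e2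
    rw [e1, e2]
  have hm : Measurable (fun τ => trf n μ s h τ * wf a b τ) := (ls μ s h).mul (nz a b)
  rw [e1, ← er (ii.2 hμ) (-s / μ^2) hm]
  refine al ?_
  filter_upwards [ol (n := n) (ii.2 hμ) (-s / μ^2) a b, di (n := n)] with τ e1 e2
  have h1 := rm hμ s e2
  rw [e1, gf, trf, lk hμ]
  set r := rq μ⁻¹ (-s / μ^2) τ
  set r' := rq μ s (qa μ⁻¹ (-s / μ^2) τ)
  have h2 : r' ^ (n + 2) * r ^ (n + 2) = 1 := by rw [← ci, h1, one_pow]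
  rw [show 2 * n + 2 = (n + 2) + n by ring, tl]
  linear_combination (r ^ n * h τ * wf a b (qa μ⁻¹ (-s / μ^2) τ)) * h2
lemma sf {μ s d : ℝ} (hμ : 0 < μ) (hd : |μ^2 - 1| + |s| ≤ d) (hd4 : d ≤ 1/32) : |μ⁻¹^2 - 1| + |-s / μ^2| ≤ 2 * d := by
  have h1 : 1/2 ≤ μ^2 := by have := eh.1 ((le_add_of_nonneg_right (aq s)).trans hd); linarith
  have e1 : μ⁻¹^2 - 1 = -(μ^2 - 1) / μ^2 := by field_simp; ring
  rw [e1, abs_div, abs_div, abs_neg, abs_neg, bm (by linarith : 0 < μ^2), ← add_div, dx (by linarith)]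
  nlinarith [aq (μ^2 - 1), aq s]
lemma lf (n : ℕ) : ∃ C, 0 ≤ C ∧ ∀ {μ : ℝ} (hμ : 0 < μ) (s : ℝ) {d : ℝ} (hd : |μ^2 - 1| + |s| ≤ d) (hd4 : d ≤ 1/32),
    (∀ a b, ‖tr hμ s (EE n (nv a b)) - EE n (nv a b)‖ ≤ C * (|a| + |b|) * d) ∧
    (∀ a b, ‖gE n (ii.2 hμ) (-s / μ^2) a b - EE n (nv a b)‖ ≤ C * (|a| + |b|) * d) ∧
    ‖tr hμ s (one n) - one n - ((n + 2 : ℝ) / 2) • EE n (nv (μ^2 - 1) (-s))‖ ≤ C * d ^ 2 := by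
  obtain ⟨C1, hC1, h1⟩ := nm (n + 2)
  obtain ⟨C2, hC2, h2⟩ := nm n
  obtain ⟨C3, hC3, h3⟩ := li (n + 2)
  have ho := ai (one n)
  refine ⟨(C1 + 2 * C2 + C3) * ‖one n‖, by positivity, fun {μ} hμ s {d} hd hd4 => ?_⟩
  have hd0 : 0 ≤ d := ew (by positivity) hd
  refine ⟨fun a b => ?_, fun a b => ?_, ?_⟩
  · refine (qt (c := C1 * (|a| + |b|) * d) ?_).trans ?_
    · filter_upwards [bb (tr hμ s (EE n (nv a b))) (EE n (nv a b)), dg hμ s (EE n (nv a b)), fa (n := n) a b, di (n := n), (fo hμ s).ae (fa (n := n) a b)] with τ e1 e2 e3 e4 e5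
      rw [e1, ay, e2, e3, trf, e5]
      exact h1 a b hμ s e4 hd (by linarith)
    · have : 0 ≤ (2 * C2 + C3) * ‖one n‖ * ((|a| + |b|) * d) := by positivity
      linarith
  · refine (qt (c := C2 * (|a| + |b|) * (2 * d)) ?_).trans ?_
    · filter_upwards [bb (gE n (ii.2 hμ) (-s / μ^2) a b) (EE n (nv a b)), ol (n := n) (ii.2 hμ) (-s / μ^2) a b, fa (n := n) a b, di (n := n)] with τ e1 e2 e3 e4
      rw [e1, ay, e2, e3, gf]
      exact h2 a b (ii.2 hμ) _ e4 (sf hμ hd hd4) (by linarith)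
    · have : 0 ≤ (C1 + C3) * ‖one n‖ * ((|a| + |b|) * d) := by positivity
      linarith
  · refine (qt (c := C3 * d ^ 2) ?_).trans ?_
    · filter_upwards [bb (tr hμ s (one n) - one n) (((n + 2 : ℝ) / 2) • EE n (nv (μ^2 - 1) (-s))), bb (tr hμ s (one n)) (one n), dg hμ s (one n),
        Lp.coeFn_smul ((n + 2 : ℝ) / 2) (EE n (nv (μ^2 - 1) (-s))), fa (n := n) (μ^2 - 1) (-s), di (n := n), fs (n := n), (fo hμ s).ae (fs (n := n))] with τ e1 e2 e3 e4 e5 e6 e7 e8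
      rw [e1, ay, e2, ay, e3, e4, cq, e5, e7, trf, e8, nt, ak]
      have := (h3 hμ s e6 hd (by linarith)).2
      push_cast at this; exact this
    · have : 0 ≤ (C1 + 2 * C2) * ‖one n‖ * d ^ 2 := by positivity
      linarith
variable {θ : ℝ} (S : SP n) (L : NL n θ)
def JJ (K : ℂ → ℝ) (h : HH n) : ℝ := 1/2 * ⟪S.T h, h⟫ - ∫ τ, K τ * L.G (S.T h τ) ∂(nu n)
def Ph (K : ℂ → ℝ) : ℝ := JJ S L K (hk S L K)
lemma pt (f : HH n) : Integrable (fun τ => L.G (f τ)) (nu n) := by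
  have h1 : Integrable (fun τ => |L.G 0| + |L.F 0| * |f τ| + (pn n + θ) * (f τ) ^ 2) (nu n) := by
    have i1 : Integrable f (nu n) := (jw f).integrable (by norm_num)
    have i2 := (bj (gg f)).1 (jw f)
    exact ((integrable_const _).add (i1.abs.const_mul _)).add (i2.const_mul _)
  refine h1.mono' (L.G_cont.comp_stronglyMeasurable (kl _)).aestronglyMeasurable (ab fun τ => ?_)
  have h2 := L.G_tay 0 (f τ)
  rw [tk] at h2
  rw [af, ← bh]
  have e : L.G (f τ) = L.G 0 + L.F 0 * f τ + (L.G (f τ) - L.G 0 - L.F 0 * f τ) := by ring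
  rw [e]
  refine (abs_add_three _ _ _).trans ?_
  linarith
lemma iq {η : ℝ} {K : ℂ → ℝ} (hK : Adm η K) (f : HH n) : Integrable (fun τ => K τ * L.G (f τ)) (nu n) :=
  (pt L f).bdd_mul (c := 1 + η) hK.meas.aestronglyMeasurable (ab fun τ => hK.le τ)
lemma pq (hn : 1 ≤ n) {η : ℝ} (hη : η ≤ 1) (hθ : 0 ≤ θ) {K : ℂ → ℝ} (hK : Adm η K) (h v : HH n) :
    |JJ S L K (h + v) - JJ S L K h - ⟪h - Nl S L K h, S.T v⟫| ≤ (1/2 + 2 * (pn n + θ)) * ‖v‖ ^ 2 := by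
  have hp := dh hn
  have i0 : Integrable (fun τ => K τ * L.F (S.T h τ) * S.T v τ) (nu n) := by
    have := (L2.integrable_inner (𝕜 := ℝ) (Nl S L K h) (S.T v))
    refine this.congr ?_
    filter_upwards [cp S L hn hK h] with τ e
    simp [e, bk]
  have e0 : ⟪Nl S L K h, S.T v⟫ = ∫ τ, K τ * L.F (S.T h τ) * S.T v τ ∂(nu n) := by
    rw [du]; refine al ?_
    filter_upwards [cp S L hn hK h] with τ e
    rw [e]
  have e1 : JJ S L K (h + v) - JJ S L K h - ⟪h - Nl S L K h, S.T v⟫ = 1/2 * ⟪S.T v, v⟫ -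
      ∫ τ, (K τ * L.G (S.T (h + v) τ) - K τ * L.G (S.T h τ) - K τ * L.F (S.T h τ) * S.T v τ) ∂(nu n) := by
    have i1 : Integrable (fun τ => K τ * L.G (S.T (h + v) τ) - K τ * L.G (S.T h τ)) (nu n) := (iq L hK _).sub (iq L hK _)
    rw [integral_sub i1 i0, integral_sub (iq L hK _) (iq L hK _), ← e0, JJ, JJ, map_add, dr,
      inner_add_left, ql, ql, S.sym v h, S.sym h v, dn (S.T h) v, S.sym h v]
    ring
  have i2 := (bj (gg (S.T v))).1 (jw (S.T v))
  have e2 : ‖∫ τ, (K τ * L.G (S.T (h + v) τ) - K τ * L.G (S.T h τ) - K τ * L.F (S.T h τ) * S.T v τ) ∂(nu n)‖ ≤ ∫ τ, 2 * (pn n + θ) * (S.T v τ) ^ 2 ∂(nu n) := by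
    refine norm_integral_le_of_norm_le (i2.const_mul _) ?_
    have hadd : ∀ᵐ τ ∂(nu n), S.T (h + v) τ = S.T h τ + S.T v τ := by rw [map_add]; exact qq _ _
    filter_upwards [hadd] with τ e
    rw [e, af]
    have h3 := L.G_tay (S.T h τ) (S.T h τ + S.T v τ)
    rw [add_sub_cancel_left] at h3
    rw [show K τ * L.G (S.T h τ + S.T v τ) - K τ * L.G (S.T h τ) - K τ * L.F (S.T h τ) * S.T v τ = K τ * (L.G (S.T h τ + S.T v τ) - L.G (S.T h τ) - L.F (S.T h τ) * S.T v τ) by ring, bh, bc]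
    exact ax ((hK.le τ).trans (by linarith)) h3 (aq _) (by norm_num)
  have e3 : ∫ τ, 2 * (pn n + θ) * (S.T v τ) ^ 2 ∂(nu n) ≤ 2 * (pn n + θ) * ‖v‖ ^ 2 := by
    rw [ah]
    have : ∫ τ, (S.T v τ) ^ 2 ∂(nu n) = ‖S.T v‖ ^ 2 := by
      rw [← bp, du]; simp only [sq]
    rw [this]
    gcongr; exact S.T_le v
  have e4 : |⟪S.T v, v⟫| ≤ ‖v‖ ^ 2 := (cm _ _).trans (by rw [sq]; gcongr; exact S.T_le v)
  rw [e1]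
  refine (abs_sub _ _).trans ?_
  rw [bh, bm (by norm_num : (0:ℝ) < 1/2)]
  rw [af] at e2
  linarith
end HW
namespace HW
open scoped ComplexConjugate RealInnerProductSpace ENNReal
variable {n : ℕ}
lemma rf {μ : ℝ} (hμ : 0 < μ) (s : ℝ) (f g : HH n) : tr hμ s (f + g) = tr hμ s f + tr hμ s g := by
  apply Lp.ext
  filter_upwards [dg hμ s (f + g), dg hμ s f, dg hμ s g, qq (tr hμ s f) (tr hμ s g), (fo hμ s).ae (qq f g)] with τ e1 e2 e3 e4 e5
  rw [e1, e4, en, e2, e3, trf, trf, trf, e5, en]; ring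
lemma Adm.comp {η : ℝ} {K : ℂ → ℝ} (hK : Adm η K) (μ s : ℝ) : Adm η (fun τ => K (qa μ s τ)) :=
  ⟨hK.meas.comp (dt μ s), fun τ => hK.bd _⟩
lemma rx (hn : 1 ≤ n) : n * pn n = n + 2 := by
  have : (1:ℝ) ≤ n := by exact_mod_cast hn
  rw [pn]; field_simp
lemma jd (hn : 1 ≤ n) {f r : ℝ} (hf : 0 < f) (hr : 0 < r) : (f * r ^ n) ^ pn n = f ^ pn n * r ^ (n + 2) := by
  rw [kj hf.le (by positivity), ← gd r n, ← qn hr.le, rx hn]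
  congr 1; exact_mod_cast gd r (n + 2)
lemma nc (hn : 1 ≤ n) {f r : ℝ} (hf : 0 < f) (hr : 0 < r) : (f * r ^ n) ^ (pn n + 1) = f ^ (pn n + 1) * r ^ (2 * n + 2) := by
  rw [Real.rpow_add_one (by positivity), Real.rpow_add_one (by positivity), jd hn hf hr]; ring
variable {θ : ℝ} {S : SP n} {L : NL n θ}
section
variable (hn : 1 ≤ n) {η : ℝ} {K : ℂ → ℝ} (hK : Adm η K) {h : HH n} (hf : ∀ᵐ τ ∂(nu n), |S.T h τ - 1| ≤ L.δ / 2)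
  {μ : ℝ} (hμ : 0 < μ) (s : ℝ) (hr : ∀ τ : ℂ, 0 ≤ τ.re → |rq μ s τ ^ n - 1| ≤ L.δ / 4)
include hn hK hf hμ hr
lemma np : ∀ᵐ τ ∂(nu n), |S.T h (qa μ s τ) - 1| ≤ L.δ ∧ |S.T h (qa μ s τ) * rq μ s τ ^ n - 1| ≤ L.δ ∧ 0 < S.T h (qa μ s τ) ∧ 0 < rq μ s τ := by
  filter_upwards [(fo hμ s).ae hf, di (n := n)] with τ e1 e2
  have h1 := L.hδ
  have h2 := L.hδ2
  have h3 := hr τ e2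
  set f := S.T h (qa μ s τ)
  set r := rq μ s τ ^ n
  refine ⟨by linarith, ?_, by linarith [(eh.1 e1).1], hj hμ s e2⟩
  have e : f * r - 1 = (f - 1) * (r - 1) + (r - 1) + (f - 1) := by ring
  rw [e]
  refine (abs_add_three _ _ _).trans ?_
  have := ax e1 h3 (aq _) (by linarith)
  rw [bh]
  nlinarith
lemma rg : Nl S L (fun τ => K (qa μ s τ)) (tr hμ s h) = tr hμ s (Nl S L K h) := by
  apply Lp.ext
  filter_upwards [cp S L hn (hK.comp μ s) (tr hμ s h), dg hμ s (Nl S L K h), (fo hμ s).ae (cp S L hn hK h), jv S hn hμ s h, np hn hK hf hμ s hr] with τ e1 e2 e3 e4 e5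
  obtain ⟨a1, a2, a3, a4⟩ := e5
  rw [e1, e2, trf, e3, e4, L.F_eq _ a1, L.F_eq _ a2, jd hn a3 a4]; ring
lemma rh : JJ S L (fun τ => K (qa μ s τ)) (tr hμ s h) = JJ S L K h := by
  rw [JJ, JJ, du, du]
  have m1 : Measurable (fun τ => S.T h τ * h τ) := (cc _).mul (cc _)
  have m2 : Measurable (fun τ => K τ * L.G (S.T h τ)) := hK.meas.mul (L.G_cont.measurable.comp (cc _))
  rw [← er hμ s m1, ← er hμ s m2]
  congr 1
  · congr 1
    refine al ?_
    filter_upwards [jv S hn hμ s h, dg hμ s h] with τ e1 e2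
    rw [e1, e2, trf]; ring
  · refine al ?_
    filter_upwards [jv S hn hμ s h, np hn hK hf hμ s hr] with τ e1 e2
    obtain ⟨a1, a2, a3, a4⟩ := e2
    rw [e1, L.G_eq _ a1, L.G_eq _ a2, nc hn a3 a4]; ring
end
lemma proj (S : SP n) (y : HH n) : ∃ a b, y - S.R (y - pn n • S.T y) = EE n (nv a b) := by
  set x := S.R (y - pn n • S.T y) - y with hx
  have h1 := S.R1 (y - pn n • S.T y)
  set z := x - pn n • S.T x with hz
  have e : S.R (y - pn n • S.T y) - pn n • S.T (S.R (y - pn n • S.T y)) - (y - pn n • S.T y) = z := by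
    simp only [hz, hx]; rw [map_sub S.T (S.R (y - pn n • S.T y)) y, smul_sub]; abel
  rw [e] at h1
  have h2 : ⟪z, z⟫ = 0 := by
    conv_lhs => rw [hz]
    rw [← hz, dr, it, S.sym, ← real_inner_smul_right, h1, sub_self]
  have h3 : z = 0 := qe.1 h2
  have h4 : pn n • S.T x = x := by rw [hz] at h3; exact (gj.1 h3).symm
  obtain ⟨a, b, hab⟩ := S.N (-x) (by rw [map_neg, smul_neg, h4])
  exact ⟨a, b, by rw [← hab, hx]; abel⟩
def Dn (n : ℕ) : ℝ := (lf n).choose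
theorem sz {η : ℝ} (H : Sm (θ := θ) S η) {K : ℂ → ℝ} (hK : Adm η K) (hf : ∀ᵐ τ ∂(nu n), |S.T (hk S L K) τ - 1| ≤ L.δ / 2)
    {a b : ℝ} (hab : Nl S L K (hk S L K) = hk S L K + EE n (nv a b)) :
    ∃ M d0, 0 ≤ M ∧ 0 < d0 ∧ ∀ {μ : ℝ} (hμ : 0 < μ) (s : ℝ) {d : ℝ} (hd : |μ^2 - 1| + |s| ≤ d) (hd4 : d ≤ d0),
      |pn n * (Ph S L (fun τ => K (qa μ s τ)) - Ph S L K) - (n + 2 : ℝ) / 2 * ⟪EE n (nv (μ^2 - 1) (-s)), EE n (nv a b)⟫| ≤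
        ‖hk S L K - one n‖ * (Dn n * (|a| + |b|) * d) + M * d ^ 2 := by
  have hn := H.hn
  have hp := dh hn
  obtain ⟨hD, hE⟩ := (lf n).choose_spec
  change 0 ≤ Dn n at hD
  obtain ⟨c, hc, hnv⟩ := ll (n := n)
  obtain ⟨Cr, hCr, hrq⟩ := li n
  set h := hk S L K with hh
  set ψ := EE n (nv a b) with hψ
  set N := |a| + |b| with hN
  have hN0 : 0 ≤ N := by positivity
  set X := Dn n * (2 * c) * ‖h‖ with hX
  have hX0 : 0 ≤ X := by positivity
  set E := X + 2 * (‖S.R‖ * (Dn n * N) + 1/2 * X) with hEd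
  have hE0 : 0 ≤ E := by positivity
  set CJ := 1/2 + 2 * (pn n + θ) with hCJ
  have hCJ0 : 0 ≤ CJ := by have := H.hθ; positivity
  refine ⟨Dn n * ‖ψ‖ + pn n * (Dn n * N * E + CJ * E ^ 2), min (1/32) (L.δ / 4 / (Cr + 1)), by positivity, lt_min (by norm_num) (by have := L.hδ; positivity),
    fun {μ} hμ s {d} hd hd4 => ?_⟩
  have hd0 : 0 ≤ d := ew (by positivity) hd
  have hd32 : d ≤ 1/32 := hd4.trans (kg _ _)
  have hr : ∀ τ : ℂ, 0 ≤ τ.re → |rq μ s τ ^ n - 1| ≤ L.δ / 4 := fun τ hτ => by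
    refine (hrq hμ s hτ hd (by linarith)).1.trans ?_
    have := hd4.trans (kf _ _)
    rw [bs (by positivity)] at this
    nlinarith
  obtain ⟨t1, t2, t3⟩ := hE hμ s hd hd32
  change ∀ a b, _ ≤ Dn n * _ * d at t1
  change ∀ a b, _ ≤ Dn n * _ * d at t2
  change _ ≤ Dn n * d ^ 2 at t3
  set K' := fun τ => K (qa μ s τ) with hK'
  have aK' : Adm η K' := hK.comp μ s
  set y := tr hμ s h with hy
  have hNy : Nl S L K' y = y + tr hμ s ψ := by rw [hK', hy, rg hn hK hf hμ s hr, hab, rf]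
  have hJ : JJ S L K' y = Ph S L K := rh hn hK hf hμ s hr
  have ho : ∀ a b, ⟪h, EE n (nv a b)⟫ = 0 := og H hK
  -- pairing
  have p1 : |⟪y, ψ⟫ - (n + 2 : ℝ) / 2 * ⟪EE n (nv (μ^2 - 1) (-s)), ψ⟫| ≤ ‖h - one n‖ * (Dn n * N * d) + Dn n * d ^ 2 * ‖ψ‖ := by
    have e1 : ⟪y, ψ⟫ - (n + 2 : ℝ) / 2 * ⟪EE n (nv (μ^2 - 1) (-s)), ψ⟫ = ⟪h - one n, gE n (ii.2 hμ) (-s / μ^2) a b - ψ⟫ +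
        ⟪tr hμ s (one n) - one n - ((n + 2 : ℝ) / 2) • EE n (nv (μ^2 - 1) (-s)), ψ⟫ := by
      rw [dr, gk, gk, dr, dr, ← ld hμ s h a b, ← ld hμ s (one n) a b, it, ho, ns S hn]
      ring
    rw [e1]
    refine (ba _ _).trans (bw ?_ ?_)
    · exact (cm _ _).trans (aa (t2 a b) (ai _))
    · exact (cm _ _).trans (ag t3 (ai _))
  -- projection
  obtain ⟨a', b', hχ⟩ := proj S y
  set v := S.R (y - pn n • S.T y) with hv
  have vo : ∀ a b, ⟪v, EE n (nv a b)⟫ = 0 := fun a b => S.R2 _ _ (S.TN a b)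
  set χ := EE n (nv a' b') with hχd
  have hχ1 : ‖χ‖ ≤ X * d := by
    have e1 : ‖χ‖ ^ 2 = ⟪h, gE n (ii.2 hμ) (-s / μ^2) a' b' - χ⟫ := by
      rw [gk, ho, ← ld hμ s h a' b', ← bp, tk]
      conv_lhs => rw [← hχ]
      rw [dr, ← hχd, hχ, vo, tk]
    have e2 : ‖χ‖ ^ 2 ≤ ‖h‖ * (Dn n * (|a'| + |b'|) * d) := by
      rw [e1]; exact (real_inner_le_norm _ _).trans (aa (t2 a' b') (ai _))
    have e3 : |a'| + |b'| ≤ 2 * c * ‖χ‖ := by linarith [(hnv a' b').1, (hnv a' b').2]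
    have e4 : ‖χ‖ ^ 2 ≤ (X * d) * ‖χ‖ := by
      refine e2.trans ?_
      have : ‖h‖ * (Dn n * (|a'| + |b'|) * d) ≤ ‖h‖ * (Dn n * (2 * c * ‖χ‖) * d) := by gcongr
      rw [hX]; linarith
    by_contra hcon
    rw [not_le] at hcon
    have : 0 < ‖χ‖ := eg (by positivity) hcon
    nlinarith
  have hyv : y - v = χ := hχ
  have hPs : Ps S L K' y = v + S.R (tr hμ s ψ - ψ) := by
    have : S.R ψ = 0 := S.R4 _ (S.TN a b)
    rw [Ps, hNy, map_sub S.R (tr hμ s ψ), this, tk, hv, ← map_add]; congr 1; abel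
  have hw : ‖v - hk S L K'‖ ≤ 2 * (‖S.R‖ * (Dn n * N) + 1/2 * X) * d := by
    refine (ma (L := L) H aK' v).trans ?_
    have e1 : v - Ps S L K' v = -S.R (tr hμ s ψ - ψ) + (Ps S L K' y - Ps S L K' v) := by rw [hPs]; abel
    have e2 : ‖v - Ps S L K' v‖ ≤ ‖S.R‖ * (Dn n * N * d) + 1/2 * (X * d) := by
      rw [e1]
      refine (bu _ _).trans (bw ?_ ?_)
      · rw [tm]; exact (S.R.le_opNorm _).trans (aa (t1 a b) (ai _))
      · refine (mf H aK' y v).trans ?_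
        rw [hyv]; linarith
    linarith
  set w := hk S L K' - y with hwd
  have hw2 : ‖w‖ ≤ E * d := by
    have e1 : w = -(v - hk S L K') - (y - v) := by rw [hwd]; abel
    rw [e1]
    refine (dp _ _).trans ?_
    rw [tm, hyv, hEd]; linarith
  have j1 := pq S L hn H.hη1 H.hθ aK' y w
  rw [hwd, add_sub_cancel, ← hwd, hJ] at j1
  change |Ph S L K' - _ - _| ≤ _ at j1
  have e5 : ⟪y - Nl S L K' y, S.T w⟫ = -⟪tr hμ s ψ - ψ, S.T w⟫ + (pn n)⁻¹ * ⟪y, ψ⟫ := by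
    have e6 : y - Nl S L K' y = -(tr hμ s ψ - ψ) - ψ := by rw [hNy]; abel
    have e7 : ⟪ψ, S.T w⟫ = -((pn n)⁻¹ * ⟪y, ψ⟫) := by
      have e8 : S.T ψ = (pn n)⁻¹ • ψ := by
        rw [eq_inv_smul_iff₀ (by linarith)]; exact S.TN a b
      rw [← S.sym, e8, it, hwd, gk, dn, og H aK', dn ψ y]; ring
    rw [e6, dr, inner_neg_left, e7]; ring
  rw [e5, ← hCJ] at j1
  have k1 : |⟪tr hμ s ψ - ψ, S.T w⟫| ≤ Dn n * N * d * (E * d) :=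
    (cm _ _).trans (ax (t1 a b) ((S.T_le w).trans hw2) (ai _) (by positivity))
  have k2 : CJ * ‖w‖ ^ 2 ≤ CJ * (E * d) ^ 2 := by gcongr
  have k3 : |Ph S L K' - Ph S L K - (pn n)⁻¹ * ⟪y, ψ⟫| ≤ Dn n * N * d * (E * d) + CJ * (E * d) ^ 2 := by
    obtain ⟨x1, x2⟩ := eh.1 j1
    obtain ⟨x3, x4⟩ := eh.1 k1
    rw [eh]; constructor <;> linarith
  have k4 : |pn n * (Ph S L K' - Ph S L K) - ⟪y, ψ⟫| ≤ pn n * (Dn n * N * d * (E * d) + CJ * (E * d) ^ 2) := by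
    have : pn n * (Ph S L K' - Ph S L K) - ⟪y, ψ⟫ = pn n * (Ph S L K' - Ph S L K - (pn n)⁻¹ * ⟪y, ψ⟫) := by
      have : pn n ≠ 0 := by linarith
      field_simp
    rw [this, bh, bm (by linarith)]
    exact aa k3 (by linarith)
  have := ba (pn n * (Ph S L K' - Ph S L K) - ⟪y, ψ⟫) (⟪y, ψ⟫ - (n + 2 : ℝ) / 2 * ⟪EE n (nv (μ^2 - 1) (-s)), ψ⟫)
  rw [sub_add_sub_cancel] at this
  linarith
theorem crit (n : ℕ) : ∃ c0, 0 < c0 ∧ ∀ {θ : ℝ} {S : SP n} {L : NL n θ} {η : ℝ} (H : Sm (θ := θ) S η) {K : ℂ → ℝ} (hK : Adm η K)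
    (hf : ∀ᵐ τ ∂(nu n), |S.T (hk S L K) τ - 1| ≤ L.δ / 2) (h1 : ‖hk S L K - one n‖ ≤ c0)
    {a b : ℝ} (hab : Nl S L K (hk S L K) = hk S L K + EE n (nv a b))
    (hext : (∀ μ s, 0 < μ → Ph S L (fun τ => K (qa μ s τ)) ≤ Ph S L K) ∨ (∀ μ s, 0 < μ → Ph S L K ≤ Ph S L (fun τ => K (qa μ s τ)))),
    a = 0 ∧ b = 0 := by
  obtain ⟨c, hc, hnv⟩ := ll (n := n)
  have hD : 0 ≤ Dn n := (lf n).choose_spec.1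
  refine ⟨1 / (8 * c ^ 2 * (Dn n + 1)), by positivity, fun {θ S L η} H {K} hK hf h1 {a b} hab hext => ?_⟩
  obtain ⟨M, d0, hM, hd0, hest⟩ := sz H hK hf hab
  set N := |a| + |b| with hN
  set ψ := EE n (nv a b) with hψ
  have hp := dh H.hn
  rcases (by positivity : 0 ≤ N).eq_or_lt with h0 | h0
  · exact ⟨abs_eq_zero.1 (by linarith [aq a, aq b]), abs_eq_zero.1 (by linarith [aq a, aq b])⟩
  exfalso
  have hNψ : N ^ 2 ≤ 4 * c ^ 2 * ‖ψ‖ ^ 2 := by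
    have e3 : N ≤ 2 * c * ‖ψ‖ := by linarith [(hnv a b).1, (hnv a b).2]
    calc N ^ 2 ≤ (2 * c * ‖ψ‖) ^ 2 := be h0.le e3 2
      _ = _ := by ring
  set e0 := min (min (1 / (2 * N)) (d0 / N)) (1 / (16 * c ^ 2 * (M + 1))) with he0
  have he0p : 0 < e0 := lt_min (lt_min (by positivity) (by positivity)) (by positivity)
  have i1 : e0 * N ≤ 1/2 := by
    have := (kg _ _).trans (kg _ _) |> (fun h => (h : e0 ≤ 1 / (2 * N)))
    rw [bs (by positivity)] at this; linarith
  have i2 : e0 * N ≤ d0 := by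
    have : e0 ≤ d0 / N := (kg _ _).trans (kf _ _)
    rwa [bs h0] at this
  have i3 : M * e0 ≤ 1 / (16 * c ^ 2) := by
    have : e0 ≤ 1 / (16 * c ^ 2 * (M + 1)) := kf _ _
    rw [bs (by positivity)] at this ⊢
    nlinarith [mul_pos (pow_pos hc 2) he0p]
  have key : ∀ ε : ℝ, |ε| = e0 → ∃ μ s, 0 < μ ∧ |pn n * (Ph S L (fun τ => K (qa μ s τ)) - Ph S L K) - (n + 2 : ℝ) / 2 * ε * ‖ψ‖ ^ 2| <  e0 * ‖ψ‖ ^ 2 := by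
    intro ε hε
    have hm : |ε * a| ≤ 1/2 := by rw [bh, hε]; nlinarith [aq b]
    have hpos : 0 < 1 + ε * a := by linarith [(eh.1 hm).1]
    have hsq : Real.sqrt (1 + ε * a) ^ 2 - 1 = ε * a := by rw [ki hpos.le]; ring
    refine ⟨Real.sqrt (1 + ε * a), -(ε * b), Real.sqrt_pos.2 hpos, ?_⟩
    have := hest (Real.sqrt_pos.2 hpos) (-(ε * b)) (d := e0 * N) (by
      rw [hsq, abs_neg, bh, bh, hε, hN]; linarith) i2
    rw [hsq, neg_neg] at this
    have e1 : EE n (nv (ε * a) (ε * b)) = ε • ψ := by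
      rw [hψ, ← map_smul]; congr 1; simp only [nv, smul_add, mul_smul]
    rw [e1, it, bp, ← bc] at this
    refine this.trans_lt ?_
    have b1 : ‖hk S L K - one n‖ * (Dn n * N * (e0 * N)) ≤ 1 / (8 * c ^ 2) * (N ^ 2 * e0) := by
      have : ‖hk S L K - one n‖ * Dn n ≤ 1 / (8 * c ^ 2) := by
        rw [bs (by positivity)] at h1 ⊢
        nlinarith [ai (hk S L K - one n), nw (ai (hk S L K - one n)) (pow_pos hc 2).le]
      calc _ = (‖hk S L K - one n‖ * Dn n) * (N ^ 2 * e0) := by ring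
        _ ≤ _ := by gcongr
    have b2 : M * (e0 * N) ^ 2 ≤ 1 / (16 * c ^ 2) * (N ^ 2 * e0) := by
      calc _ = (M * e0) * (N ^ 2 * e0) := by ring
        _ ≤ _ := by gcongr
    have b3 : N ^ 2 * e0 ≤ 4 * c ^ 2 * ‖ψ‖ ^ 2 * e0 := by gcongr
    have b4 : (1 / (8 * c ^ 2) + 1 / (16 * c ^ 2)) * (N ^ 2 * e0) ≤ (1 / (8 * c ^ 2) + 1 / (16 * c ^ 2)) * (4 * c ^ 2 * ‖ψ‖ ^ 2 * e0) := by gcongr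
    have b5 : (1 / (8 * c ^ 2) + 1 / (16 * c ^ 2)) * (4 * c ^ 2 * ‖ψ‖ ^ 2 * e0) = 3/4 * (e0 * ‖ψ‖ ^ 2) := by field_simp; ring
    have b6 : 0 < ‖ψ‖ ^ 2 := by nlinarith [pow_pos h0 2, pow_pos hc 2]
    have b7 : 0 < e0 * ‖ψ‖ ^ 2 := by positivity
    linarith
  have n0 : (0:ℝ) ≤ n := by positivity
  have q0 : 0 ≤ e0 * ‖ψ‖ ^ 2 := by positivity
  have q1 : 0 ≤ n * (e0 * ‖ψ‖ ^ 2) := by positivity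
  rcases hext with hx | hx
  · obtain ⟨μ, s, hμ, hh⟩ := key e0 (bm he0p)
    have g := aa (hx μ s hμ) (by linarith : 0 ≤ pn n)
    have := (abs_lt.1 hh).1
    nlinarith
  · obtain ⟨μ, s, hμ, hh⟩ := key (-e0) (by rw [abs_neg, bm he0p])
    have g := aa (hx μ s hμ) (by linarith : 0 ≤ pn n)
    have := (abs_lt.1 hh).2
    nlinarith
end HW
namespace HW
open scoped ComplexConjugate RealInnerProductSpace ENNReal
variable {n : ℕ}
theorem pf {θ : ℝ} {S : SP n} {L : NL n θ} {η : ℝ} (H : Sm (θ := θ) S η) {ι : Type*} {l : Filter ι} [l.IsCountablyGenerated]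
    {Kf : ι → ℂ → ℝ} {K : ℂ → ℝ} (hf : ∀ i, Adm η (Kf i)) (hK : Adm η K) (ht : ∀ τ : ℂ, 0 ≤ τ.re → Tendsto (fun i => Kf i τ) l (𝓝 (K τ))) :
    Tendsto (fun i => Ph S L (Kf i)) l (𝓝 (Ph S L K)) := by
  have hn := H.hn
  have ht' : ∀ᵐ τ ∂(nu n), Tendsto (fun i => Kf i τ) l (𝓝 (K τ)) := by
    filter_upwards [di (n := n)] with τ h using ht τ h
  set h := hk S L K with hh
  have a1 : Adm η (fun _ => (1:ℝ)) := ⟨dd, fun τ => by simpa using H.hη.le⟩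
  set g := Nl S L (fun _ => (1:ℝ)) h with hg
  have i2 := (bj (gg g)).1 (jw g)
  have hD2 : Tendsto (fun i => ‖Nl S L (Kf i) h - Nl S L K h‖ ^ 2) l (𝓝 0) := by
    have e1 : ∀ i, ‖Nl S L (Kf i) h - Nl S L K h‖ ^ 2 = ∫ τ, ((Kf i τ - K τ) * g τ) ^ 2 ∂(nu n) := fun i => by
      rw [← bp, du]
      refine al ?_
      filter_upwards [cp S L hn (hf i) h, cp S L hn hK h, cp S L hn a1 h, bb (Nl S L (Kf i) h) (Nl S L K h)] with τ e1 e2 e3 e4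
      rw [e4, ay, e1, e2, e3]; ring
    have e2 : (0:ℝ) = ∫ τ : ℂ, (0:ℝ) ∂(nu n) := by simp
    simp_rw [e1]; rw [e2]
    refine mt (fun τ => (2 * η) ^ 2 * g τ ^ 2) (ab fun i => ?_) (ab fun i => ab fun τ => ?_) (i2.const_mul _) ?_
    · exact ((((hf i).meas.sub hK.meas).mul (cc g)).pow_const 2).aestronglyMeasurable
    · rw [af, gl (ed _), ci]
      refine ag ?_ (ed _)
      rw [← sq_abs]
      refine be (aq _) ?_ 2
      have := abs_sub (Kf i τ - 1) (K τ - 1)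
      rw [sub_sub_sub_cancel_right] at this
      linarith [(hf i).bd τ, hK.bd τ]
    · filter_upwards [ht'] with τ e
      have := (((e.sub_const (K τ)).mul_const (g τ)).pow 2)
      simpa using this
  have hD : Tendsto (fun i => ‖Nl S L (Kf i) h - Nl S L K h‖) l (𝓝 0) := by
    have := hD2.sqrt
    simpa [Real.sqrt_sq] using this
  have hv : Tendsto (fun i => ‖hk S L (Kf i) - h‖) l (𝓝 0) := by
    have := hD.const_mul (2 * ‖S.R‖)
    rw [mul_zero] at this
    refine squeeze_zero (fun i => ai _) (fun i => ?_) this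
    have h1 := ma (L := L) H (hf i) h
    have h2 : h - Ps S L (Kf i) h = - S.R (Nl S L (Kf i) h - Nl S L K h) := by
      have : Ps S L K h = h := jk H hK
      conv_lhs => rw [← this, this]
      conv_lhs => enter [1]; rw [← this]
      rw [Ps, Ps, ← map_sub, ← map_neg]; congr 1; abel
    rw [h2, tm, qh] at h1
    have := S.R.le_opNorm (Nl S L (Kf i) h - Nl S L K h)
    linarith
  have hJ : Tendsto (fun i => JJ S L (Kf i) h) l (𝓝 (JJ S L K h)) := by
    unfold JJ
    refine Tendsto.const_sub _ ?_
    refine mt (fun τ => (1 + η) * ‖L.G (S.T h τ)‖) (ab fun i => (iq L (hf i) _).1) (ab fun i => ab fun τ => ?_) ((pt L _).norm.const_mul _) ?_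
    · rw [am]; exact ag ((hf i).le τ) (ai _)
    · filter_upwards [ht'] with τ e using e.mul_const _
  have hR : Tendsto (fun i => Ph S L (Kf i) - JJ S L (Kf i) h) l (𝓝 0) := by
    have : Tendsto (fun i => (‖h - Nl S L K h‖ + ‖Nl S L (Kf i) h - Nl S L K h‖) * ‖hk S L (Kf i) - h‖ + (1/2 + 2 * (pn n + θ)) * ‖hk S L (Kf i) - h‖ ^ 2) l (𝓝 ((‖h - Nl S L K h‖ + 0) * 0 + (1/2 + 2 * (pn n + θ)) * 0 ^ 2)) :=
      (((hD.const_add _).mul hv).add ((hv.pow 2).const_mul _))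
    rw [show (‖h - Nl S L K h‖ + 0) * 0 + (1/2 + 2 * (pn n + θ)) * 0 ^ 2 = 0 by ring] at this
    refine squeeze_zero_norm (fun i => ?_) this
    have j := pq S L hn H.hη1 H.hθ (hf i) h (hk S L (Kf i) - h)
    rw [add_sub_cancel] at j
    have q := cm (h - Nl S L (Kf i) h) (S.T (hk S L (Kf i) - h))
    have q2 : ‖h - Nl S L (Kf i) h‖ * ‖S.T (hk S L (Kf i) - h)‖ ≤ (‖h - Nl S L K h‖ + ‖Nl S L (Kf i) h - Nl S L K h‖) * ‖hk S L (Kf i) - h‖ := by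
      refine ax ?_ (S.T_le _) (ai _) (by positivity)
      have := dp (h - Nl S L K h) (Nl S L (Kf i) h - Nl S L K h)
      rwa [sub_sub_sub_cancel_right] at this
    have q3 := tq (Ph S L (Kf i) - JJ S L (Kf i) h) ⟪h - Nl S L (Kf i) h, S.T (hk S L (Kf i) - h)⟫
    rw [af]
    change |Ph S L (Kf i) - _ - _| ≤ _ at j
    linarith
  have := hR.add hJ
  simp only [sub_add_cancel, zero_add] at this
  exact this
lemma rs (τ : ℂ) : Continuous (fun g : ℝ × ℝ => qa (Real.exp g.1) g.2 τ) := by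
  unfold qa; fun_prop
lemma qre (μ s : ℝ) (τ : ℂ) : (qa μ s τ).re = μ ^ 2 * τ.re := by simp [qa, ← Complex.ofReal_pow]
lemma sb {K : ℂ → ℝ} {c : ℝ} (hc : Continuous K) (hl : Tendsto K (cocompact ℂ) (𝓝 c)) (ha : ∀ τ : ℂ, τ.re ≤ 0 → K τ = c) (τ : ℂ) (hτ : 0 ≤ τ.re) :
    Tendsto (fun g : ℝ × ℝ => K (qa (Real.exp g.1) g.2 τ)) (cocompact (ℝ × ℝ)) (𝓝 c) := by
  rcases hτ.eq_or_lt with h0 | h0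
  · refine ty.congr fun g => (ha _ ?_).symm
    rw [qre, ← h0]; simp
  rw [Metric.tendsto_nhds] at hl ⊢
  intro δ hδ
  obtain ⟨B, hB, hB2⟩ := mem_cocompact.1 (hl δ hδ)
  set B' := B ∩ {z | δ ≤ dist (K z) c} with hB'
  have cB : IsCompact B' := hB.inter_right (isClosed_le br (by fun_prop))
  have pos : ∀ z ∈ B', 0 < z.re := fun z hz => by
    by_contra hcon
    have := hz.2
    simp only [Set.mem_setOf_eq, ha z (not_lt.1 hcon), dist_self] at this
    linarith
  have cI : IsCompact ((fun z : ℂ => ((Real.log (z.re / τ.re) / 2, z.re / τ.re * τ.im - z.im) : ℝ × ℝ)) '' B') := by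
    refine cB.image_of_continuousOn ?_
    refine ContinuousOn.prodMk ?_ (by fun_prop)
    refine ContinuousOn.div_const ?_ _
    refine ContinuousOn.log (by fun_prop) fun z hz => ?_
    have := pos z hz
    positivity
  refine mem_cocompact.2 ⟨_, cI, fun g hg => ?_⟩
  by_contra hcon
  have hcon : δ ≤ dist (K (qa (Real.exp g.1) g.2 τ)) c := not_lt.1 hcon
  refine hg ⟨qa (Real.exp g.1) g.2 τ, ⟨?_, hcon⟩, ?_⟩
  · by_contra hz
    have := hB2 hz
    exact absurd this (not_lt.2 hcon)
  · have e1 : (qa (Real.exp g.1) g.2 τ).re / τ.re = Real.exp g.1 ^ 2 := by rw [qre]; field_simp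
    have e2 : (qa (Real.exp g.1) g.2 τ).im = Real.exp g.1 ^ 2 * τ.im - g.2 := by simp [qa, ← Complex.ofReal_pow]
    ext
    · simp only [e1, Real.log_pow, Real.log_exp]; push_cast; ring
    · simp only [e1, e2]; ring
theorem exsol (hn : 1 ≤ n) : ∃ η, 0 < η ∧ ∃ S : SP n, ∀ {K : ℂ → ℝ} {c : ℝ}, Continuous K → Adm η K → Tendsto K (cocompact ℂ) (𝓝 c) → (∀ τ : ℂ, τ.re ≤ 0 → K τ = c) →
    ∃ h : HH n, ∃ C, ∀ᵐ τ ∂(nu n), 0 < S.T h τ ∧ S.T h τ ≤ C ∧ h τ = K τ * (S.T h τ) ^ pn n := by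
  obtain ⟨S⟩ := exSP hn
  have hp := dh hn
  set θ : ℝ := 1 / (4 * (‖S.R‖ + 1)) with hθ
  have hθp : 0 < θ := by positivity
  obtain ⟨L⟩ := exNL hn hθp
  obtain ⟨C, hC, hsup⟩ := sh S hθp.le hn
  obtain ⟨c0, hc0, hcrit⟩ := crit n
  have lδ := L.hδ
  obtain ⟨η, hη0, hη1, hη2, hη3, hη4⟩ : ∃ η : ℝ, 0 < η ∧ η ≤ 1 ∧ ‖S.R‖ * (pn n + θ) * η ≤ 1/4 ∧ C * η ≤ L.δ / 2 ∧ 2 * ‖S.R‖ * ‖one n‖ * η ≤ c0 := by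
    have aux : ∀ A b : ℝ, 0 < b → ∀ᶠ η : ℝ in 𝓝[>] 0, A * η ≤ b := fun A b hb => by
      have : Tendsto (fun η : ℝ => A * η) (𝓝[>] 0) (𝓝 (A * 0)) := ((br.mul continuous_id).tendsto 0).mono_left nhdsWithin_le_nhds
      rw [mul_zero] at this
      exact (this.eventually (eventually_le_nhds hb))
    obtain ⟨η, h1, h2, h3, h4, h5⟩ := ((self_mem_nhdsWithin : Set.Ioi (0:ℝ) ∈ 𝓝[>] 0) |> fun h => (Filter.eventually_mem_set.2 h).and ((aux 1 1 one_pos).and ((aux _ _ (by norm_num : (0:ℝ) < 1/4)).and ((aux _ _ (half_pos lδ)).and (aux _ _ hc0))))).exists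
    exact ⟨η, h1, by linarith, h3, h4, h5⟩
  have H : Sm (θ := θ) S η := ⟨hn, hη0, hη1, hθp.le, by
    have : ‖S.R‖ * θ ≤ 1/4 := by
      rw [hθ, mul_one_div, dx (by positivity)]; linarith
    linarith⟩
  refine ⟨η, hη0, S, fun {K c} hc hK hl ha => ?_⟩
  set Φ : ℝ × ℝ → ℝ := fun g => Ph S L (fun τ => K (qa (Real.exp g.1) g.2 τ)) with hΦ
  have cΦ : Continuous Φ := qf.2 fun g => pf H (fun i => hK.comp _ _) (hK.comp _ _) fun τ _ => (hc.comp (rs τ)).continuousAt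
  have hcb : |c - 1| ≤ η := by have := hK.bd 0; rwa [ha 0 (by simp)] at this
  have : (cocompact (ℝ × ℝ)).IsCountablyGenerated := by
    rw [← Metric.cobounded_eq_cocompact, ← comap_norm_atTop]; infer_instance
  have lΦ : Tendsto Φ (cocompact (ℝ × ℝ)) (𝓝 (Ph S L (fun _ => c))) := pf H (fun i => hK.comp _ _) ⟨dd, fun _ => hcb⟩ fun τ hτ => sb hc hl ha τ hτ
  obtain ⟨g, hg⟩ : ∃ g, (∀ g', Φ g' ≤ Φ g) ∨ (∀ g', Φ g ≤ Φ g') := by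
    by_cases h1 : ∃ g, Ph S L (fun _ => c) < Φ g
    · obtain ⟨g, h1⟩ := h1
      obtain ⟨g, hg⟩ := cΦ.exists_forall_ge' g (lΦ.eventually (eventually_le_nhds h1))
      exact ⟨g, Or.inl hg⟩
    by_cases h2 : ∃ g, Φ g < Ph S L (fun _ => c)
    · obtain ⟨g, h2⟩ := h2
      obtain ⟨g, hg⟩ := cΦ.exists_forall_le' g (lΦ.eventually (eventually_ge_nhds h2))
      exact ⟨g, Or.inr hg⟩
    simp only [not_exists, not_lt] at h1 h2
    exact ⟨0, Or.inl fun g' => (h1 g').trans (h2 0)⟩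
  set m := Real.exp g.1 with hm
  have hm0 : 0 < m := Real.exp_pos _
  set Kg := fun τ => K (qa m g.2 τ) with hKg
  have aKg : Adm η Kg := hK.comp _ _
  have hcomp : ∀ μ s, 0 < μ → Ph S L (fun τ => Kg (qa μ s τ)) = Φ (Real.log (m * μ), m ^ 2 * s + g.2) := fun μ s hμ => by
    simp only [hΦ, hKg, nr, Real.exp_log (mul_pos hm0 hμ)]
  obtain ⟨a, b, hab, -, -, hT, -⟩ := hsup L η H Kg aKg
  have hT' : ∀ᵐ τ ∂(nu n), |S.T (hk S L Kg) τ - 1| ≤ L.δ / 2 := hT.mono fun τ h => h.trans hη3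
  obtain ⟨rfl, rfl⟩ := hcrit H aKg hT' ((oh H aKg).trans hη4) hab (by
    rcases hg with hg | hg
    · exact Or.inl fun μ s hμ => by rw [hcomp μ s hμ]; exact hg _
    · exact Or.inr fun μ s hμ => by rw [hcomp μ s hμ]; exact hg _)
  set h := hk S L Kg with hh
  have e0 : Nl S L Kg h = h := by rw [hab]; simp [nv]
  have e1 : ∀ᵐ τ ∂(nu n), 1/2 ≤ S.T h τ ∧ S.T h τ ≤ 2 ∧ h τ = Kg τ * S.T h τ ^ pn n := by
    have := cp S L hn aKg h
    rw [e0] at this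
    filter_upwards [this, hT'] with τ e1 e2
    have := L.hδ2
    have e3 := eh.1 e2
    exact ⟨by linarith, by linarith, by rw [e1, L.F_eq _ (by linarith)]⟩
  have hmi := ii.2 hm0
  obtain ⟨C', hC'⟩ : ∃ C', ∀ τ : ℂ, 0 ≤ τ.re → rq m⁻¹ (-g.2 / m ^ 2) τ ≤ C' := (lj hmi _).imp fun _ h => h.2
  refine ⟨tr hmi (-g.2 / m ^ 2) h, 2 * C' ^ n, ?_⟩
  filter_upwards [(fo hmi (-g.2 / m ^ 2)).ae e1, jv S hn hmi (-g.2 / m ^ 2) h, dg hmi (-g.2 / m ^ 2) h, di (n := n)] with τ f1 f2 f3 f4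
  obtain ⟨x1, x2, x3⟩ := f1
  have hr := hj hmi (-g.2 / m ^ 2) f4
  have hf0 : 0 < S.T h (qa m⁻¹ (-g.2 / m ^ 2) τ) := by linarith
  refine ⟨by rw [f2]; positivity, ?_, ?_⟩
  · rw [f2]
    exact ax x2 (be hr.le (hC' τ f4) n) (by positivity) (by norm_num)
  · rw [f2, f3, trf, x3, hKg, jd hn hf0 hr]
    simp only [lk hm0]; ring
end HW
namespace HW
open scoped ComplexConjugate RealInnerProductSpace ENNReal
variable {n : ℕ}
lemma fi {F G : Pt n → ℂ} (hF : Measurable F) (hG : Measurable G) {C D a b : ℝ} (h1 : ∀ p, ‖F p‖ ≤ C * wt p ^ (-a)) (h2 : ∀ p, ‖G p‖ ≤ D * wt p ^ (-b))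
    (h : (n:ℝ) + 1 < a + b) : Integrable (fun p => F p * G p) := by
  refine bn (C := C * D) h (hF.mul hG).aestronglyMeasurable fun p => ?_
  have := ad p
  rw [am, show -(a + b) = -a + -b by ring, ce this]
  calc _ ≤ (C * wt p ^ (-a)) * (D * wt p ^ (-b)) := ax (h1 p) (h2 p) (ai _) ((ai _).trans (h1 p))
    _ = _ := by ring
structure SolP (V W : Pt n → ℂ) : Prop where
  dec : Dec n V
  meas : Measurable W
  bd : ∃ C, ∀ p, ‖W p‖ ≤ C * wt p ^ (-(n + 2 : ℝ))
  eq : ∀ {s : ℝ} {F : Pt n → ℂ}, Dec s F → 1/2 < s → ∫ p, ∑ j, (XC j F p * XC j V p + YC j F p * YC j V p) = ∫ p, F p * W p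
lemma Dec.int_grad {s r : ℝ} {F V : Pt n → ℂ} (hF : Dec s F) (hV : Dec r V) (hs : (n:ℝ) < s + r) : Integrable (fun p => ∑ j, (XC j F p * XC j V p + YC j F p * YC j V p)) := by
  obtain ⟨C, _, _, h1⟩ := hF.bd
  obtain ⟨D, _, _, h2⟩ := hV.bd
  refine integrable_finsetSum _ fun j _ => Integrable.add ?_ ?_
  · exact fi (fd F j) (fd V j) (a := s + 1/2) (b := r + 1/2) (fun p => by rw [eo]; exact (h1 j p).1) (fun p => by rw [eo]; exact (h2 j p).1) (by linarith)
  · exact fi (fc F j) (fc V j) (a := s + 1/2) (b := r + 1/2) (fun p => by rw [eo]; exact (h1 j p).2) (fun p => by rw [eo]; exact (h2 j p).2) (by linarith)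
lemma SolP.comb {V W V' W' : Pt n → ℂ} (h : SolP V W) (h' : SolP V' W') (c c' : ℂ) :
    SolP (fun p => c * V p + c' * V' p) (fun p => c * W p + c' * W' p) := by
  obtain ⟨C, hC⟩ := h.bd
  obtain ⟨C', hC'⟩ := h'.bd
  refine ⟨(h.dec.smul c).add (h'.dec.smul c'), (h.meas.const_mul c).add (h'.meas.const_mul c'), ⟨‖c‖ * C + ‖c'‖ * C', fun p => ?_⟩, fun {s F} hF hs => ?_⟩
  · refine (bu _ _).trans ?_
    rw [am, am]
    have := aa (hC p) (ai c)
    have := aa (hC' p) (ai c')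
    linarith
  obtain ⟨A, _, hA, _⟩ := hF.bd
  have i1 : Integrable (fun p => F p * W p) := fi hF.diff.continuous.measurable h.meas hA hC (by linarith)
  have i2 : Integrable (fun p => F p * W' p) := fi hF.diff.continuous.measurable h'.meas hA hC' (by linarith)
  have e1 : (fun p => F p * (c * W p + c' * W' p)) = fun p => c * (F p * W p) + c' * (F p * W' p) := by ext p; ring
  have e2 : (fun p => ∑ j, (XC j F p * XC j (fun p => c * V p + c' * V' p) p + YC j F p * YC j (fun p => c * V p + c' * V' p) p)) =
      fun p => c * ∑ j, (XC j F p * XC j V p + YC j F p * YC j V p) + c' * ∑ j, (XC j F p * XC j V' p + YC j F p * YC j V' p) := by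
    ext p
    rw [ap, ap, ← ao]
    refine cr rfl fun j _ => ?_
    rw [oy (h.dec.smul c).diff (h'.dec.smul c').diff, ox (h.dec.smul c).diff (h'.dec.smul c').diff, jr h.dec.diff, jr h'.dec.diff, jp h.dec.diff, jp h'.dec.diff]
    ring
  rw [e1, e2, ep ((hF.int_grad h.dec (by linarith)).const_mul c) ((hF.int_grad h'.dec (by linarith)).const_mul c'), ep (i1.const_mul c) (i2.const_mul c'),
    ah, ah, ah, ah, h.eq hF hs, h'.eq hF hs]
lemma lb (p : Pt n) (k : ℕ) : wt p ^ (-(k:ℝ)) = (wt p ^ k)⁻¹ := by rw [Real.rpow_neg (ad p).le, gd]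
lemma SolP.mon (hn : 1 ≤ n) (a b : ℕ) : SolP (n := n) (fun p => (((wt p ^ n)⁻¹ : ℝ) : ℂ) * mon a b (BB p)) (fun p => (4 * n^2) * ((((wt p ^ (n+2))⁻¹ : ℝ) : ℂ) * Lmon n a b (BB p))) := by
  have e0 : (fun p : Pt n => (((wt p ^ n)⁻¹ : ℝ) : ℂ) * HW.mon a b (BB p)) = VV 0 1 (n/2 + a) (n/2 + b) := by ext p; rw [VVB]; rfl
  have mL : Measurable (Lmon n a b) := by
    unfold Lmon HW.mon
    have := Complex.continuous_conj.measurable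
    fun_prop
  have mw : Measurable (fun p : Pt n => (((wt p ^ (n+2))⁻¹ : ℝ) : ℂ)) := Complex.measurable_ofReal.comp ((bo.measurable.pow_const _).inv)
  have hd : Dec (n + (a + b)) (VV (n := n) 0 1 (n/2 + a) (n/2 + b)) := ff iv (by ring) (by positivity)
  rw [e0]
  refine ⟨hd.mono (by linarith [(by positivity : (0:ℝ) ≤ (a:ℝ) + b)]), (mw.mul (mL.comp (cj.comp mtau))).const_mul _, ⟨4 * n^2 * (|l0 n a b| + |l1 n a b| + |l1 n b a|), fun p => ?_⟩, fun {s F} hF hs => ?_⟩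
  · have := ad p
    have h3 := lb p (n + 2)
    push_cast at h3
    have e : ‖((4 * (n:ℂ)^2))‖ = 4 * n^2 := by simp
    rw [h3, am, e, am, aj, ac (by positivity)]
    have h4 := mh (n := n) a b _ (jz p)
    have h5 : 0 ≤ (wt p ^ (n + 2))⁻¹ := by positivity
    calc _ = 4 * (n:ℝ)^2 * (wt p ^ (n + 2))⁻¹ * ‖Lmon n a b (BB p)‖ := by ring
      _ ≤ 4 * (n:ℝ)^2 * (wt p ^ (n + 2))⁻¹ * (|l0 n a b| + |l1 n a b| + |l1 n b a|) := by gcongr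
      _ = _ := by ring
  · have h := lx (iv (n := n)) (α := n/2 + a) (β := n/2 + b) hF (by positivity) (by linarith [(by positivity : (0:ℝ) ≤ (a:ℝ) + b)])
    rw [← neg_eq_iff_eq_neg, ← integral_neg] at h
    rw [← h]
    refine al (ab fun p => ?_)
    simp only [mi hn]; ring
lemma so (m : ℕ) (τ : ℂ) : ef (Lv n m) τ = pr (m % 2) (Lmon n (m / 2).unpair.1 (m / 2).unpair.2 (B1 τ)) := by
  have hix : ∀ a b τ, bf (ix a b (m % 2)) τ = pr (m % 2) (mon a b (B1 τ)) := fun a b τ => by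
    have hm : m % 2 < 2 := Nat.mod_lt _ (by norm_num)
    have e1 : ix a b (m % 2) / 2 = Nat.pair a b := by unfold ix; omega
    have e2 : ix a b (m % 2) % 2 = m % 2 := by unfold ix; omega
    rw [bf, e1, e2, gn]
  rw [Lv, map_sub, map_sub, map_smul, map_smul, map_smul, cd, cd, cd]
  simp only [ay, cq, hix]
  simp only [bf, lv, pr, Lmon]
  split_ifs <;> simp
lemma ru (e : ℕ) : ∃ c c' : ℂ, ∀ z, (pr e z : ℂ) = c * z + c' * conj z := by
  by_cases h : e = 0
  · exact ⟨1/2, 1/2, fun z => by rw [pr, if_pos h, Complex.re_eq_add_conj]; ring⟩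
  · exact ⟨1/(2 * Complex.I), -(1/(2 * Complex.I)), fun z => by rw [pr, if_neg h, Complex.im_eq_sub_conj]; ring⟩
lemma nx (a b : ℕ) (B : ℂ) : conj (mon a b B) = mon b a B := by simp [mon, bk]
lemma ta (a b : ℕ) (B : ℂ) : conj (Lmon n a b B) = Lmon n b a B := by
  simp only [Lmon, map_sub, map_mul, ug, nx]
  have : l0 n a b = l0 n b a := by unfold l0; ring
  rw [this]; ring
def vv (n : ℕ) (y : FV) (p : Pt n) : ℝ := (wt p ^ n)⁻¹ * ef y (tau p)
def ww (n : ℕ) (y : FV) (p : Pt n) : ℝ := 4 * n^2 * ((wt p ^ (n+2))⁻¹ * ef (Lc n y) (tau p))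
theorem SolP.vv (hn : 1 ≤ n) (y : FV) : SolP (n := n) (fun p => (vv n y p : ℂ)) (fun p => (ww n y p : ℂ)) := by
  have key : ∀ m, SolP (n := n) (fun p => (HW.vv n (ev m) p : ℂ)) (fun p => (ww n (ev m) p : ℂ)) := fun m => by
    obtain ⟨c, c', h⟩ := ru (m % 2)
    have := (SolP.mon hn (m / 2).unpair.1 (m / 2).unpair.2).comb (SolP.mon hn (m / 2).unpair.2 (m / 2).unpair.1) c c'
    convert this using 2 with p p
    · rw [HW.vv, cd, bf, gx]; push_cast; rw [h, nx]; ring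
    · rw [ww, ip, so, gx]; push_cast; rw [h, ta]; ring
  induction y using ek with
  | zero =>
    convert (key 0).comb (key 0) 0 0 using 2 with p p
    · simp [HW.vv]
    · simp [ww]
  | add f g hf hg =>
    convert hf.comb hg 1 1 using 2 with p p
    · simp [HW.vv, je]
    · simp [ww, je]
  | single m r =>
    have h1 : Finsupp.single m r = r • ev m := by simp [ev]
    rw [h1]
    convert (key m).comb (key m) r 0 using 2 with p p
    · simp [HW.vv]; ring
    · simp [ww]; ring
lemma js {f : Pt n → ℝ} {p : Pt n} (hf : DifferentiableAt ℝ f p) (j : Fin n) : XC j (fun p => (f p : ℂ)) p = (Xd n j f p : ℂ) ∧ YC j (fun p => (f p : ℂ)) p = (Yd n j f p : ℂ) := by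
  have h : fderiv ℝ (fun p => (f p : ℂ)) p = Complex.ofRealCLM.comp (fderiv ℝ f p) := (Complex.ofRealCLM.hasFDerivAt.comp p hf.hasFDerivAt).fderiv
  simp [XC, YC, h, Xv, Yv, Xd, Yd]
lemma sr {f : Pt n → ℝ} (h : Differentiable ℝ (fun p => (f p : ℂ))) : Differentiable ℝ f := by
  have := Complex.reCLM.differentiable.comp h
  exact this
structure DecR (s : ℝ) (f : Pt n → ℝ) : Prop where
  dec : Dec s (fun p => (f p : ℂ))
lemma DecR.diff {s : ℝ} {f : Pt n → ℝ} (h : DecR s f) : Differentiable ℝ f := sr h.dec.diff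
lemma DecR.X {s : ℝ} {f : Pt n → ℝ} (h : DecR s f) (j : Fin n) (p : Pt n) : XC j (fun p => (f p : ℂ)) p = (Xd n j f p : ℂ) := (js (h.diff p) j).1
lemma DecR.Y {s : ℝ} {f : Pt n → ℝ} (h : DecR s f) (j : Fin n) (p : Pt n) : YC j (fun p => (f p : ℂ)) p = (Yd n j f p : ℂ) := (js (h.diff p) j).2
lemma vvR (hn : 1 ≤ n) (y : FV) : DecR n (vv n y) := ⟨(SolP.vv hn y).dec⟩
lemma rsol (hn : 1 ≤ n) (y : FV) {s : ℝ} {φ : Pt n → ℝ} (h : DecR s φ) (hs : 1/2 < s) :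
    ∫ p, ∑ j, (Xd n j φ p * Xd n j (vv n y) p + Yd n j φ p * Yd n j (vv n y) p) = ∫ p, φ p * ww n y p := by
  have := (SolP.vv hn y).eq h.dec hs
  simp only [h.X, h.Y, (vvR hn y).X, (vvR hn y).Y, ← dz, ← Complex.ofReal_add, ← Complex.ofReal_sum] at this
  rw [bi, bi] at this
  exact_mod_cast this
lemma ribp {s r : ℝ} {f g : Pt n → ℝ} (hf : DecR s f) (hg : DecR r g) (h : (n:ℝ) + 1 < s + r) (j : Fin n) :
    (∫ p, f p * Xd n j g p = - ∫ p, Xd n j f p * g p) ∧ ∫ p, f p * Yd n j g p = - ∫ p, Yd n j f p * g p := by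
  have h1 := ibpX hf.dec hg.dec h j
  have h2 := ibpY hf.dec hg.dec h j
  simp only [hf.X, hf.Y, hg.X, hg.Y, ← dz] at h1 h2
  rw [bi, bi] at h1 h2
  exact ⟨by exact_mod_cast h1, by exact_mod_cast h2⟩
lemma DecR.bd {s : ℝ} {f : Pt n → ℝ} (h : DecR s f) : ∃ C : ℝ, 0 ≤ C ∧ (∀ p, |f p| ≤ C * wt p ^ (-s)) ∧
    ∀ j p, |Xd n j f p| ≤ C * wt p ^ (-s - 1/2) ∧ |Yd n j f p| ≤ C * wt p ^ (-s - 1/2) := by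
  obtain ⟨C, h0, h1, h2⟩ := h.dec.bd
  refine ⟨C, h0, fun p => by simpa using h1 p, fun j p => ?_⟩
  have := h2 j p
  rw [h.X, h.Y] at this
  simpa using this
lemma DecR.meas {s : ℝ} {f : Pt n → ℝ} (h : DecR s f) (j : Fin n) : Measurable (Xd n j f) ∧ Measurable (Yd n j f) := by
  have h1 := iu.comp (fd (fun p => (f p : ℂ)) j)
  have h2 := iu.comp (fc (fun p => (f p : ℂ)) j)
  simp only [cg, h.X, h.Y, ue] at h1 h2
  exact ⟨h1, h2⟩
lemma lr {f : Pt n → ℝ} (hm : Measurable f) {C a : ℝ} (ha : (n:ℝ) + 1 < 2 * a) (h : ∀ p, |f p| ≤ C * wt p ^ (-a)) : MemLp f 2 volume := by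
  rw [bj hm.aestronglyMeasurable]
  refine ((fh ha).const_mul (C ^ 2)).mono' (hm.pow_const 2).aestronglyMeasurable (ab fun p => ?_)
  have := ad p
  rw [ac (ed _), ← sq_abs]
  refine (be (aq _) (h p) 2).trans (kh ?_)
  rw [ci, ← gd (wt p ^ (-a)) 2, ← qn this.le]; congr 2; push_cast; ring
lemma DecR.mem {s : ℝ} {f : Pt n → ℝ} (h : DecR s f) (hs : (n:ℝ) < 2 * s) (j : Fin n) : MemLp (Xd n j f) 2 volume ∧ MemLp (Yd n j f) 2 volume := by
  obtain ⟨C, -, -, h2⟩ := h.bd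
  exact ⟨lr (h.meas j).1 (a := s + 1/2) (C := C) (by linarith) (fun p => by rw [eo]; exact (h2 j p).1), lr (h.meas j).2 (a := s + 1/2) (C := C) (by linarith) (fun p => by rw [eo]; exact (h2 j p).2)⟩
lemma ri {φ : Pt n → ℝ} (h : TestFun n φ) (s : ℝ) : DecR s φ := by
  obtain ⟨h1, h2⟩ := h
  have hd : Differentiable ℝ φ := h1.differentiable (by simp)
  have hc : Continuous (fderiv ℝ φ) := h1.continuous_fderiv (by simp)
  have key : ∀ g : Pt n → ℝ, Continuous g → HasCompactSupport g → ∀ r : ℝ, ∃ C, 0 ≤ C ∧ ∀ p, |g p| ≤ C * wt p ^ (-r) := fun g hg hs r => by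
    have hcont : Continuous (fun p => g p * wt p ^ r) := hg.mul (bo.rpow_const fun p => Or.inl (ad p).ne')
    obtain ⟨C, hC⟩ := hcont.bounded_above_of_compact_support (hs.mul_right (f' := fun p => wt p ^ r))
    refine ⟨C, (ai _).trans (hC 0), fun p => ?_⟩
    have := hC p
    have hw := ad p
    rw [am, af, ac (by positivity)] at this
    rw [Real.rpow_neg hw.le, ← az, bs (by positivity)]; exact this
  have cs : ∀ v, HasCompactSupport (fun p => fderiv ℝ φ p v) := fun v => h2.fderiv_apply ℝ v
  have cX : ∀ j, Continuous (Xd n j φ) ∧ HasCompactSupport (Xd n j φ) ∧ Continuous (Yd n j φ) ∧ HasCompactSupport (Yd n j φ) := fun j => by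
    refine ⟨?_, ?_, ?_, ?_⟩
    · unfold Xd; fun_prop
    · exact (cs _).add ((cs (et n)).mul_left (f := fun p : Pt n => 2 * p.2.1 j))
    · unfold Yd; fun_prop
    · exact (cs _).sub ((cs (et n)).mul_left (f := fun p : Pt n => 2 * p.1 j))
  obtain ⟨C, hC, b1⟩ := key φ h1.continuous h2 s
  choose Cx hCx b2 using fun j => key _ (cX j).1 (cX j).2.1 (s + 1/2)
  choose Cy hCy b3 using fun j => key _ (cX j).2.2.1 (cX j).2.2.2 (s + 1/2)
  have hs1 : ∀ j, Cx j ≤ ∑ j, Cx j := fun j => cz (f := Cx) (fun i _ => hCx i) (ct j)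
  have hs2 : ∀ j, Cy j ≤ ∑ j, Cy j := fun j => cz (f := Cy) (fun i _ => hCy i) (ct j)
  have g1 : 0 ≤ ∑ j, Cx j := Finset.sum_nonneg fun i _ => hCx i
  have g2 : 0 ≤ ∑ j, Cy j := Finset.sum_nonneg fun i _ => hCy i
  refine ⟨⟨Complex.ofRealCLM.differentiable.comp hd, C + ∑ j, Cx j + ∑ j, Cy j, by positivity, fun p => ?_, fun j p => ?_⟩⟩
  · have := ad p
    rw [aj]
    exact (b1 p).trans (ag (by linarith) (by positivity))
  · have := ad p
    rw [(js (hd p) j).1, (js (hd p) j).2, aj, aj, ← eo]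
    exact ⟨(b2 j p).trans (ag (by linarith [hs1 j]) (by positivity)), (b3 j p).trans (ag (by linarith [hs2 j]) (by positivity))⟩
end HW
namespace HW
open scoped ComplexConjugate RealInnerProductSpace ENNReal
variable {n : ℕ}
lemma oc {b : Pt n → ℝ} (hb : Measurable b) {C : ℝ} (hC : ∀ p, |b p| ≤ C) (g : HH n) :
    Integrable (fun p => g (tau p) * b p) (mm n) := by
  have : Integrable (fun p => g (tau p)) (mm n) :=
    ⟨(co g).aestronglyMeasurable, (dm g).trans_lt (ENNReal.mul_lt_top bg io.lt_top)⟩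
  exact this.mul_bdd (c := C) hb.aestronglyMeasurable (ab hC)
lemma ob {b : Pt n → ℝ} (hb : Measurable b) {C : ℝ} (hC : ∀ p, |b p| ≤ C) {g : ℕ → HH n} {g0 : HH n} (h : Tendsto g atTop (𝓝 g0)) :
    Tendsto (fun m => ∫ p, g m (tau p) * b p ∂(mm n)) atTop (𝓝 (∫ p, g0 (tau p) * b p ∂(mm n))) := by
  refine tendsto_integral_of_L1 _ (oc hb hC g0).aestronglyMeasurable (ab fun m => oc hb hC (g m)) ?_
  have h1 : Tendsto (fun m => ENNReal.ofReal C * (ENNReal.ofReal ‖g m - g0‖ * Mn n)) atTop (𝓝 0) := by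
    have h2 : Tendsto (fun m => ENNReal.ofReal ‖g m - g0‖) atTop (𝓝 0) := by
      have := ENNReal.tendsto_ofReal (tendsto_iff_norm_sub_tendsto_zero.1 h)
      simpa using this
    have := ENNReal.Tendsto.const_mul (ENNReal.Tendsto.mul_const h2 (Or.inr (io (n := n)))) (Or.inr (my (r := C)))
    simpa using this
  refine tendsto_of_tendsto_of_tendsto_of_le_of_le ty h1 (fun _ => zero_le) fun m => ?_
  have h3 := dm (g m - g0)
  calc _ ≤ ∫⁻ p, ENNReal.ofReal C * ‖(g m - g0 : HH n) (tau p)‖ₑ ∂(mm n) := by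
        refine gb ?_
        filter_upwards [cn (bb (g m) g0)] with p hp
        rw [hp, ← sub_mul, enorm_mul, bk, ay]
        gcongr
        rw [Real.enorm_eq_ofReal_abs]
        exact de (hC p)
    _ = ENNReal.ofReal C * ∫⁻ p, ‖(g m - g0 : HH n) (tau p)‖ₑ ∂(mm n) := db _ (co _).enorm
    _ ≤ _ := by gcongr
def DD (n : ℕ) (i : Bool) (j : Fin n) (f : Pt n → ℝ) : Pt n → ℝ := if i then Xd n j f else Yd n j f
lemma DDmem {s : ℝ} {f : Pt n → ℝ} (h : DecR s f) (hs : (n:ℝ) < 2 * s) (i : Bool) (j : Fin n) : MemLp (DD n i j f) 2 volume := by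
  cases i
  · exact (h.mem hs j).2
  · exact (h.mem hs j).1
lemma DDsub {s : ℝ} {f g : Pt n → ℝ} (hf : DecR s f) (hg : DecR s g) (i : Bool) (j : Fin n) (p : Pt n) : DD n i j (fun p => f p - g p) p = DD n i j f p - DD n i j g p := by
  have : fderiv ℝ (fun p => f p - g p) p = fderiv ℝ f p - fderiv ℝ g p := fderiv_fun_sub (hf.diff p) (hg.diff p)
  cases i <;> simp [DD, Xd, Yd, this] <;> ring
lemma DDbd {s : ℝ} {f : Pt n → ℝ} (h : DecR s f) (i : Bool) (j : Fin n) : Measurable (DD n i j f) ∧ ∃ C, ∀ p, |DD n i j f p| ≤ C * wt p ^ (-s - 1/2) := by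
  obtain ⟨C, -, -, h2⟩ := h.bd
  cases i
  · exact ⟨(h.meas j).2, C, fun p => (h2 j p).2⟩
  · exact ⟨(h.meas j).1, C, fun p => (h2 j p).1⟩
lemma DDibp {s r : ℝ} {f g : Pt n → ℝ} (hf : DecR s f) (hg : DecR r g) (h : (n:ℝ) + 1 < s + r) (i : Bool) (j : Fin n) :
    ∫ p, f p * DD n i j g p = - ∫ p, DD n i j f p * g p := by
  cases i
  · exact (ribp hf hg h j).2
  · exact (ribp hf hg h j).1
lemma iy (p : Pt n) (a : ℝ) : (wt p ^ (2*n+2))⁻¹ * (a * wt p ^ (n+2)) = (wt p ^ n)⁻¹ * a ∧ (wt p ^ (2*n+2))⁻¹ * (a * wt p ^ n) = (wt p ^ (n+2))⁻¹ * a := by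
  have := ad p
  constructor
  · rw [show 2*n+2 = n + (n+2) by ring, tl]; field_simp
  · rw [show 2*n+2 = n + (n+2) by ring, tl]; field_simp
lemma oo (y : FV) (b : Pt n → ℝ) : ∫ p, EE n y (tau p) * b p ∂(mm n) = ∫ p, ef y (tau p) * b p ∂(mm n) :=
  al (by filter_upwards [cn (dj y)] with p hp; rw [hp])
lemma energy (hn : 1 ≤ n) (S : SP n) (y : FV) (i : Bool) (j : Fin n) : ∫ p, (DD n i j (vv n y) p) ^ 2 ≤ 4 * n^2 * ‖EE n (Lc n y)‖ ^ 2 := by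
  have hn1 : (1:ℝ) ≤ n := by exact_mod_cast hn
  have hv := vvR hn y
  have h := rsol hn y hv (by linarith)
  have e1 : ∫ p, vv n y p * ww n y p = 4 * n^2 * ⟪EE n y, EE n (Lc n y)⟫ := by
    have m1 : AEStronglyMeasurable (fun τ => EE n y τ * EE n (Lc n y) τ) (nu n) := ((cc (EE n y)).mul (cc (EE n (Lc n y)))).aestronglyMeasurable (μ := nu n)
    rw [du, jj m1]
    have : ∫ p, (EE n y) (tau p) * (EE n (Lc n y)) (tau p) ∂(mm n) = ∫ p, ef y (tau p) * ef (Lc n y) (tau p) ∂(mm n) :=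
      al (by filter_upwards [cn (dj y), cn (dj (Lc n y))] with p hp hq; rw [hp, hq])
    rw [this, fu, ← ah]
    congr 1; ext p
    have := ad p
    rw [vv, ww, ak, show 2*n+2 = n + (n+2) by ring, tl (wt p) n (n+2), mul_inv]; ring
  have e2 : ⟪EE n y, EE n (Lc n y)⟫ ≤ ‖EE n (Lc n y)‖ ^ 2 := by
    refine (real_inner_le_norm _ _).trans ?_
    rw [← S.hE y, sq]
    exact ag (S.T_le _) (ai _)
  refine ew ?_ ((h.trans e1).le.trans (aa e2 (by positivity)))
  have iX : ∀ i j, Integrable (fun p => DD n i j (vv n y) p ^ 2) := fun i j => (DDmem hv (by linarith) i j).integrable_sq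
  refine integral_mono (iX i j) ?_ fun p => ?_
  · refine integrable_finsetSum _ fun j _ => ((iX true j).add (iX false j)).congr (ab fun p => ?_)
    simp [DD]; ring
  · refine ew ?_ (cz (f := fun j => Xd n j (vv n y) p * Xd n j (vv n y) p + Yd n j (vv n y) p * Yd n j (vv n y) p) (fun j _ => add_nonneg (qi _) (qi _)) (ct j))
    cases i <;> simp only [DD] <;> simp <;> nlinarith [qi (Xd n j (vv n y) p), qi (Yd n j (vv n y) p)]
lemma gw {f : ℕ → Lp ℝ 2 (volume : Measure (Pt n))} {f0 : Lp ℝ 2 (volume : Measure (Pt n))} (h : Tendsto f atTop (𝓝 f0)) {φ : Pt n → ℝ} (hφ : MemLp φ 2 volume) :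
    Tendsto (fun m => ∫ p, f m p * φ p) atTop (𝓝 (∫ p, f0 p * φ p)) := by
  have e : ∀ g : Lp ℝ 2 (volume : Measure (Pt n)), ∫ p, g p * φ p = ⟪g, hφ.toLp φ⟫ := fun g => by
    rw [ud]
    refine al ?_
    filter_upwards [hφ.coeFn_toLp] with p hp
    simp [hp, bk]
  simp only [e]
  exact h.inner ty
theorem sj (hn : 1 ≤ n) (S : SP n) (h : HH n) : ∃ G : Bool → Fin n → Lp ℝ 2 (volume : Measure (Pt n)), ∀ φ, TestFun n φ →
    (∀ i j, ∫ p, ((wt p ^ n)⁻¹ * S.T h (tau p)) * DD n i j φ p = - ∫ p, G i j p * φ p) ∧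
    ∫ p, ∑ j, (G true j p * Xd n j φ p + G false j p * Yd n j φ p) = 4 * n^2 * ∫ p, (wt p ^ (n+2))⁻¹ * h (tau p) * φ p := by
  have hn1 : (1:ℝ) ≤ n := by exact_mod_cast hn
  have hmem := fun y i j => DDmem (vvR hn y) (by linarith) i j
  set g : Bool → Fin n → FV → Lp ℝ 2 (volume : Measure (Pt n)) := fun i j y => (hmem y i j).toLp _ with hg
  have hseq : ∃ y : ℕ → FV, Tendsto (fun m => EE n (Lc n (y m))) atTop (𝓝 h) := by
    have := S.dense h
    rw [mem_closure_iff_seq_limit] at this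
    obtain ⟨x, h1, h2⟩ := this
    choose y hy using h1
    exact ⟨y, by simpa only [hy] using h2⟩
  obtain ⟨y, hy⟩ := hseq
  have hT : Tendsto (fun m => EE n (y m)) atTop (𝓝 (S.T h)) := by
    have := (S.T.continuous.tendsto h).comp hy
    simpa only [cg, S.hE] using this
  have hle : ∀ i j a b, ‖g i j a - g i j b‖ ≤ 2 * n * ‖EE n (Lc n a) - EE n (Lc n b)‖ := fun i j a b => by
    have e1 : vv n (a - b) = fun p => vv n a p - vv n b p := by ext p; simp [vv, mul_sub]
    have e2 : g i j a - g i j b = g i j (a - b) := by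
      rw [hg]; simp only
      rw [← MemLp.toLp_sub]
      refine qp _ _ (ab fun p => ?_)
      rw [e1, DDsub (vvR hn a) (vvR hn b)]; rfl
    have e3 : ‖g i j (a - b)‖ ^ 2 = ∫ p, (DD n i j (vv n (a - b)) p) ^ 2 := by
      rw [← bp, ud]
      refine al ?_
      filter_upwards [(hmem (a - b) i j).coeFn_toLp] with p hp
      simp [hg, hp, sq]
    have e4 := energy hn S (a - b) i j
    rw [← e3, map_sub, map_sub] at e4
    rw [e2]
    refine qx ?_ (by positivity) |>.2
    rw [ci, ci]; linarith
  have hlim : ∀ i j, ∃ G, Tendsto (fun m => g i j (y m)) atTop (𝓝 G) := fun i j => by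
    refine cauchySeq_tendsto_of_complete ?_
    have hc := hy.cauchySeq
    rw [Metric.cauchySeq_iff] at hc ⊢
    intro ε hε
    obtain ⟨N, hN⟩ := hc (ε / (2 * n)) (by positivity)
    refine ⟨N, fun a ha b hb => ?_⟩
    have := hN a ha b hb
    rw [em, lt_div_iff₀ (by positivity)] at this
    rw [em]
    exact (hle i j _ _).trans_lt (by linarith)
  choose G hG using hlim
  refine ⟨G, fun φ hφ => ?_⟩
  have hd := fun s => ri hφ s
  have hφm : MemLp φ 2 volume := by
    obtain ⟨C, -, h1, -⟩ := (hd (n+1)).bd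
    exact lr (hd 0).diff.continuous.measurable (by linarith) h1
  have hDm : ∀ i j, MemLp (DD n i j φ) 2 volume := fun i j => DDmem (hd n) (by linarith) i j
  have hgi : ∀ i j m {ψ : Pt n → ℝ}, ∫ p, g i j (y m) p * ψ p = ∫ p, DD n i j (vv n (y m)) p * ψ p := fun i j m ψ => by
    refine al ?_
    filter_upwards [(hmem (y m) i j).coeFn_toLp] with p hp
    simp [hg, hp]
  have bdd : ∀ {ψ : Pt n → ℝ} {C : ℝ} (k : ℕ), (∀ p, |ψ p| ≤ C * wt p ^ (-(k:ℝ))) → ∀ p, |ψ p * wt p ^ k| ≤ C := fun {ψ C} k hk p => by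
    have := ad p
    have h1 := hk p
    rw [lb, ← az, bs (by positivity)] at h1
    rwa [bh, bm (a := wt p ^ k) (by positivity)]
  have cw : Measurable (fun p : Pt n => wt p) := bo.measurable
  refine ⟨fun i j => ?_, ?_⟩
  · obtain ⟨hm, C, hC⟩ := DDbd (hd (n + 3/2)) i j
    have hb := bdd (n+2) (fun p => (hC p).trans_eq (by push_cast; ring_nf))
    have t1 := ob (hm.mul (cw.pow_const (n+2))) hb hT
    have t2 := (gw (hG i j) hφm).neg
    have e : ∀ m, ∫ p, EE n (y m) (tau p) * (DD n i j φ p * wt p ^ (n+2)) ∂(mm n) = - ∫ p, g i j (y m) p * φ p := fun m => by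
      rw [oo, hgi, ← DDibp (vvR hn (y m)) (hd 2) (by linarith), fu]
      congr 1; ext p
      rw [ak, ← bc (ef _ _), (iy p _).1, vv]; ring
    have t3 := tx (t1.congr e) t2
    rw [← t3, fu]
    congr 1; ext p
    simp only [Pi.mul_apply, ak]
    rw [← bc (S.T h _), (iy p _).1]; ring
  · obtain ⟨C, -, hC, -⟩ := (hd n).bd
    have t1 := (ob ((hd 0).diff.continuous.measurable.mul (cw.pow_const n)) (bdd n hC) hy).const_mul (4 * (n:ℝ)^2)
    have es : ∀ F : Bool → Fin n → Lp ℝ 2 (volume : Measure (Pt n)), ∫ p, ∑ j, (F true j p * Xd n j φ p + F false j p * Yd n j φ p) = ∑ j, ((∫ p, F true j p * DD n true j φ p) + ∫ p, F false j p * DD n false j φ p) := fun F => by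
      have hi : ∀ i j, Integrable (fun p => F i j p * DD n i j φ p) := fun i j => (jw (F i j)).integrable_mul (hDm i j)
      have h2 : ∀ j, Integrable (fun p => F true j p * Xd n j φ p + F false j p * Yd n j φ p) := fun j => (hi true j).add (hi false j)
      rw [integral_finsetSum _ fun j _ => h2 j]
      exact cr rfl fun j _ => ep (hi true j) (hi false j)
    have t2 : Tendsto (fun m => ∑ j, ((∫ p, g true j (y m) p * DD n true j φ p) + ∫ p, g false j (y m) p * DD n false j φ p)) atTop (𝓝 (∑ j, ((∫ p, G true j p * DD n true j φ p) + ∫ p, G false j p * DD n false j φ p))) :=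
      tendsto_finset_sum _ fun j _ => (gw (hG true j) (hDm true j)).add (gw (hG false j) (hDm false j))
    have e : ∀ m, 4 * (n:ℝ)^2 * ∫ p, EE n (Lc n (y m)) (tau p) * (φ p * wt p ^ n) ∂(mm n) = ∑ j, ((∫ p, g true j (y m) p * DD n true j φ p) + ∫ p, g false j (y m) p * DD n false j φ p) := fun m => by
      rw [← es (fun i j => g i j (y m)), oo, fu, ← ah]
      have := rsol hn (y m) (hd 1) (by norm_num)
      trans ∫ p, φ p * ww n (y m) p
      · congr 1; ext p
        rw [ak, ← bc (ef _ _), (iy p _).2, ww]; ring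
      · rw [← this]
        refine al ?_
        have hA : ∀ i, ∀ᵐ p, ∀ j, g i j (y m) p = DD n i j (vv n (y m)) p := fun i => ae_all_iff.2 fun j => (hmem (y m) i j).coeFn_toLp
        filter_upwards [hA true, hA false] with p h1 h2
        refine cr rfl fun j _ => ?_
        rw [h1, h2]; simp [DD, bk]
    have t3 := tx (t1.congr e) t2
    rw [es, ← t3, fu]
    congr 2; ext p
    simp only [Pi.mul_apply, ak]
    rw [← bc (h _), (iy p _).2]; ring
end HW
namespace HW
open scoped ComplexConjugate RealInnerProductSpace ENNReal
variable {n : ℕ}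
lemma qz (p : Pt n) : znorm n p ^ 2 = zsq p := ki (ez p)
lemma sy (hn : 1 ≤ n) : Qs n - 1 = pn n ∧ n * Qs n = 2 * n + 2 ∧ 0 < Qs n := by
  have : (1:ℝ) ≤ n := by exact_mod_cast hn
  have e : Qs n = (2 * n + 2) / n := by rw [Qs, Qh, show (2:ℝ) * n + 2 - 2 = 2 * n by ring, mul_div_mul_left _ _ (by norm_num)]
  refine ⟨?_, ?_, ?_⟩
  · rw [e, pn]; field_simp; ring
  · rw [e]; field_simp
  · rw [e]; positivity
theorem weak_of (hn : 1 ≤ n) (S : SP n) (h : HH n) {K : ℂ → ℝ} {C : ℝ} (hh : ∀ᵐ τ ∂(nu n), 0 < S.T h τ ∧ S.T h τ ≤ C ∧ h τ = K τ * (S.T h τ) ^ pn n) :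
    ∃ u : Pt n → ℝ, IsWeakSol n (fun p => K (tau p)) u := by
  have hn1 : (1:ℝ) ≤ n := by exact_mod_cast hn
  obtain ⟨q1, q2, q3⟩ := sy hn
  have hae := ow.ae_le (cn hh)
  have hr : ∀ p : Pt n, 0 < 2 * n / wt p := fun p => by have := ad p; positivity
  obtain ⟨G, hG⟩ := sj hn S h
  have hu : Measurable (fun p : Pt n => S.T h (tau p) * (2 * n / wt p) ^ n) := (co _).mul ((bo.measurable.const_div _).pow_const n)
  refine ⟨fun p => S.T h (tau p) * (2 * n / wt p) ^ n, ⟨fun r t => S.T h ⟨r^2, -t⟩ * (2 * n / ‖1 + (⟨r^2, -t⟩ : ℂ)‖) ^ n, fun p => ?_⟩, ?_, ?_, fun p => (fun j => (2*n:ℝ)^n * G true j p, fun j => (2*n:ℝ)^n * G false j p), ⟨fun j => ⟨?_, ?_⟩, fun φ hφ j => ⟨?_, ?_⟩⟩, fun φ hφ => ?_⟩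
  · simp only [qz]; rfl
  · refine (integrable_norm_rpow_iff hu.aestronglyMeasurable (by simpa using q3) my).1 ?_
    rw [ch q3.le]
    refine ((fh (n := n) (s := 2 * n + 2) (by linarith)).const_mul ((C * (2*n)^n) ^ Qs n)).mono' (hu.norm.pow_const _).aestronglyMeasurable ?_
    filter_upwards [hae] with p hp
    have hw := ad p
    have h0 : 0 < C := hp.1.trans_le hp.2.1
    rw [ac (by positivity), ac (nw hp.1.le (by positivity))]
    calc _ ≤ ((C * (2*n)^n) * wt p ^ (-(n:ℝ))) ^ Qs n := by
          refine Real.rpow_le_rpow (nw hp.1.le (by positivity)) ?_ q3.le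
          rw [lb, mo, az, ← bc]
          have := hp.2.1
          gcongr
      _ = _ := by rw [kj (by positivity) (by positivity), ← qn hw.le, neg_mul, q2]
  · filter_upwards [hae] with p hp
    exact mul_pos hp.1 (pow_pos (hr p) n)
  · exact (jw (G true j)).const_mul _
  · exact (jw (G false j)).const_mul _
  · have := (hG φ hφ).1 true j
    simp only [bc, ah]
    rw [← mul_neg, ← this, ← ah]
    congr 1; ext p; rw [mo]; simp only [DD]; simp; ring
  · have := (hG φ hφ).1 false j
    simp only [bc, ah]
    rw [← mul_neg, ← this, ← ah]
    congr 1; ext p; rw [mo]; simp only [DD]; simp; ring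
  · have e1 : ∀ p, gDot n (fun p => (fun j => (2*n:ℝ)^n * G true j p, fun j => (2*n:ℝ)^n * G false j p)) φ p = (2*n:ℝ)^n * ∑ j, (G true j p * Xd n j φ p + G false j p * Yd n j φ p) := fun p => by
      rw [gDot, ap]; exact cr rfl fun j _ => by ring
    simp only [e1]
    rw [ah, (hG φ hφ).2, ← ah, ← ah]
    refine al ?_
    filter_upwards [hae] with p hp
    rw [q1, jd hn hp.1 (hr p), hp.2.2, mo, tl (2 * (n:ℝ))]
    ring
def qs (hn : 1 ≤ n) (τ : ℂ) : Pt n := (fun j => if j = ⟨0, hn⟩ then √τ.re else 0, 0, -τ.im)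
lemma qs_cont (hn : 1 ≤ n) : Continuous (qs hn) := by
  refine Continuous.prodMk (continuous_pi fun j => ?_) (Continuous.prodMk br (by fun_prop))
  by_cases h : j = ⟨0, hn⟩
  · simp only [h, if_true]; fun_prop
  · simp only [h, if_false]; fun_prop
lemma qs_z (hn : 1 ≤ n) (p : Pt n) : znorm n (qs hn (tau p)) = znorm n p ∧ (qs hn (tau p)).2.2 = p.2.2 := by
  refine ⟨?_, by simp [qs, tau]⟩
  have h : √(zsq p) = znorm n p := rfl
  have : zsq (qs hn (tau p)) = zsq p := by
    have : zsq (qs hn (tau p)) = √(zsq p) ^ 2 := by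
      rw [zsq]; simp [qs, tau, ite_pow]
    rw [this, ki (ez p)]
  rw [← h, ← this]; rfl
lemma qs_neg (hn : 1 ≤ n) {τ : ℂ} (h : τ.re ≤ 0) : qs hn τ = (0, 0, -τ.im) := by
  simp only [qs, Real.sqrt_eq_zero_of_nonpos h, ite_self]; rfl
lemma qs_lim (hn : 1 ≤ n) {k : Pt n → ℝ} {c : ℝ} (h : Tendsto k (cocompact (Pt n)) (𝓝 c)) (ha : ∀ t : ℝ, k (0, 0, t) = c) :
    Tendsto (fun τ => k (qs hn τ)) (cocompact ℂ) (𝓝 c) := by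
  intro U hU
  have h1 := h hU
  rw [mem_map, mem_cocompact] at h1 ⊢
  obtain ⟨B, hB, hs⟩ := h1
  refine ⟨(fun p : Pt n => (⟨(p.1 ⟨0, hn⟩)^2, -p.2.2⟩ : ℂ)) '' B, hB.image ?_, fun τ hτ => ?_⟩
  · rw [show (fun p : Pt n => (⟨(p.1 ⟨0, hn⟩)^2, -p.2.2⟩ : ℂ)) = fun p => ((((p.1 ⟨0, hn⟩)^2 : ℝ) : ℂ) + ((-p.2.2 : ℝ) : ℂ) * Complex.I) by ext p; rw [Complex.mk_eq_add_mul_I]]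
    fun_prop
  · by_cases hr : τ.re ≤ 0
    · simp only [Set.mem_preimage]
      rw [qs_neg hn hr, ha]; exact mem_of_mem_nhds hU
    · refine hs fun hq => hτ ⟨qs hn τ, hq, ?_⟩
      apply bz <;> simp [qs]
      exact ki (le_of_not_ge hr)
end HW
/-- Theorem 1.4.
If `k` is bounded, continuous, cylindrically symmetric with locally Hölder profile,
with finite limit `k(∞)` at infinity and `k(0,t) = k(∞)` for every `t`, then
`-Δ_{ℍⁿ} u = (1 + εk) u^{Q*-1}` has a positive cylindrically symmetric finite-energy
weak solution for all `|ε|` small. -/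
theorem webster_existence_perturbative_constant_axis (n : ℕ) (hn : 1 ≤ n)
    (k : Pt n → ℝ) (kinf : ℝ)
    (hkbd : ∃ C : ℝ, ∀ p : Pt n, |k p| ≤ C)
    (hkcont : Continuous k)
    (hkcyl : CylHolder n k)
    (hklim : Tendsto k (cocompact (Pt n)) (𝓝 kinf))
    (haxis : ∀ t : ℝ, k (0, 0, t) = kinf) :
    ∃ ε₀ : ℝ, 0 < ε₀ ∧ ∀ ε : ℝ, |ε| < ε₀ →
      ∃ u : Pt n → ℝ, IsWeakSol n (fun p => 1 + ε * k p) u := by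
  obtain ⟨C, hC⟩ := hkbd
  obtain ⟨Kt, hK, -⟩ := hkcyl
  obtain ⟨η, hη, S, hS⟩ := HW.exsol hn
  have hC0 : 0 ≤ C := (abs_nonneg _).trans (hC 0)
  refine ⟨η / (C + 1), by positivity, fun ε hε => ?_⟩
  have hc : Continuous (fun τ => 1 + ε * k (HW.qs hn τ)) := continuous_const.add (continuous_const.mul (hkcont.comp (HW.qs_cont hn)))
  have hA : HW.Adm η (fun τ => 1 + ε * k (HW.qs hn τ)) := ⟨hc.measurable, fun τ => by
    rw [lt_div_iff₀ (by positivity)] at hε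
    rw [add_sub_cancel_left, abs_mul]
    have := mul_le_mul_of_nonneg_left (hC (HW.qs hn τ)) (abs_nonneg ε)
    nlinarith [abs_nonneg ε]⟩
  obtain ⟨h, D, hh⟩ := hS hc hA (c := 1 + ε * kinf) (tendsto_const_nhds.add (tendsto_const_nhds.mul (HW.qs_lim hn hklim haxis)))
    (fun τ hτ => by rw [HW.qs_neg hn hτ, haxis])
  obtain ⟨u, hu⟩ := HW.weak_of hn S h hh
  refine ⟨u, ?_⟩
  have : (fun p => 1 + ε * k p) = fun p => 1 + ε * k (HW.qs hn (HW.tau p)) := by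
    ext p; rw [hK p, hK (HW.qs hn _), (HW.qs_z hn p).1, (HW.qs_z hn p).2]
  rw [this]; exact hu
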